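/- arXiv:2205.07599 — 5 statements merged into one kernel-verified Lean document; each statement's English description precedes it below -/
import Mathlib

section
/- Let p > 1 and let p' be its conjugate exponent (1/p + 1/p' = 1). The multiplicative Hilbert operator H_p, defined for a = {a_n}_{n≥2} in l^p by H_p(a)(m) = m^{-1/p} · Σ_{n=2}^∞ a_n / (n^{1/p'} · log(mn)) for m ≥ 2, is a bounded operator on l^p, and its operator norm equals π·csc(π/p). -/
open scoped ENNReal Real

/-- The `l^p` norm of a sequence indexed from `n = 2` (entry `n` of the abstract
sequence corresponds to `a (n)`, and we sum over `n ≥ 2` via the shift `n + 2`). -/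
noncomputable def lpNorm (p : ℝ) (a : ℕ → ℂ) : ℝ≥0∞ :=
  (∑' n : ℕ, (‖a (n + 2)‖₊ : ℝ≥0∞) ^ p) ^ (1 / p)

/-- The multiplicative Hilbert operator `H_p`:
`H_p(a)(m) = m^{-1/p} ∑_{n≥2} a_n / (n^{1/p'} log(mn))`, where `q = p'` is the
conjugate exponent of `p`. -/
noncomputable def multH (p q : ℝ) (a : ℕ → ℂ) : ℕ → ℂ := fun m =>
  ((((m : ℝ) ^ (1 / p))⁻¹ : ℝ) : ℂ) *
    ∑' n : ℕ,
      a (n + 2) /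
        ((((n : ℝ) + 2) ^ (1 / q) * Real.log ((m : ℝ) * ((n : ℝ) + 2)) : ℝ) : ℂ)

section MHaux
open MeasureTheory

lemma mh_union (k : ℕ) (hk : 1 ≤ k) :
    (⋃ n : ℕ, Set.Ioc (Real.log (n + k)) (Real.log (n + k + 1))) = Set.Ioi (Real.log k) := by
  have hk' : (1:ℝ) ≤ k := by exact_mod_cast hk
  have h := iUnion_Ioc_map_succ_eq_Ioi (f := fun n : ℕ => Real.log (n + k)) ?_ ?_
  · simp only [Nat.succ_eq_succ, Nat.succ_eq_add_one, Nat.cast_add, Nat.cast_one, Nat.bot_eq_zero,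
      Nat.cast_zero, zero_add] at h
    rw [← h]
    congr 1
    ext n
    rw [add_right_comm]
  · intro a
    simp only [Nat.bot_eq_zero, Nat.cast_zero, zero_add]
    apply Real.log_le_log (by linarith)
    have : (0:ℝ) ≤ a := Nat.cast_nonneg a
    linarith
  · apply Filter.not_bddAbove_of_tendsto_atTop (l := Filter.atTop)
    exact Real.tendsto_log_atTop.comp
      (Filter.tendsto_atTop_add_const_right _ _ tendsto_natCast_atTop_atTop)

lemma mh_lint (k : ℕ) (hk : 1 ≤ k) (g : ℝ → ℝ≥0∞) :
    ∫⁻ u in Set.Ioi (Real.log k), g u =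
      ∑' n : ℕ, ∫⁻ u in Set.Ioc (Real.log (n + k)) (Real.log (n + k + 1)), g u := by
  have hk' : (1:ℝ) ≤ k := by exact_mod_cast hk
  rw [← mh_union k hk, lintegral_iUnion (fun _ => measurableSet_Ioc)]
  have hm : Monotone (fun n : ℕ => Real.log (n + k)) := by
    intro a b hab
    have : (0:ℝ) ≤ a := Nat.cast_nonneg a
    have : (a:ℝ) ≤ b := by exact_mod_cast hab
    exact Real.log_le_log (by linarith) (by linarith)
  have := hm.pairwise_disjoint_on_Ioc_succ
  simp only [Nat.succ_eq_succ, Nat.succ_eq_add_one, Nat.cast_add, Nat.cast_one] at this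
  convert! this using 4
  ring_nf

lemma mh_sum_le (k : ℕ) (hk : 1 ≤ k) (g : ℝ → ℝ≥0∞) (hg : AntitoneOn g (Set.Ioi 0)) :
    ∑' n : ℕ, ENNReal.ofReal (1 / (n + k + 1)) * g (Real.log (n + k + 1)) ≤
      ∫⁻ u in Set.Ioi (Real.log k), g u := by
  have hk' : (1:ℝ) ≤ k := by exact_mod_cast hk
  rw [mh_lint k hk]
  refine ENNReal.tsum_le_tsum fun n => ?_
  have hn : (0:ℝ) ≤ n := Nat.cast_nonneg n
  have h0 : 0 ≤ Real.log (n + k) := Real.log_nonneg (by linarith)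
  calc _ ≤ ENNReal.ofReal (Real.log (n + k + 1) - Real.log (n+k)) * g (Real.log (n + k + 1)) := by
        gcongr
        rw [← Real.log_div (by positivity) (by positivity)]
        have := Real.one_sub_inv_le_log_of_pos (x := ((n:ℝ)+k+1)/(n+k)) (by positivity)
        refine le_trans (le_of_eq ?_) this
        field_simp
        ring
    _ = ∫⁻ u in Set.Ioc (Real.log (n + k)) (Real.log (n + k + 1)), g (Real.log (n + k + 1)) := by
        rw [setLIntegral_const, Real.volume_Ioc, mul_comm]
    _ ≤ _ := by
        refine setLIntegral_mono' measurableSet_Ioc fun u hu => ?_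
        exact hg (lt_of_le_of_lt h0 hu.1) (lt_of_lt_of_le (lt_of_le_of_lt h0 hu.1) hu.2) hu.2

lemma mh_le_sum (k : ℕ) (hk : 2 ≤ k) (g : ℝ → ℝ≥0∞) (hg : AntitoneOn g (Set.Ioi 0)) :
    ∫⁻ u in Set.Ioi (Real.log k), g u ≤
    ∑' n : ℕ, ENNReal.ofReal (1 / (n + k)) * g (Real.log (n + k)) := by
  have hk' : (2:ℝ) ≤ k := by exact_mod_cast hk
  rw [mh_lint k (by omega)]
  refine ENNReal.tsum_le_tsum fun n => ?_
  have hn : (0:ℝ) ≤ n := Nat.cast_nonneg n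
  have h0 : 0 < Real.log (n + k) := Real.log_pos (by linarith)
  calc _ ≤ ∫⁻ u in Set.Ioc (Real.log (n + k)) (Real.log (n + k + 1)), g (Real.log (n + k)) := by
        refine setLIntegral_mono' measurableSet_Ioc fun u hu => ?_
        exact hg h0 (lt_trans h0 hu.1) hu.1.le
    _ = ENNReal.ofReal (Real.log (n + k + 1) - Real.log (n+k)) * g (Real.log (n + k)) := by
        rw [setLIntegral_const, Real.volume_Ioc, mul_comm]
    _ ≤ _ := by
        gcongr
        rw [← Real.log_div (by positivity) (by positivity)]
        have := Real.log_le_sub_one_of_pos (x := ((n:ℝ)+k+1)/(n+k)) (by positivity)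
        refine le_trans this (le_of_eq ?_)
        field_simp
        ring

lemma mh_holder {p q : ℝ} (hpq : p.HolderConjugate q) (f g : ℕ → ℝ≥0∞) :
    ∑' i, f i * g i ≤ (∑' i, f i ^ p) ^ (1 / p) * (∑' i, g i ^ q) ^ (1 / q) := by
  rw [ENNReal.tsum_eq_iSup_sum]
  refine iSup_le fun s => (ENNReal.inner_le_Lp_mul_Lq s f g hpq).trans ?_
  have := hpq.pos
  have := hpq.symm.pos
  gcongr <;> exact ENNReal.sum_le_tsum _

lemma mh_gamma {a r : ℝ} (ha : 0 < a) (hr : 0 < r) :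
    ∫⁻ t in Set.Ioi (0:ℝ), ENNReal.ofReal (t ^ (a - 1) * Real.exp (-(r * t))) =
      ENNReal.ofReal ((1 / r) ^ a * Real.Gamma a) := by
  have h := Real.integral_rpow_mul_exp_neg_mul_Ioi ha hr
  have hG := Real.Gamma_pos_of_pos ha
  rw [← h, ofReal_integral_eq_lintegral_ofReal]
  · exact .of_integral_ne_zero (by rw [h]; positivity)
  · refine (ae_restrict_iff' measurableSet_Ioi).2 (Filter.Eventually.of_forall fun t ht => ?_)
    have : (0:ℝ) < t := ht
    simp only [Pi.zero_apply]
    positivity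

lemma mh_kernel {s L : ℝ} (hs : 0 < s) (hs1 : s < 1) (hL : 0 < L) :
    ∫⁻ u in Set.Ioi (0:ℝ), ENNReal.ofReal (u ^ (-s) / (L + u)) =
      ENNReal.ofReal (π / Real.sin (π * s) * L ^ (-s)) := by
  have e1 : ∀ u ∈ Set.Ioi (0:ℝ), ENNReal.ofReal (u ^ (-s) / (L + u)) =
      ∫⁻ t in Set.Ioi (0:ℝ), ENNReal.ofReal (u ^ (-s) * Real.exp (-((L + u) * t))) := by
    intro u hu
    have hu : 0 < u := hu
    have h := mh_gamma (a := 1) (r := L + u) one_pos (by positivity)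
    simp only [sub_self, Real.rpow_zero, one_mul, Real.rpow_one, Real.Gamma_one, mul_one] at h
    have h2 : ∀ t : ℝ, ENNReal.ofReal (u ^ (-s) * Real.exp (-((L + u) * t))) =
      ENNReal.ofReal (u ^ (-s)) * ENNReal.ofReal (Real.exp (-((L + u) * t))) :=
      fun t => ENNReal.ofReal_mul (by positivity)
    simp_rw [h2]
    rw [lintegral_const_mul _ (by fun_prop), h, ← ENNReal.ofReal_mul (by positivity)]
    congr 1
    ring
  rw [setLIntegral_congr_fun measurableSet_Ioi e1, lintegral_lintegral_swap (by fun_prop)]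
  have e2 : ∀ t ∈ Set.Ioi (0:ℝ),
      ∫⁻ u in Set.Ioi (0:ℝ), ENNReal.ofReal (u ^ (-s) * Real.exp (-((L + u) * t))) =
      ENNReal.ofReal (Real.Gamma (1 - s)) * ENNReal.ofReal (t ^ (s - 1) * Real.exp (-(L * t))) := by
    intro t ht
    have ht : 0 < t := ht
    have h := mh_gamma (a := 1 - s) (r := t) (by linarith) ht
    have h2 : ∀ u : ℝ, ENNReal.ofReal (u ^ (-s) * Real.exp (-((L + u) * t))) =
      ENNReal.ofReal (Real.exp (-(L * t))) * ENNReal.ofReal (u ^ (1 - s - 1) * Real.exp (-(t * u))) := by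
      intro u
      rw [← ENNReal.ofReal_mul (by positivity), show -((L+u)*t) = -(L * t) + -(t * u) by ring,
        Real.exp_add, show 1 - s - 1 = -s by ring]
      congr 1
      ring
    simp_rw [h2]
    have hG := Real.Gamma_pos_of_pos (show 0 < 1 - s by linarith)
    rw [lintegral_const_mul _ (by fun_prop), h, ← ENNReal.ofReal_mul (by positivity),
      ← ENNReal.ofReal_mul (by positivity)]
    congr 1
    rw [one_div, Real.inv_rpow ht.le, ← Real.rpow_neg ht.le, show -(1-s) = s - 1 by ring]
    ring
  have hG := Real.Gamma_pos_of_pos (show 0 < 1 - s by linarith)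
  rw [setLIntegral_congr_fun measurableSet_Ioi e2, lintegral_const_mul _ (by fun_prop),
    mh_gamma hs hL, ← ENNReal.ofReal_mul (by positivity), ← Real.Gamma_mul_Gamma_one_sub]
  congr 1
  rw [one_div, Real.inv_rpow hL.le, ← Real.rpow_neg hL.le]
  ring

lemma mh_anti {s L : ℝ} (hs : 0 < s) (hL : 0 < L) :
    AntitoneOn (fun u : ℝ => ENNReal.ofReal (u ^ (-s) / (L + u))) (Set.Ioi 0) := by
  intro u hu v hv huv
  have hu : 0 < u := hu
  have hv : 0 < v := hv
  apply ENNReal.ofReal_le_ofReal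
  have := Real.rpow_le_rpow_of_nonpos hu huv (show -s ≤ 0 by linarith)
  gcongr

lemma mh_upper {s L : ℝ} (hs : 0 < s) (hs1 : s < 1) (hL : 0 < L) :
    ∑' n : ℕ, ENNReal.ofReal (1 / ((n:ℝ) + 2) *
      (Real.log ((n:ℝ) + 2) ^ (-s) / (L + Real.log ((n:ℝ) + 2)))) ≤
      ENNReal.ofReal (π / Real.sin (π * s) * L ^ (-s)) := by
  have h := mh_sum_le 1 le_rfl _ (mh_anti hs hL)
  rw [Nat.cast_one, Real.log_one, mh_kernel hs hs1 hL] at h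
  refine le_trans (le_of_eq ?_) h
  congr 1
  ext n
  rw [add_assoc, one_add_one_eq_two, ENNReal.ofReal_mul (by positivity)]

lemma mh_lower {s L : ℝ} (hs : 0 < s) (hs1 : s < 1) (hL : 0 < L) :
    ENNReal.ofReal (π / Real.sin (π * s) * L ^ (-s)) ≤
    ENNReal.ofReal (1 / (1 - s) / L) + ∑' n : ℕ, ENNReal.ofReal (1 / ((n:ℝ) + 2) *
      (Real.log ((n:ℝ) + 2) ^ (-s) / (L + Real.log ((n:ℝ) + 2)))) := by
  have hl2 : 0 < Real.log 2 := Real.log_pos (by norm_num)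
  have hl1 : Real.log 2 < 1 := by linarith [Real.log_two_lt_d9]
  have h := mh_le_sum 2 le_rfl _ (mh_anti hs hL)
  rw [← mh_kernel hs hs1 hL, ← Set.Ioc_union_Ioi_eq_Ioi hl2.le]
  refine (lintegral_union_le _ _ _).trans ?_
  refine add_le_add ?_ (le_trans h (le_of_eq ?_))
  · calc _ ≤ ∫⁻ u in Set.Ioc (0:ℝ) (Real.log 2), ENNReal.ofReal (u ^ (-s) / L) := by
          refine setLIntegral_mono' measurableSet_Ioc fun u hu => ?_
          have hu0 : 0 < u := hu.1
          apply ENNReal.ofReal_le_ofReal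
          gcongr
          linarith
      _ ≤ ∫⁻ u in Set.Ioc (0:ℝ) 1, ENNReal.ofReal (u ^ (-s) / L) :=
          lintegral_mono_set (Set.Ioc_subset_Ioc_right hl1.le)
      _ = ENNReal.ofReal (∫ u in Set.Ioc (0:ℝ) 1, u ^ (-s) / L) := by
          rw [ofReal_integral_eq_lintegral_ofReal]
          · have := (intervalIntegral.intervalIntegrable_rpow' (a := 0) (b := 1)
              (show -1 < -s by linarith))
            rw [intervalIntegrable_iff_integrableOn_Ioc_of_le zero_le_one] at this
            exact Integrable.div_const this L
          · refine (ae_restrict_iff' measurableSet_Ioc).2 (Filter.Eventually.of_forall fun t ht => ?_)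
            have : (0:ℝ) < t := ht.1
            simp only [Pi.zero_apply]
            positivity
      _ ≤ _ := by
          apply ENNReal.ofReal_le_ofReal
          rw [integral_div, ← intervalIntegral.integral_of_le zero_le_one,
            integral_rpow (Or.inl (by linarith)), Real.one_rpow, Real.zero_rpow (by linarith)]
          apply le_of_eq
          ring
  · congr 1
    ext n
    rw [ENNReal.ofReal_mul (by positivity)]
    norm_num

lemma mh_split (M : ℕ) (f : ℕ → ℝ≥0∞) :
    ∑ n ∈ Finset.range M, f n + ∑' n, f (n + M) = ∑' n, f n :=
  Summable.sum_add_tsum_nat_add' (f := f) (k := M) ENNReal.summable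

lemma mh_S {t : ℝ} (ht : 0 < t) :
    ∑' n : ℕ, ENNReal.ofReal (1 / ((n:ℝ) + 2) * Real.log ((n:ℝ) + 2) ^ (-(1 + t))) ≠ ⊤ ∧
    ENNReal.ofReal (1 / t) ≤
      ∑' n : ℕ, ENNReal.ofReal (1 / ((n:ℝ) + 2) * Real.log ((n:ℝ) + 2) ^ (-(1 + t))) := by
  have hl2 : 0 < Real.log 2 := Real.log_pos (by norm_num)
  have hl1 : Real.log 2 < 1 := by linarith [Real.log_two_lt_d9]
  have hanti : AntitoneOn (fun u : ℝ => ENNReal.ofReal (u ^ (-(1 + t)))) (Set.Ioi 0) := by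
    intro u hu v hv huv
    have hu : 0 < u := hu
    apply ENNReal.ofReal_le_ofReal
    exact Real.rpow_le_rpow_of_nonpos hu huv (by linarith)
  have hint := integrableOn_Ioi_rpow_of_lt (a := -(1+t)) (by linarith) hl2
  have hval := integral_Ioi_rpow_of_lt (a := -(1+t)) (by linarith) hl2
  have hl : ∫⁻ u in Set.Ioi (Real.log 2), ENNReal.ofReal (u ^ (-(1 + t))) =
      ENNReal.ofReal (∫ u in Set.Ioi (Real.log 2), u ^ (-(1 + t))) := by
    rw [ofReal_integral_eq_lintegral_ofReal hint]
    refine (ae_restrict_iff' measurableSet_Ioi).2 (Filter.Eventually.of_forall fun u hu => ?_)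
    have : (0:ℝ) < u := hl2.trans hu
    simp only [Pi.zero_apply]
    positivity
  have h1 := mh_sum_le 2 (by norm_num) _ hanti
  have h2 := mh_le_sum 2 le_rfl _ hanti
  rw [Nat.cast_two, hl] at h1 h2
  constructor
  · rw [← mh_split 1, Finset.sum_range_one]
    refine ENNReal.add_ne_top.2 ⟨ENNReal.ofReal_ne_top, ?_⟩
    refine ne_top_of_le_ne_top ENNReal.ofReal_ne_top (le_trans (le_of_eq ?_) h1)
    congr 1
    ext n
    rw [← ENNReal.ofReal_mul (by positivity)]
    push_cast
    rw [add_right_comm]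
  · calc _ ≤ _ := ENNReal.ofReal_le_ofReal ?_
      _ ≤ _ := h2
      _ = _ := ?_
    · rw [hval, show -(1+t)+1 = -t by ring, neg_div_neg_eq]
      gcongr
      exact Real.one_le_rpow_of_pos_of_le_one_of_nonpos hl2 hl1.le (by linarith)
    · congr 1
      ext n
      rw [← ENNReal.ofReal_mul (by positivity)]

end MHaux

lemma mh_main_upper (p q : ℝ) (hp : 1 < p) (hq : 1 / p + 1 / q = 1) (a : ℕ → ℂ) :
    lpNorm p (multH p q a) ≤ ENNReal.ofReal (π * (Real.sin (π / p))⁻¹) * lpNorm p a := by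
  have hpq : p.HolderConjugate q := Real.holderConjugate_iff.2 ⟨hp, by simpa using hq⟩
  have hp0 := hpq.pos
  have hq0 := hpq.symm.pos
  have hq1 := hpq.symm.lt
  set C : ℝ := π * (Real.sin (π / p))⁻¹ with hC
  have hCp : π / Real.sin (π * (1 / p)) = C := by rw [hC, mul_one_div, div_eq_mul_inv]
  have hCq : π / Real.sin (π * (1 / q)) = C := by
    rw [← hCp, ← Real.sin_pi_sub, show π - π * (1/q) = π * (1/p) by
      rw [show 1/p = 1 - 1/q by linarith]; ring]
  have hip : 1 / p < 1 := by rw [div_lt_one hp0]; exact hp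
  have hiq : 1 / q < 1 := by rw [div_lt_one hq0]; exact hq1
  have hip0 : 0 < 1 / p := by positivity
  have hC0 : 0 < C := by
    rw [← hCp]
    have := Real.sin_pos_of_pos_of_lt_pi (x := π * (1/p)) (by positivity) (by nlinarith [Real.pi_pos])
    positivity
  have hℓ : ∀ n : ℕ, 0 < Real.log ((n:ℝ) + 2) := fun n => Real.log_pos (by
    have : (0:ℝ) ≤ n := Nat.cast_nonneg n
    linarith)
  have hx : ∀ n : ℕ, (0:ℝ) < (n:ℝ) + 2 := fun n => by positivity
  -- pointwise bound
  have key : ∀ m : ℕ, (‖multH p q a (m + 2)‖₊ : ℝ≥0∞) ^ p ≤ ENNReal.ofReal (C ^ (p / q)) *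
      ∑' n : ℕ, (‖a (n + 2)‖₊ : ℝ≥0∞) ^ p * (ENNReal.ofReal (Real.log ((n:ℝ) + 2) ^ (1 / q)) *
        ENNReal.ofReal (1 / ((m:ℝ) + 2) * (Real.log ((m:ℝ) + 2) ^ (-(1 / q)) /
          (Real.log ((n:ℝ) + 2) + Real.log ((m:ℝ) + 2))))) := by
    intro m
    have hm := hℓ m
    have hxm := hx m
    have s1 : (‖multH p q a (m + 2)‖₊ : ℝ≥0∞) ≤ ENNReal.ofReal (((m:ℝ) + 2) ^ (-(1 / p))) *
        ∑' n : ℕ, ((‖a (n + 2)‖₊ : ℝ≥0∞) * ENNReal.ofReal (Real.log ((n:ℝ) + 2) ^ (1 / (p * q)) *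
          (1 / (Real.log ((m:ℝ) + 2) + Real.log ((n:ℝ) + 2))) ^ (1 / p))) *
          ENNReal.ofReal (((n:ℝ) + 2) ^ (-(1 / q)) * Real.log ((n:ℝ) + 2) ^ (-(1 / (p * q))) *
          (1 / (Real.log ((m:ℝ) + 2) + Real.log ((n:ℝ) + 2))) ^ (1 / q)) := by
      rw [← enorm_eq_nnnorm, multH, enorm_mul]
      refine mul_le_mul' ?_ (enorm_tsum_le_tsum_enorm.trans (ENNReal.tsum_le_tsum fun n => ?_))
      · rw [← ofReal_norm, Complex.norm_real, Real.norm_of_nonneg (by positivity)]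
        push_cast
        rw [Real.rpow_neg hxm.le]
      · have hn := hℓ n
        have hxn := hx n
        rw [div_eq_mul_inv, enorm_mul, mul_assoc, ← enorm_eq_nnnorm]
        gcongr
        rw [show (((m + 2 : ℕ) : ℝ)) = (m:ℝ) + 2 by push_cast; rfl]
        rw [Real.log_mul hxm.ne' hxn.ne', ← Complex.ofReal_inv, ← ofReal_norm,
          Complex.norm_real, Real.norm_of_nonneg (by positivity), ← ENNReal.ofReal_mul (by positivity)]
        apply ENNReal.ofReal_le_ofReal
        apply le_of_eq
        set k := Real.log ((m:ℝ) + 2) + Real.log ((n:ℝ) + 2) with hk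
        have hk0 : 0 < k := by positivity
        have e1 : (1 / k) ^ (1 / p) * (1 / k) ^ (1 / q) = 1 / k := by
          rw [← Real.rpow_add (by positivity), hq, Real.rpow_one]
        have e2 : Real.log ((n:ℝ) + 2) ^ (1 / (p * q)) * Real.log ((n:ℝ) + 2) ^ (-(1 / (p * q))) = 1 := by
          rw [← Real.rpow_add hn, add_neg_cancel, Real.rpow_zero]
        rw [Real.rpow_neg hxn.le]
        calc _ = (((n:ℝ) + 2) ^ (1 / q))⁻¹ * 1 * (1 / k) := by
              rw [mul_inv, one_div k, mul_one]
          _ = _ := by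
              have : (1 / k) ^ (1 / q) * (1 / k) ^ (1 / p) = 1 / k := by rw [mul_comm, e1]
              linear_combination (-(((n:ℝ) + 2) ^ (1 / q))⁻¹) * ((1/k) * e2 +
                (Real.log ((n:ℝ) + 2) ^ (1 / (p * q)) * Real.log ((n:ℝ) + 2) ^ (-(1 / (p * q)))) * e1)
    have s2 := s1.trans (mul_le_mul_right (mh_holder hpq _ _) _)
    have s3 := ENNReal.rpow_le_rpow s2 hp0.le
    refine s3.trans ?_
    rw [ENNReal.mul_rpow_of_nonneg _ _ hp0.le, ENNReal.mul_rpow_of_nonneg _ _ hp0.le,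
      ← ENNReal.rpow_mul, ← ENNReal.rpow_mul, one_div_mul_cancel hp0.ne', ENNReal.rpow_one]
    have hg : ∑' n : ℕ, ENNReal.ofReal (((n:ℝ) + 2) ^ (-(1 / q)) * Real.log ((n:ℝ) + 2) ^ (-(1 / (p * q))) *
          (1 / (Real.log ((m:ℝ) + 2) + Real.log ((n:ℝ) + 2))) ^ (1 / q)) ^ q ≤
          ENNReal.ofReal (C * Real.log ((m:ℝ) + 2) ^ (-(1 / p))) := by
      have := mh_upper hip0 hip hm
      rw [hCp] at this
      refine le_trans (le_of_eq ?_) this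
      congr 1
      ext n
      have hn := hℓ n
      have hxn := hx n
      rw [ENNReal.ofReal_rpow_of_nonneg (by positivity) hq0.le]
      congr 1
      rw [Real.mul_rpow (by positivity) (by positivity), Real.mul_rpow (by positivity) (by positivity),
        ← Real.rpow_mul hxn.le, ← Real.rpow_mul hn.le, ← Real.rpow_mul (by positivity),
        one_div_mul_cancel hq0.ne', Real.rpow_one, neg_mul, one_div_mul_cancel hq0.ne',
        Real.rpow_neg_one, show -(1 / (p * q)) * q = -(1/p) by field_simp]
      ring
    have hg2 := ENNReal.rpow_le_rpow hg (show 0 ≤ 1 / q * p by positivity)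
    rw [ENNReal.ofReal_rpow_of_nonneg (by positivity) (by positivity),
      Real.mul_rpow hC0.le (by positivity), ← Real.rpow_mul hm.le,
      show -(1 / p) * (1 / q * p) = -(1/q) by field_simp, show 1 / q * p = p / q by ring] at hg2
    rw [show 1 / q * p = p / q by ring]
    refine (mul_le_mul_right (mul_le_mul_right hg2 _) _).trans ?_
    · · rw [← ENNReal.tsum_mul_right, ← ENNReal.tsum_mul_left, ← ENNReal.tsum_mul_left]
        refine ENNReal.tsum_le_tsum fun n => le_of_eq ?_
        have hn := hℓ n
        have hxn := hx n
        rw [ENNReal.mul_rpow_of_nonneg _ _ hp0.le, ENNReal.ofReal_rpow_of_nonneg (by positivity) hp0.le,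
          ENNReal.ofReal_rpow_of_nonneg (by positivity) hp0.le,
          Real.mul_rpow (by positivity) (by positivity), ← Real.rpow_mul hxm.le, neg_mul,
          one_div_mul_cancel hp0.ne', Real.rpow_neg_one, ← Real.rpow_mul hn.le,
          ← Real.rpow_mul (by positivity), one_div_mul_cancel hp0.ne', Real.rpow_one,
          show 1 / (p * q) * p = 1 / q by field_simp, ← ENNReal.ofReal_mul (by positivity)]
        rw [mul_left_comm (ENNReal.ofReal (C ^ (p/q))), mul_assoc (_ ^ p), mul_left_comm _ (_ ^ p),
          ← ENNReal.ofReal_mul (by positivity), ← ENNReal.ofReal_mul (by positivity),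
          ← ENNReal.ofReal_mul (by positivity)]
        congr 2
        rw [add_comm (Real.log ((n:ℝ) + 2))]
        ring
  have total : ∑' m : ℕ, (‖multH p q a (m + 2)‖₊ : ℝ≥0∞) ^ p ≤
      ENNReal.ofReal C ^ p * ∑' n : ℕ, (‖a (n + 2)‖₊ : ℝ≥0∞) ^ p := by
    refine (ENNReal.tsum_le_tsum key).trans ?_
    rw [ENNReal.tsum_mul_left, ENNReal.tsum_comm]
    simp_rw [ENNReal.tsum_mul_left]
    calc _ ≤ ENNReal.ofReal (C ^ (p / q)) * ∑' n : ℕ, (‖a (n + 2)‖₊ : ℝ≥0∞) ^ p * ENNReal.ofReal C := by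
          gcongr with n
          have hn := hℓ n
          have := mh_upper (s := 1 / q) (by positivity) hiq hn
          rw [hCq] at this
          refine (mul_le_mul_right this _).trans (le_of_eq ?_)
          rw [← ENNReal.ofReal_mul (by positivity), mul_left_comm, ← Real.rpow_add hn, add_neg_cancel,
            Real.rpow_zero, mul_one]
      _ = _ := by
          rw [ENNReal.tsum_mul_right, mul_left_comm, mul_comm, ← ENNReal.ofReal_mul (by positivity),
            ENNReal.ofReal_rpow_of_nonneg hC0.le hp0.le]
          congr 2
          rw [← Real.rpow_add_one hC0.ne']
          congr 1
          have : q = p / (p - 1) := hpq.conjugate_eq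
          rw [this]
          have : p - 1 ≠ 0 := by linarith
          field_simp
          ring
  rw [lpNorm, lpNorm]
  refine (ENNReal.rpow_le_rpow total hip0.le).trans (le_of_eq ?_)
  rw [ENNReal.mul_rpow_of_nonneg _ _ hip0.le, ← ENNReal.rpow_mul, mul_one_div_cancel hp0.ne',
    ENNReal.rpow_one]

lemma mh_test {p q : ℝ} (hq : 1 / p + 1 / q = 1) {s : ℝ} (hs : 0 < s) (hs1 : s < 1)
    (a : ℕ → ℂ) (ha : a = fun n : ℕ =>
      (((n : ℝ) ^ (-(1 / p)) * Real.log (n : ℝ) ^ (-s) : ℝ) : ℂ)) (m : ℕ) :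
    (‖multH p q a (m + 2)‖₊ : ℝ≥0∞) = ENNReal.ofReal (((m:ℝ) + 2) ^ (-(1 / p))) *
      ∑' n : ℕ, ENNReal.ofReal (1 / ((n:ℝ) + 2) *
        (Real.log ((n:ℝ) + 2) ^ (-s) / (Real.log ((m:ℝ) + 2) + Real.log ((n:ℝ) + 2)))) := by
  have hℓ : ∀ n : ℕ, 0 < Real.log ((n:ℝ) + 2) := fun n => Real.log_pos (by
    have : (0:ℝ) ≤ n := Nat.cast_nonneg n
    linarith)
  have hx : ∀ n : ℕ, (0:ℝ) < (n:ℝ) + 2 := fun n => by positivity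
  have hm := hℓ m
  have hxm := hx m
  have hup := mh_upper hs hs1 hm
  have hnn : ∀ n : ℕ, 0 ≤ 1 / ((n:ℝ) + 2) *
        (Real.log ((n:ℝ) + 2) ^ (-s) / (Real.log ((m:ℝ) + 2) + Real.log ((n:ℝ) + 2))) := by
    intro n
    have := hℓ n
    positivity
  have hsum : Summable fun n : ℕ => 1 / ((n:ℝ) + 2) *
        (Real.log ((n:ℝ) + 2) ^ (-s) / (Real.log ((m:ℝ) + 2) + Real.log ((n:ℝ) + 2))) := by
    have := ENNReal.summable_toReal (ne_top_of_le_ne_top ENNReal.ofReal_ne_top hup)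
    refine this.congr fun n => ENNReal.toReal_ofReal (hnn n)
  rw [← enorm_eq_nnnorm, multH, enorm_mul]
  congr 1
  · rw [← ofReal_norm, Complex.norm_real, Real.norm_of_nonneg (by positivity)]
    push_cast
    rw [Real.rpow_neg hxm.le]
  · rw [← ENNReal.ofReal_tsum_of_nonneg hnn hsum]
    have : ∀ n : ℕ, a (n + 2) / ((((n : ℝ) + 2) ^ (1 / q) *
        Real.log (((m + 2 : ℕ) : ℝ) * ((n : ℝ) + 2)) : ℝ) : ℂ) = ((1 / ((n:ℝ) + 2) *
        (Real.log ((n:ℝ) + 2) ^ (-s) / (Real.log ((m:ℝ) + 2) + Real.log ((n:ℝ) + 2))) : ℝ) : ℂ) := by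
      intro n
      have hn := hℓ n
      have hxn := hx n
      rw [ha]
      simp only
      rw [← Complex.ofReal_div]
      congr 1
      rw [show (((m + 2 : ℕ) : ℝ)) = (m:ℝ) + 2 by push_cast; rfl,
        show (((n + 2 : ℕ) : ℝ)) = (n:ℝ) + 2 by push_cast; rfl, Real.log_mul hxm.ne' hxn.ne']
      have e : ((n:ℝ) + 2) ^ (1 / p) * ((n:ℝ) + 2) ^ (1 / q) = (n:ℝ) + 2 := by
        rw [← Real.rpow_add hxn, hq, Real.rpow_one]
      rw [Real.rpow_neg hxn.le]
      calc _ = 1 / (((n:ℝ) + 2) ^ (1 / p) * ((n:ℝ) + 2) ^ (1 / q)) *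
        (Real.log ((n:ℝ) + 2) ^ (-s) / (Real.log ((m:ℝ) + 2) + Real.log ((n:ℝ) + 2))) := by
            field_simp
        _ = _ := by rw [e]
    simp_rw [this]
    rw [← Complex.ofReal_tsum, ← ofReal_norm, Complex.norm_real,
      Real.norm_of_nonneg (tsum_nonneg hnn)]

open Filter Topology in
lemma mh_eps {p : ℝ} (hp : 1 < p) {c : ℝ} (hc : c < π * (Real.sin (π / p))⁻¹) :
    ∃ M : ℕ, ∀ᶠ ε in 𝓝[>] (0:ℝ), 1 / p + ε < 1 ∧ ∀ m : ℕ, M ≤ m →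
      c ≤ π / Real.sin (π * (1 / p + ε)) -
        Real.log ((m:ℝ) + 2) ^ (1 / p + ε - 1) / (1 - (1 / p + ε)) := by
  have hp0 : 0 < p := by linarith
  have hip : 1 / p < 1 := by rw [div_lt_one hp0]; exact hp
  have hip0 : 0 < 1 / p := by positivity
  have h1 : Tendsto (fun X : ℝ => π * (Real.sin (π / p))⁻¹ - X ^ (1 / p - 1) / (1 - 1 / p))
      atTop (𝓝 (π * (Real.sin (π / p))⁻¹ - 0 / (1 - 1 / p))) := by
    refine Tendsto.const_sub _ (Tendsto.div_const ?_ _)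
    have := tendsto_rpow_neg_atTop (y := 1 - 1 / p) (by linarith)
    simpa using this
  rw [zero_div, sub_zero] at h1
  obtain ⟨X, hX1, hX⟩ := ((eventually_ge_atTop (1:ℝ)).and (h1.eventually (lt_mem_nhds hc))).exists
  have hlog : Tendsto (fun m : ℕ => Real.log ((m:ℝ) + 2)) atTop atTop :=
    Real.tendsto_log_atTop.comp
      (tendsto_atTop_add_const_right _ _ tendsto_natCast_atTop_atTop)
  obtain ⟨M, hM⟩ := eventually_atTop.1 (hlog.eventually (eventually_ge_atTop X))
  refine ⟨M, ?_⟩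
  have hsin : 0 < Real.sin (π * (1 / p)) :=
    Real.sin_pos_of_pos_of_lt_pi (by positivity) (by nlinarith [Real.pi_pos])
  have hcont : ContinuousAt (fun ε : ℝ => π / Real.sin (π * (1 / p + ε)) -
        X ^ (1 / p + ε - 1) / (1 - (1 / p + ε))) 0 := by
    refine ContinuousAt.sub (ContinuousAt.div (by fun_prop) (by fun_prop) ?_)
      (ContinuousAt.div ?_ (by fun_prop) ?_)
    · rw [add_zero]; exact hsin.ne'
    · refine ContinuousAt.rpow (by fun_prop) (by fun_prop) (Or.inl (by positivity))
    · rw [add_zero]; linarith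
  have hev : ∀ᶠ ε in 𝓝 (0:ℝ), c < π / Real.sin (π * (1 / p + ε)) -
        X ^ (1 / p + ε - 1) / (1 - (1 / p + ε)) := by
    refine hcont.eventually (lt_mem_nhds ?_)
    simpa only [add_zero, mul_one_div, div_eq_mul_inv π (Real.sin _)] using hX
  have hev2 : ∀ᶠ ε in 𝓝 (0:ℝ), ε < 1 - 1 / p := gt_mem_nhds (by linarith)
  filter_upwards [hev.filter_mono nhdsWithin_le_nhds, hev2.filter_mono nhdsWithin_le_nhds] with ε h h'
  refine ⟨by linarith, fun m hm => h.le.trans ?_⟩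
  have : 0 < 1 - (1 / p + ε) := by linarith
  have := Real.rpow_le_rpow_of_nonpos (by linarith) (hM m hm)
    (show 1 / p + ε - 1 ≤ 0 by linarith)
  gcongr

open Filter Topology in
lemma mh_main_lower (p q : ℝ) (hp : 1 < p) (hq : 1 / p + 1 / q = 1) (C : ℝ≥0∞)
    (hC : ∀ a : ℕ → ℂ, lpNorm p a ≠ ⊤ → lpNorm p (multH p q a) ≤ C * lpNorm p a) :
    ENNReal.ofReal (π * (Real.sin (π / p))⁻¹) ≤ C := by
  have hp0 : 0 < p := by linarith
  have hip : 1 / p < 1 := by rw [div_lt_one hp0]; exact hp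
  have hip0 : 0 < 1 / p := by positivity
  have hl2 : 0 < Real.log 2 := Real.log_pos (by norm_num)
  have hl1 : Real.log 2 < 1 := by linarith [Real.log_two_lt_d9]
  have hℓ : ∀ n : ℕ, 0 < Real.log ((n:ℝ) + 2) := fun n => Real.log_pos (by
    have : (0:ℝ) ≤ n := Nat.cast_nonneg n
    linarith)
  have hx : ∀ n : ℕ, (0:ℝ) < (n:ℝ) + 2 := fun n => by positivity
  refine ENNReal.le_of_forall_nnreal_lt fun c hc => ?_
  by_contra! hCc
  lift C to NNReal using hCc.ne_top
  have hCc' : (C:ℝ) < c := by exact_mod_cast hCc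
  have hC0 : (0:ℝ) ≤ C := C.2
  have hc0 : (0:ℝ) < c := lt_of_le_of_lt hC0 hCc'
  have hc' : (c:ℝ) < π * (Real.sin (π / p))⁻¹ := by
    rw [ENNReal.lt_ofReal_iff_toReal_lt ENNReal.coe_ne_top] at hc
    simpa using hc
  obtain ⟨M, hM⟩ := mh_eps hp hc'
  set B : ℝ := Real.log 2 ^ (-(1 + p)) with hB
  have hB0 : 0 < B := by positivity
  have hgap : 0 < (c:ℝ) ^ p - (C:ℝ) ^ p := by
    have := Real.rpow_lt_rpow hC0 hCc' hp0
    linarith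
  set E : ℝ := ((c:ℝ) ^ p - (C:ℝ) ^ p) / (p * ((c:ℝ) ^ p * (M * B) + 1)) with hE
  have hE0 : 0 < E := by positivity
  have hev1 : ∀ᶠ ε in 𝓝[>] (0:ℝ), ε < E := (gt_mem_nhds hE0).filter_mono nhdsWithin_le_nhds
  have hev2 : ∀ᶠ ε in 𝓝[>] (0:ℝ), ε < 1 := (gt_mem_nhds one_pos).filter_mono nhdsWithin_le_nhds
  obtain ⟨ε, ⟨hs1, hMε⟩, hεE, hε1, hε0⟩ :=
    (hM.and (hev1.and (hev2.and self_mem_nhdsWithin))).exists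
  have hε0 : 0 < ε := hε0
  set s := 1 / p + ε with hs
  have hs0 : 0 < s := by positivity
  have hsp : s * p = 1 + ε * p := by rw [hs]; field_simp
  set a : ℕ → ℂ := fun n : ℕ =>
      (((n : ℝ) ^ (-(1 / p)) * Real.log (n : ℝ) ^ (-s) : ℝ) : ℂ) with ha
  set w : ℕ → ℝ := fun n => 1 / ((n:ℝ) + 2) * Real.log ((n:ℝ) + 2) ^ (-(1 + ε * p)) with hw
  have hw0 : ∀ n, 0 ≤ w n := fun n => by
    have := hℓ n
    simp only [hw]
    positivity
  have hwp : ∀ n : ℕ, (((n:ℝ) + 2) ^ (-(1 / p)) * Real.log ((n:ℝ) + 2) ^ (-s)) ^ p = w n := by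
    intro n
    have hn := hℓ n
    have hxn := hx n
    rw [Real.mul_rpow (by positivity) (by positivity), ← Real.rpow_mul hxn.le,
      ← Real.rpow_mul hn.le, neg_mul, neg_mul, hsp, one_div_mul_cancel hp0.ne', Real.rpow_neg_one,
      ← one_div]
  obtain ⟨hSt, hSl⟩ := mh_S (t := ε * p) (by positivity)
  change ∑' n, ENNReal.ofReal (w n) ≠ ⊤ at hSt
  change _ ≤ ∑' n, ENNReal.ofReal (w n) at hSl
  have hnorm : ∑' n : ℕ, (‖a (n + 2)‖₊ : ℝ≥0∞) ^ p = ∑' n, ENNReal.ofReal (w n) := by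
    congr 1
    ext n
    have hn := hℓ n
    have hxn := hx n
    rw [← enorm_eq_nnnorm, ha]
    simp only
    rw [← ofReal_norm, Complex.norm_real,
      show (((n + 2 : ℕ) : ℝ)) = (n:ℝ) + 2 by push_cast; rfl, Real.norm_of_nonneg (by positivity),
      ENNReal.ofReal_rpow_of_nonneg (by positivity) hp0.le, hwp]
  have hfin : lpNorm p a ≠ ⊤ := by
    rw [lpNorm, hnorm]
    exact ENNReal.rpow_ne_top_of_nonneg hip0.le hSt
  have h1 := ENNReal.rpow_le_rpow (hC a hfin) hp0.le
  rw [lpNorm, lpNorm, hnorm, ENNReal.mul_rpow_of_nonneg _ _ hp0.le, ← ENNReal.rpow_mul,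
    ← ENNReal.rpow_mul, one_div_mul_cancel hp0.ne', ENNReal.rpow_one, ENNReal.rpow_one] at h1
  have hlow : ∀ m : ℕ, M ≤ m → (c:ℝ≥0∞) ^ p * ENNReal.ofReal (w m) ≤
      (‖multH p q a (m + 2)‖₊ : ℝ≥0∞) ^ p := by
    intro m hm
    have hℓm := hℓ m
    have hxm := hx m
    have h2 := mh_lower hs0 hs1 hℓm
    set K := ∑' n : ℕ, ENNReal.ofReal (1 / ((n:ℝ) + 2) *
        (Real.log ((n:ℝ) + 2) ^ (-s) / (Real.log ((m:ℝ) + 2) + Real.log ((n:ℝ) + 2)))) with hK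
    have h1s : 0 < 1 - s := by linarith
    have h3 : ENNReal.ofReal (c * Real.log ((m:ℝ) + 2) ^ (-s)) ≤ K := by
      have h4 : ENNReal.ofReal (1 / (1 - s) / Real.log ((m:ℝ) + 2)) +
          ENNReal.ofReal (c * Real.log ((m:ℝ) + 2) ^ (-s)) ≤
          ENNReal.ofReal (1 / (1 - s) / Real.log ((m:ℝ) + 2)) + K := by
        refine le_trans ?_ h2
        rw [← ENNReal.ofReal_add (by positivity) (by positivity)]
        apply ENNReal.ofReal_le_ofReal
        have h5 := mul_le_mul_of_nonneg_right (hMε m hm)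
          (Real.rpow_nonneg hℓm.le (-s))
        have e : Real.log ((m:ℝ) + 2) ^ (s - 1) * Real.log ((m:ℝ) + 2) ^ (-s) =
            (Real.log ((m:ℝ) + 2))⁻¹ := by
          rw [← Real.rpow_add hℓm, show s - 1 + -s = -1 by ring, Real.rpow_neg_one]
        rw [sub_mul, div_mul_eq_mul_div (Real.log _ ^ (s - 1)), e] at h5
        have e2 : 1 / (1 - s) / Real.log ((m:ℝ) + 2) = (Real.log ((m:ℝ) + 2))⁻¹ / (1 - s) := by
          field_simp
        rw [e2]
        linarith
      exact (ENNReal.add_le_add_iff_left ENNReal.ofReal_ne_top).1 h4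
    rw [mh_test hq hs0 hs1 a ha m]
    calc _ = (ENNReal.ofReal (((m:ℝ) + 2) ^ (-(1 / p))) *
          ENNReal.ofReal (c * Real.log ((m:ℝ) + 2) ^ (-s))) ^ p := by
          rw [← ENNReal.ofReal_mul (by positivity), mul_left_comm, ENNReal.ofReal_mul hc0.le,
            ENNReal.mul_rpow_of_nonneg _ _ hp0.le, ENNReal.ofReal_coe_nnreal,
            ENNReal.ofReal_rpow_of_nonneg (by positivity) hp0.le, hwp]
      _ ≤ _ := by gcongr
  have hsplit : (c:ℝ≥0∞) ^ p * ∑' n, ENNReal.ofReal (w n) ≤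
      (c:ℝ≥0∞) ^ p * ENNReal.ofReal (M * B) + (C:ℝ≥0∞) ^ p * ∑' n, ENNReal.ofReal (w n) := by
    calc _ = (c:ℝ≥0∞) ^ p * (∑ n ∈ Finset.range M, ENNReal.ofReal (w n)) +
          ∑' n, (c:ℝ≥0∞) ^ p * ENNReal.ofReal (w (n + M)) := by
          rw [← mh_split M, mul_add, ENNReal.tsum_mul_left]
      _ ≤ _ := by
          refine add_le_add ?_ (le_trans ?_ h1)
          · gcongr
            rw [← ENNReal.ofReal_sum_of_nonneg fun i _ => hw0 i]
            apply ENNReal.ofReal_le_ofReal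
            refine (Finset.sum_le_card_nsmul _ _ B fun n _ => ?_).trans (by simp)
            have hn : (0:ℝ) ≤ n := Nat.cast_nonneg n
            have hℓn := hℓ n
            have hll : Real.log 2 ≤ Real.log ((n:ℝ) + 2) :=
              Real.log_le_log (by norm_num) (by linarith)
            calc w n ≤ 1 * Real.log ((n:ℝ) + 2) ^ (-(1 + ε * p)) := by
                  simp only [hw]
                  gcongr
                  rw [div_le_one (by positivity)]
                  linarith
              _ ≤ Real.log 2 ^ (-(1 + ε * p)) := by
                  rw [one_mul]
                  refine Real.rpow_le_rpow_of_nonpos hl2 hll ?_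
                  have : 0 < ε * p := by positivity
                  linarith
              _ ≤ B := Real.rpow_le_rpow_of_exponent_ge hl2 hl1.le (by nlinarith)
          · calc _ ≤ ∑' n, (‖multH p q a (n + M + 2)‖₊ : ℝ≥0∞) ^ p :=
                  ENNReal.tsum_le_tsum fun n => hlow (n + M) (by omega)
              _ ≤ _ := by
                  rw [← mh_split M (fun m : ℕ => (‖multH p q a (m + 2)‖₊ : ℝ≥0∞) ^ p)]
                  exact le_add_self
  lift (∑' n, ENNReal.ofReal (w n)) to NNReal using hSt with S hS
  have hSl' : 1 / (ε * p) ≤ (S:ℝ) := by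
    have := ENNReal.toReal_mono ENNReal.coe_ne_top hSl
    rwa [ENNReal.toReal_ofReal (by positivity), ENNReal.coe_toReal] at this
  have hfinal : (c:ℝ) ^ p * S ≤ (c:ℝ) ^ p * (M * B) + (C:ℝ) ^ p * S := by
    rw [← ENNReal.ofReal_coe_nnreal (p := c), ← ENNReal.ofReal_coe_nnreal (p := C),
      ← ENNReal.ofReal_coe_nnreal (p := S), ENNReal.ofReal_rpow_of_nonneg hc0.le hp0.le,
      ENNReal.ofReal_rpow_of_nonneg hC0 hp0.le, ← ENNReal.ofReal_mul (by positivity),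
      ← ENNReal.ofReal_mul (by positivity), ← ENNReal.ofReal_mul (by positivity),
      ← ENNReal.ofReal_add (by positivity) (by positivity)] at hsplit
    exact (ENNReal.ofReal_le_ofReal_iff (by positivity)).1 hsplit
  have h6 : ((c:ℝ) ^ p - (C:ℝ) ^ p) * (1 / (ε * p)) ≤ (c:ℝ) ^ p * (M * B) := by
    have := mul_le_mul_of_nonneg_left hSl' hgap.le
    linarith
  have h7 : ε * (p * ((c:ℝ) ^ p * (M * B) + 1)) < (c:ℝ) ^ p - (C:ℝ) ^ p := by
    rw [hE, lt_div_iff₀ (by positivity)] at hεE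
    exact hεE
  rw [mul_one_div, div_le_iff₀ (by positivity)] at h6
  have : 0 < ε * p := by positivity
  nlinarith

/-- **(Brevig et al.)** For `p > 1` the multiplicative Hilbert operator `H_p` is
bounded on `l^p`, and its operator norm equals `π csc(π/p)`: this value is the least
constant `C` with `‖H_p a‖_p ≤ C ‖a‖_p` for all `a ∈ l^p`. -/
theorem multiplicative_hilbert_norm (p q : ℝ) (hp : 1 < p) (hq : 1 / p + 1 / q = 1) :
    IsLeast {C : ℝ≥0∞ | ∀ a : ℕ → ℂ, lpNorm p a ≠ ⊤ →
        lpNorm p (multH p q a) ≤ C * lpNorm p a}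
      (ENNReal.ofReal (π * (Real.sin (π / p))⁻¹)) := by
  exact ⟨fun a _ => mh_main_upper p q hp hq a, fun C hC => mh_main_lower p q hp hq C hC⟩
end

section
/- Let p > 1, γ > 0, 0 < α ≤ 1, 0 < β ≤ 1, and −1 < μ, ν < p−1. The generalized multiplicative Hilbert operator H^{μ,ν}_{p,α,β,γ} is bounded on l^p if and only if p(γ−1) − (μ−ν) ≥ 0. -/
open scoped ENNReal

/-- The generalized multiplicative Hilbert operator `H^{μ,ν}_{p,α,β,γ}`, where `q = p'`
is the conjugate exponent of `p`. -/
noncomputable def genH (p q α β γ μ ν : ℝ) (a : ℕ → ℂ) : ℕ → ℂ := fun m =>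
  ((Real.log m ^ (((α - 1) + α * μ) / p) / (m : ℝ) ^ (1 / p) : ℝ) : ℂ) *
    ∑' n : ℕ,
      ((Real.log ((n : ℝ) + 2) ^ (((β - 1) - (q - 1) * β * ν) / q) /
          (((n : ℝ) + 2) ^ (1 / q) *
            (Real.log m ^ α + Real.log ((n : ℝ) + 2) ^ β) ^ γ) : ℝ) : ℂ) *
        a (n + 2)


lemma hilb_incr (u ρ η : ℝ) (hu : 0 < u) (hη : 0 ≤ η) (h1 : 1 + η ≤ ρ) (h2 : ρ ≤ 2) :
    η * (u / (1 + u) ^ 2) ≤ 2 * ((ρ * u) / (1 + ρ * u) - u / (1 + u)) := by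
  have hρ : 0 < ρ := by linarith
  have hρu : 0 < ρ * u := by positivity
  have e : 2 * ((ρ * u) / (1 + ρ * u) - u / (1 + u)) = 2 * (u * (ρ - 1)) / ((1 + ρ * u) * (1 + u)) := by
    field_simp
    ring
  rw [e, ← mul_div_assoc, div_le_div_iff₀ (by positivity) (by positivity)]
  have : (1 + ρ * u) ≤ 2 * (1 + u) := by nlinarith
  calc η * u * ((1 + ρ * u) * (1 + u)) ≤ ((ρ - 1) * u) * ((2 * (1 + u)) * (1 + u)) := by
        have : 0 ≤ ρ - 1 := by linarith
        gcongr; linarith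
    _ = _ := by ring

lemma hilb_logpos (n : ℕ) : 1 / 2 ≤ Real.log ((n : ℝ) + 2) := by
  have h2 := Real.log_two_gt_d9
  have : Real.log 2 ≤ Real.log ((n : ℝ) + 2) := by
    apply Real.log_le_log (by norm_num)
    have : (0 : ℝ) ≤ n := n.cast_nonneg
    linarith
  linarith

lemma hilb_term (ε D : ℝ) (hε : 0 < ε) (hε1 : ε ≤ 1) (hD : 0 < D) (n : ℕ) :
    (Real.log ((n : ℝ) + 2) ^ ε / D) / (1 + Real.log ((n : ℝ) + 2) ^ ε / D) ^ 2 /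
      (((n : ℝ) + 2) * Real.log ((n : ℝ) + 2)) ≤
    8 / ε * ((Real.log (((n + 1 : ℕ) : ℝ) + 2) ^ ε / D) / (1 + Real.log (((n + 1 : ℕ) : ℝ) + 2) ^ ε / D)
      - (Real.log ((n : ℝ) + 2) ^ ε / D) / (1 + Real.log ((n : ℝ) + 2) ^ ε / D)) := by
  have hn : (0 : ℝ) ≤ n := n.cast_nonneg
  have hL := hilb_logpos n
  have hL' := hilb_logpos (n + 1)
  have hcast : (((n + 1 : ℕ) : ℝ) + 2) = (n : ℝ) + 3 := by push_cast; ring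
  rw [hcast] at *
  have hdiff : 1 / ((n : ℝ) + 3) ≤ Real.log ((n : ℝ) + 3) - Real.log ((n : ℝ) + 2) := by
    rw [← Real.log_div (by positivity) (by positivity)]
    have := Real.one_sub_inv_le_log_of_pos (x := ((n : ℝ) + 3) / ((n : ℝ) + 2)) (by positivity)
    refine le_trans (le_of_eq ?_) this
    field_simp
    ring
  have hdbl : Real.log ((n : ℝ) + 3) ≤ 2 * Real.log ((n : ℝ) + 2) := by
    have : 2 * Real.log ((n : ℝ) + 2) = Real.log (((n : ℝ) + 2) ^ 2) := by
      rw [Real.log_pow]; norm_num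
    rw [this]
    apply Real.log_le_log (by positivity)
    nlinarith
  set L := Real.log ((n : ℝ) + 2)
  set L' := Real.log ((n : ℝ) + 3)
  have hL0 : 0 < L := by linarith
  have hL0' : 0 < L' := by
    have : 0 < 1 / ((n : ℝ) + 3) := by positivity
    linarith
  have hu : 0 < L ^ ε / D := by positivity
  have e1 : L' ^ ε / D = (L' / L) ^ ε * (L ^ ε / D) := by
    rw [Real.div_rpow hL0'.le hL0.le]
    have : L ^ ε ≠ 0 := by positivity
    field_simp
  have hLL : 0 < L' / L := by positivity
  have h2 : (L' / L) ^ ε ≤ 2 := by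
    calc (L' / L) ^ ε ≤ 2 ^ ε := by
          apply Real.rpow_le_rpow hLL.le _ hε.le
          rw [div_le_iff₀ hL0]; exact hdbl
      _ ≤ 2 ^ (1 : ℝ) := Real.rpow_le_rpow_of_exponent_le (by norm_num) hε1
      _ = 2 := by simp
  have h1 : 1 + ε / (4 * (((n : ℝ) + 2) * L)) ≤ (L' / L) ^ ε := by
    rw [Real.rpow_def_of_pos hLL]
    have a1 := Real.add_one_le_exp (Real.log (L' / L) * ε)
    have a2 := Real.one_sub_inv_le_log_of_pos hLL
    have a3 : 1 / (4 * (((n : ℝ) + 2) * L)) ≤ 1 - (L' / L)⁻¹ := by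
      have : 1 - (L' / L)⁻¹ = (L' - L) / L' := by field_simp
      rw [this]
      calc 1 / (4 * (((n : ℝ) + 2) * L)) = (1 / (2 * ((n : ℝ) + 2))) / (2 * L) := by
            field_simp; norm_num
        _ ≤ (1 / ((n : ℝ) + 3)) / L' := by
            gcongr
            linarith
        _ ≤ _ := by gcongr
    have a4 : ε * (1 / (4 * (((n : ℝ) + 2) * L))) ≤ ε * Real.log (L' / L) := by
      gcongr
      linarith
    have a5 : ε / (4 * (((n : ℝ) + 2) * L)) = ε * (1 / (4 * (((n : ℝ) + 2) * L))) := by ring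
    rw [a5]; linarith
  have key := hilb_incr (L ^ ε / D) ((L' / L) ^ ε) (ε / (4 * (((n : ℝ) + 2) * L))) hu (by positivity) h1 h2
  rw [e1]
  have := mul_le_mul_of_nonneg_left key (a := 4 / ε) (by positivity)
  refine le_trans (le_of_eq ?_) (this.trans (le_of_eq ?_))
  · field_simp
  · ring

lemma hilb_sum (ε D : ℝ) (hε : 0 < ε) (hε1 : ε ≤ 1) (hD : 0 < D) :
    ∑' n : ℕ, ENNReal.ofReal ((Real.log ((n : ℝ) + 2) ^ ε / D) / (1 + Real.log ((n : ℝ) + 2) ^ ε / D) ^ 2 /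
      (((n : ℝ) + 2) * Real.log ((n : ℝ) + 2))) ≤ ENNReal.ofReal (8 / ε) := by
  rw [ENNReal.tsum_eq_iSup_nat]
  refine iSup_le fun N => ?_
  have hpos : ∀ n : ℕ, 0 < Real.log ((n : ℝ) + 2) := fun n => by
    have := hilb_logpos n; linarith
  rw [← ENNReal.ofReal_sum_of_nonneg]
  · apply ENNReal.ofReal_le_ofReal
    refine (Finset.sum_le_sum fun n _ => hilb_term ε D hε hε1 hD n).trans ?_
    rw [← Finset.mul_sum, Finset.sum_range_sub
      (fun n : ℕ => (Real.log ((n : ℝ) + 2) ^ ε / D) / (1 + Real.log ((n : ℝ) + 2) ^ ε / D))]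
    have hb : ∀ u : ℝ, 0 < u → u / (1 + u) ≤ 1 := fun u hu => by
      rw [div_le_one (by linarith)]; linarith
    have h1 : 0 < Real.log ((N : ℝ) + 2) ^ ε / D := by have := hpos N; positivity
    have h0 : 0 < Real.log (((0 : ℕ) : ℝ) + 2) ^ ε / D := by have := hpos 0; positivity
    have h3 : 0 ≤ (Real.log (((0 : ℕ) : ℝ) + 2) ^ ε / D) / (1 + Real.log (((0 : ℕ) : ℝ) + 2) ^ ε / D) := by
      positivity
    have h4 := hb _ h1
    calc _ ≤ 8 / ε * 1 := by
          gcongr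
          linarith
      _ = _ := by ring
  · intro n _
    have := hpos n
    positivity

lemma hilb_phi (r T g e : ℝ) (hr : 0 < r) (he : 0 < e) (heT : e ≤ T) (heg : e ≤ g - T) :
    r ^ T / (1 + r) ^ g ≤ 4 * (r ^ e / (1 + r ^ e) ^ 2) := by
  have hre : 0 < r ^ e := by positivity
  rw [← mul_div_assoc]
  have hg : 0 < g := by linarith
  rcases le_total r 1 with h | h
  · have h1 : r ^ e ≤ 1 := Real.rpow_le_one hr.le h he.le
    have h2 : r ^ T ≤ r ^ e := Real.rpow_le_rpow_of_exponent_ge hr h heT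
    have h3 : 1 ≤ (1 + r) ^ g := Real.one_le_rpow (by linarith) hg.le
    calc r ^ T / (1 + r) ^ g ≤ r ^ e / 1 := by gcongr
      _ ≤ _ := by
        rw [div_le_div_iff₀ (by norm_num) (by positivity)]
        nlinarith [mul_nonneg hre.le (sub_nonneg.2 h1), mul_nonneg hre.le hre.le]
  · have h1 : 1 ≤ r ^ e := Real.one_le_rpow h he.le
    have h3 : r ^ g ≤ (1 + r) ^ g := Real.rpow_le_rpow hr.le (by linarith) hg.le
    calc r ^ T / (1 + r) ^ g ≤ r ^ T / r ^ g := by gcongr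
      _ = r ^ (T - g) := by rw [Real.rpow_sub hr]
      _ ≤ r ^ (-e) := Real.rpow_le_rpow_of_exponent_le h (by linarith)
      _ = 1 / r ^ e := by rw [Real.rpow_neg hr.le, one_div]
      _ ≤ _ := by
        rw [div_le_div_iff₀ (by positivity) (by positivity)]
        nlinarith

open MeasureTheory in
lemma hilb_schur (p q : ℝ) (hpq : p.HolderConjugate q) (F G : ℕ → ℕ → ℝ≥0∞) (b : ℕ → ℝ≥0∞)
    (C1 C2 : ℝ≥0∞) (h1 : ∀ m, ∑' n, (F m n) ^ q ≤ C1) (h2 : ∀ n, ∑' m, (G m n) ^ p ≤ C2) :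
    ∑' m, (∑' n, F m n * G m n * b n) ^ p ≤ C1 ^ (p / q) * C2 * ∑' n, b n ^ p := by
  have hp : 0 < p := hpq.pos
  have hq : 0 < q := hpq.symm.pos
  have step : ∀ m, (∑' n, F m n * G m n * b n) ^ p ≤ C1 ^ (p / q) * ∑' n, (G m n) ^ p * b n ^ p := by
    intro m
    have hol := ENNReal.lintegral_mul_le_Lp_mul_Lq (Measure.count : Measure ℕ) hpq.symm
      (f := F m) (g := fun n => G m n * b n) (by fun_prop) (by fun_prop)
    simp only [lintegral_count, Pi.mul_apply] at hol
    calc (∑' n, F m n * G m n * b n) ^ p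
        = (∑' n, F m n * (G m n * b n)) ^ p := by simp only [mul_assoc]
      _ ≤ ((∑' n, F m n ^ q) ^ (1 / q) * (∑' n, (G m n * b n) ^ p) ^ (1 / p)) ^ p := by
          gcongr
      _ = (∑' n, F m n ^ q) ^ (p / q) * (∑' n, (G m n * b n) ^ p) := by
          rw [ENNReal.mul_rpow_of_nonneg _ _ hp.le, ← ENNReal.rpow_mul, ← ENNReal.rpow_mul]
          rw [show 1 / q * p = p / q by ring, show 1 / p * p = 1 by field_simp, ENNReal.rpow_one]
      _ ≤ C1 ^ (p / q) * ∑' n, (G m n) ^ p * b n ^ p := by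
          simp only [ENNReal.mul_rpow_of_nonneg _ _ hp.le]
          gcongr
          exact h1 m
  calc _ ≤ ∑' m, C1 ^ (p / q) * ∑' n, (G m n) ^ p * b n ^ p := ENNReal.tsum_le_tsum step
    _ = C1 ^ (p / q) * ∑' n, (∑' m, (G m n) ^ p) * b n ^ p := by
        rw [ENNReal.tsum_mul_left, ENNReal.tsum_comm]
        simp only [ENNReal.tsum_mul_right]
    _ ≤ C1 ^ (p / q) * ∑' n, C2 * b n ^ p := by
        gcongr with n
        exact h2 n
    _ = _ := by rw [ENNReal.tsum_mul_left, mul_assoc]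

lemma hilb_kernel_eq (p q α β μ ν M L a b : ℝ) (hp : 0 < p) (hq0 : 0 < q) (hq : 1 / p + 1 / q = 1)
    (hM : 0 < M) (hL : 0 < L) (ha : 0 < a) (hb : 0 < b) :
    M ^ (((α - 1) + α * μ) / p) / a ^ (1 / p) * (L ^ (((β - 1) - (q - 1) * β * ν) / q) /
      (b ^ (1 / q) * (M ^ α + L ^ β) ^ (1 + (μ - ν) / p))) =
    ((L ^ β / M ^ α) ^ (1 / q - ν / p) / (1 + L ^ β / M ^ α) ^ (1 + (μ - ν) / p)) /
      ((b * L) ^ (1 / q) * (a * M) ^ (1 / p)) := by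
  have hx : 0 < M ^ α := by positivity
  have hy : 0 < L ^ β := by positivity
  have e1 : M ^ (((α - 1) + α * μ) / p) = (M ^ α) ^ (1 + (μ - ν) / p) / (M ^ α) ^ (1 / q - ν / p) / M ^ (1 / p) := by
    rw [← Real.rpow_sub hx, ← Real.rpow_mul hM.le, ← Real.rpow_sub hM]
    congr 1
    have : 1 / q = 1 - 1 / p := by linarith
    rw [this]; ring
  have e2 : L ^ (((β - 1) - (q - 1) * β * ν) / q) = (L ^ β) ^ (1 / q - ν / p) / L ^ (1 / q) := by
    rw [← Real.rpow_mul hL.le, ← Real.rpow_sub hL]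
    congr 1
    have : 1 / p = 1 - 1 / q := by linarith
    rw [div_eq_mul_one_div ν p, this]; field_simp; ring
  have e3 : (M ^ α + L ^ β) ^ (1 + (μ - ν) / p) =
      (M ^ α) ^ (1 + (μ - ν) / p) * (1 + L ^ β / M ^ α) ^ (1 + (μ - ν) / p) := by
    rw [← Real.mul_rpow hx.le (by positivity)]
    congr 1
    field_simp
  rw [e1, e2, e3, Real.div_rpow hy.le hx.le, Real.mul_rpow hb.le hL.le, Real.mul_rpow ha.le hM.le]
  have : 0 < 1 + L ^ β / M ^ α := by positivity
  generalize 1 + L ^ β / M ^ α = z at *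
  field_simp

lemma hilb_half_le (L s : ℝ) (hL : 1 / 2 ≤ L) (hs : 0 < s) (hs1 : s ≤ 1) : 1 / 2 ≤ L ^ s := by
  rcases le_total L 1 with h | h
  · have := Real.rpow_le_rpow_of_exponent_ge (by linarith) h hs1
    rw [Real.rpow_one] at this; linarith
  · have := Real.one_le_rpow h hs.le
    linarith

/-- The real kernel. -/
noncomputable def hilbK (p q α β γ μ ν : ℝ) (m n : ℕ) : ℝ :=
  Real.log ((m : ℝ) + 2) ^ (((α - 1) + α * μ) / p) / ((m : ℝ) + 2) ^ (1 / p) *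
    (Real.log ((n : ℝ) + 2) ^ (((β - 1) - (q - 1) * β * ν) / q) /
          (((n : ℝ) + 2) ^ (1 / q) *
            (Real.log ((m : ℝ) + 2) ^ α + Real.log ((n : ℝ) + 2) ^ β) ^ γ))

lemma hilb_genH (p q α β γ μ ν : ℝ) (a : ℕ → ℂ) (m : ℕ) :
    genH p q α β γ μ ν a (m + 2) = ∑' n, (hilbK p q α β γ μ ν m n : ℂ) * a (n + 2) := by
  unfold genH hilbK
  rw [← tsum_mul_left]
  push_cast
  simp only [mul_assoc]

lemma hilbK_nonneg (p q α β γ μ ν : ℝ) (m n : ℕ) : 0 ≤ hilbK p q α β γ μ ν m n := by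
  have h1 := hilb_logpos m
  have h2 := hilb_logpos n
  have h1' : 0 < Real.log ((m : ℝ) + 2) := by linarith
  have h2' : 0 < Real.log ((n : ℝ) + 2) := by linarith
  unfold hilbK
  positivity

lemma hilbK_le (p q α β γ μ ν e : ℝ) (hp : 0 < p) (hq0 : 0 < q) (hq : 1 / p + 1 / q = 1)
    (hα0 : 0 < α) (hα1 : α ≤ 1) (hβ0 : 0 < β) (hβ1 : β ≤ 1) (hγ : 1 + (μ - ν) / p ≤ γ)
    (he : 0 < e) (he1 : e ≤ 1 / q - ν / p) (he2 : e ≤ (1 + (μ - ν) / p) - (1 / q - ν / p)) (m n : ℕ) :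
    hilbK p q α β γ μ ν m n ≤
      (4 * ((Real.log ((n : ℝ) + 2) ^ (e * β) / Real.log ((m : ℝ) + 2) ^ (e * α)) /
        (1 + Real.log ((n : ℝ) + 2) ^ (e * β) / Real.log ((m : ℝ) + 2) ^ (e * α)) ^ 2)) /
      ((((n : ℝ) + 2) * Real.log ((n : ℝ) + 2)) ^ (1 / q) *
        (((m : ℝ) + 2) * Real.log ((m : ℝ) + 2)) ^ (1 / p)) := by
  have h1 := hilb_logpos m
  have h2 := hilb_logpos n
  unfold hilbK
  set M := Real.log ((m : ℝ) + 2)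
  set L := Real.log ((n : ℝ) + 2)
  have hM : 0 < M := by linarith
  have hL : 0 < L := by linarith
  have hx := hilb_half_le M α h1 hα0 hα1
  have hy := hilb_half_le L β h2 hβ0 hβ1
  have hr : 0 < L ^ β / M ^ α := by positivity
  have key := hilb_phi _ _ _ _ hr he he1 he2
  have er : (L ^ β / M ^ α) ^ e = L ^ (e * β) / M ^ (e * α) := by
    rw [Real.div_rpow (by positivity) (by positivity), ← Real.rpow_mul hL.le, ← Real.rpow_mul hM.le,
      mul_comm β, mul_comm α]
  rw [er] at key
  calc _ ≤ M ^ (((α - 1) + α * μ) / p) / ((m : ℝ) + 2) ^ (1 / p) * (L ^ (((β - 1) - (q - 1) * β * ν) / q) /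
      (((n : ℝ) + 2) ^ (1 / q) * (M ^ α + L ^ β) ^ (1 + (μ - ν) / p))) := by
        gcongr
        linarith
    _ ≤ _ := by
        rw [hilb_kernel_eq p q α β μ ν M L _ _ hp hq0 hq hM hL (by positivity) (by positivity)]
        gcongr

lemma hilb_psi_symm (u v : ℝ) (hu : 0 < u) (hv : 0 < v) :
    (u / v) / (1 + u / v) ^ 2 = (v / u) / (1 + v / u) ^ 2 := by
  field_simp
  ring

lemma hilb_upper (p q α β γ μ ν : ℝ) (hp : 1 < p) (hq : 1 / p + 1 / q = 1)
    (hα0 : 0 < α) (hα1 : α ≤ 1) (hβ0 : 0 < β) (hβ1 : β ≤ 1)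
    (hμ1 : -1 < μ) (hν2 : ν < p - 1) (h : 0 ≤ p * (γ - 1) - (μ - ν)) :
    ∃ C : ℝ, 0 < C ∧ ∀ a : ℕ → ℂ, lpNorm p a ≠ ⊤ →
        lpNorm p (genH p q α β γ μ ν a) ≤ ENNReal.ofReal C * lpNorm p a := by
  have hp0 : 0 < p := by linarith
  have hpq : p.HolderConjugate q := by
    rw [Real.holderConjugate_iff]
    exact ⟨hp, by simpa using hq⟩
  have hq0 : 0 < q := hpq.symm.pos
  have hγ : 1 + (μ - ν) / p ≤ γ := by
    have : (μ - ν) / p ≤ γ - 1 := by rw [div_le_iff₀ hp0]; linarith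
    linarith
  have hT : 0 < 1 / q - ν / p := by
    have : 1 / q = (p - 1) / p := by field_simp; field_simp at hq; linarith
    rw [this, ← sub_div]; apply div_pos _ hp0; linarith
  have hT2 : 0 < (1 + (μ - ν) / p) - (1 / q - ν / p) := by
    have : (1 + (μ - ν) / p) - (1 / q - ν / p) = (1 + μ) / p := by
      have : 1 / q = 1 - 1 / p := by linarith
      rw [this]; ring
    rw [this]; apply div_pos _ hp0; linarith
  obtain ⟨e, he, he1, he2, he3⟩ : ∃ e : ℝ, 0 < e ∧ e ≤ 1 ∧ e ≤ 1 / q - ν / p ∧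
      e ≤ (1 + (μ - ν) / p) - (1 / q - ν / p) :=
    ⟨min 1 (min (1 / q - ν / p) ((1 + (μ - ν) / p) - (1 / q - ν / p))),
      lt_min one_pos (lt_min hT hT2), min_le_left _ _, (min_le_right _ _).trans (min_le_left _ _),
      (min_le_right _ _).trans (min_le_right _ _)⟩
  have hlog : ∀ n : ℕ, 0 < Real.log ((n : ℝ) + 2) := fun n => by
    have := hilb_logpos n; linarith
  let ψ : ℕ → ℕ → ℝ := fun m n =>
    (Real.log ((n : ℝ) + 2) ^ (e * β) / Real.log ((m : ℝ) + 2) ^ (e * α)) /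
        (1 + Real.log ((n : ℝ) + 2) ^ (e * β) / Real.log ((m : ℝ) + 2) ^ (e * α)) ^ 2
  have hψ : ∀ m n, 0 < ψ m n := fun m n => by
    have := hlog m
    have := hlog n
    simp only [ψ]; positivity
  let d : ℕ → ℝ := fun n => ((n : ℝ) + 2) * Real.log ((n : ℝ) + 2)
  have hd : ∀ n, 0 < d n := fun n => by
    have := hlog n
    simp only [d]; positivity
  let F : ℕ → ℕ → ℝ≥0∞ := fun m n => ENNReal.ofReal ((4 * (ψ m n / d n)) ^ (1 / q))
  let G : ℕ → ℕ → ℝ≥0∞ := fun m n => ENNReal.ofReal ((4 * (ψ m n / d m)) ^ (1 / p))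
  have hF : ∀ m, ∑' n, F m n ^ q ≤ 4 * ENNReal.ofReal (8 / (e * β)) := by
    intro m
    have : ∀ n, F m n ^ q = 4 * ENNReal.ofReal (ψ m n / d n) := fun n => by
      have h1 := hψ m n
      have h2 := hd n
      simp only [F]
      rw [ENNReal.ofReal_rpow_of_nonneg (by positivity) hq0.le, ← Real.rpow_mul (by positivity),
        one_div, inv_mul_cancel₀ hq0.ne', Real.rpow_one, ENNReal.ofReal_mul (by norm_num)]
      simp
    simp only [this, ENNReal.tsum_mul_left]
    gcongr
    have := hlog m
    exact hilb_sum (e * β) (Real.log ((m : ℝ) + 2) ^ (e * α)) (by positivity) (by nlinarith) (by positivity)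
  have hG : ∀ n, ∑' m, G m n ^ p ≤ 4 * ENNReal.ofReal (8 / (e * α)) := by
    intro n
    have : ∀ m, G m n ^ p = 4 * ENNReal.ofReal (ψ m n / d m) := fun m => by
      have h1 := hψ m n
      have h2 := hd m
      simp only [G]
      rw [ENNReal.ofReal_rpow_of_nonneg (by positivity) hp0.le, ← Real.rpow_mul (by positivity),
        one_div, inv_mul_cancel₀ hp0.ne', Real.rpow_one, ENNReal.ofReal_mul (by norm_num)]
      simp
    simp only [this, ENNReal.tsum_mul_left]
    gcongr
    have hn := hlog n
    have := hilb_sum (e * α) (Real.log ((n : ℝ) + 2) ^ (e * β)) (by positivity) (by nlinarith) (by positivity)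
    refine le_trans (le_of_eq ?_) this
    congr 1
    ext m
    have hm := hlog m
    simp only [ψ, d]
    rw [hilb_psi_symm _ _ (by positivity) (by positivity)]
  have hK : ∀ m n, ENNReal.ofReal (hilbK p q α β γ μ ν m n) ≤ F m n * G m n := by
    intro m n
    have h1 := hψ m n
    have h2 := hd m
    have h3 := hd n
    simp only [F, G]
    rw [← ENNReal.ofReal_mul (by positivity)]
    apply ENNReal.ofReal_le_ofReal
    refine (hilbK_le p q α β γ μ ν e hp0 hq0 hq hα0 hα1 hβ0 hβ1 hγ he he2 he3 m n).trans (le_of_eq ?_)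
    change (4 * ψ m n) / (d n ^ (1 / q) * d m ^ (1 / p)) = _
    generalize ψ m n = z at *
    rw [← mul_div_assoc, ← mul_div_assoc, Real.div_rpow (by positivity) h3.le, Real.div_rpow (by positivity) h2.le,
      div_mul_div_comm, ← Real.rpow_add (by positivity), add_comm, hq, Real.rpow_one]
  set D : ℝ≥0∞ := (4 * ENNReal.ofReal (8 / (e * β))) ^ (p / q) * (4 * ENNReal.ofReal (8 / (e * α))) with hD
  have hDtop : D ^ (1 / p) ≠ ⊤ := by
    apply ENNReal.rpow_ne_top_of_nonneg (by positivity)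
    apply ENNReal.mul_ne_top
    · apply ENNReal.rpow_ne_top_of_nonneg (by positivity)
      exact ENNReal.mul_ne_top (by simp) (by simp)
    · exact ENNReal.mul_ne_top (by simp) (by simp)
  refine ⟨(D ^ (1 / p)).toReal + 1, by positivity, fun a _ => ?_⟩
  have hDle : D ^ (1 / p) ≤ ENNReal.ofReal ((D ^ (1 / p)).toReal + 1) := by
    rw [ENNReal.le_ofReal_iff_toReal_le hDtop (by positivity)]; linarith
  refine le_trans ?_ (mul_le_mul_left hDle _)
  unfold lpNorm
  rw [← ENNReal.mul_rpow_of_nonneg _ _ (by positivity)]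
  apply ENNReal.rpow_le_rpow _ (by positivity)
  refine le_trans ?_ (hilb_schur p q hpq F G (fun n => (‖a (n + 2)‖₊ : ℝ≥0∞)) _ _ hF hG)
  refine ENNReal.tsum_le_tsum fun m => ?_
  apply ENNReal.rpow_le_rpow _ hp0.le
  rw [hilb_genH]
  refine (enorm_tsum_le_tsum_enorm (f := fun n => (hilbK p q α β γ μ ν m n : ℂ) * a (n + 2))).trans ?_
  refine ENNReal.tsum_le_tsum fun n => ?_
  rw [enorm_mul]
  refine mul_le_mul' (le_trans (le_of_eq ?_) (hK m n)) le_rfl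
  rw [← ofReal_norm, Complex.norm_real, Real.norm_of_nonneg (hilbK_nonneg ..)]

lemma hilb_block (s R : ℝ) (hs : 0 < s) (hs1 : s ≤ 1) (hR : 2 ≤ R) :
    ∃ S : Finset ℕ, (∀ n ∈ S, R ≤ Real.log ((n : ℝ) + 2) ^ s ∧ Real.log ((n : ℝ) + 2) ^ s ≤ 2 * R) ∧
      R / 4 ≤ ∑ n ∈ S, Real.log ((n : ℝ) + 2) ^ (s - 1) / ((n : ℝ) + 2) := by
  obtain ⟨X, hX, hXR⟩ : ∃ X : ℝ, 2 ≤ X ∧ X ^ s = R := by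
    refine ⟨R ^ (1 / s), ?_, ?_⟩
    · have : R ^ (1 : ℝ) ≤ R ^ (1 / s) :=
        Real.rpow_le_rpow_of_exponent_le (by linarith) (by rw [le_div_iff₀ hs]; linarith)
      rw [Real.rpow_one] at this; linarith
    · rw [← Real.rpow_mul (by linarith), one_div, inv_mul_cancel₀ hs.ne', Real.rpow_one]
  have hX0 : 0 < X := by linarith
  have hA2 : 2 ≤ ⌈Real.exp X⌉₊ := by
    have h1 := Real.add_one_le_exp X
    have h2 := Nat.le_ceil (Real.exp X)
    have : (2 : ℝ) ≤ (⌈Real.exp X⌉₊ : ℝ) := by linarith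
    exact_mod_cast this
  have hAB : ⌈Real.exp X⌉₊ ≤ ⌈Real.exp (2 * X)⌉₊ := by
    apply Nat.ceil_mono
    apply Real.exp_le_exp.2; linarith
  obtain ⟨A, hA⟩ := Nat.exists_eq_add_of_le' hA2
  obtain ⟨B, hB⟩ := Nat.exists_eq_add_of_le' (hA2.trans hAB)
  have hAB' : A ≤ B := by omega
  have hmem : ∀ n ∈ Finset.Ico A B, X ≤ Real.log ((n : ℝ) + 2) ∧ Real.log ((n : ℝ) + 2) ≤ 2 * X := by
    intro n hn
    rw [Finset.mem_Ico] at hn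
    constructor
    · rw [Real.le_log_iff_exp_le (by positivity)]
      have := Nat.le_ceil (Real.exp X)
      rw [hA] at this
      have h2 : (A : ℝ) ≤ n := by exact_mod_cast hn.1
      push_cast at this; linarith
    · rw [Real.log_le_iff_le_exp (by positivity)]
      have : n + 2 < ⌈Real.exp (2 * X)⌉₊ := by omega
      have := Nat.lt_ceil.1 this
      push_cast at this; exact this.le
  refine ⟨Finset.Ico A B, ?_, ?_⟩
  · intro n hn
    obtain ⟨h1, h2⟩ := hmem n hn
    constructor
    · rw [← hXR]; exact Real.rpow_le_rpow hX0.le h1 hs.le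
    · calc _ ≤ (2 * X) ^ s := Real.rpow_le_rpow (by linarith) h2 hs.le
        _ = 2 ^ s * R := by rw [Real.mul_rpow (by norm_num) hX0.le, hXR]
        _ ≤ 2 ^ (1 : ℝ) * R := by
          gcongr
          norm_num
        _ = 2 * R := by simp
  · have hsum : X / 2 ≤ ∑ n ∈ Finset.Ico A B, 1 / ((n : ℝ) + 2) := by
      have ht : ∀ n ∈ Finset.Ico A B, Real.log (((n + 1 : ℕ) : ℝ) + 2) - Real.log ((n : ℝ) + 2) ≤ 1 / ((n : ℝ) + 2) := by
        intro n _
        rw [← Real.log_div (by positivity) (by positivity)]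
        refine (Real.log_le_sub_one_of_pos (by positivity)).trans (le_of_eq ?_)
        push_cast
        field_simp
        ring
      refine le_trans ?_ (Finset.sum_le_sum ht)
      rw [Finset.sum_Ico_eq_sub _ hAB', Finset.sum_range_sub (fun n : ℕ => Real.log ((n : ℝ) + 2)),
        Finset.sum_range_sub (fun n : ℕ => Real.log ((n : ℝ) + 2))]
      have hb : 2 * X ≤ Real.log ((B : ℝ) + 2) := by
        rw [Real.le_log_iff_exp_le (by positivity)]
        have := Nat.le_ceil (Real.exp (2 * X))
        rw [hB] at this
        push_cast at this; exact this
      have ha : Real.log ((A : ℝ) + 2) ≤ X + 1 := by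
        rw [Real.log_le_iff_le_exp (by positivity)]
        have := Nat.ceil_lt_add_one (Real.exp_pos X).le
        rw [hA] at this
        push_cast at this
        rw [Real.exp_add]
        have h1 := Real.add_one_le_exp X
        have h2 := Real.add_one_le_exp 1
        nlinarith
      linarith
    calc R / 4 = (1 / 2) * X ^ (s - 1) * (X / 2) := by
          rw [Real.rpow_sub hX0, Real.rpow_one, hXR]; field_simp; norm_num
      _ ≤ (2 ^ (s - 1)) * X ^ (s - 1) * (X / 2) := by
          have : (1 / 2 : ℝ) ≤ 2 ^ (s - 1) := by
            have : (2 : ℝ) ^ (-1 : ℝ) ≤ 2 ^ (s - 1) :=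
              Real.rpow_le_rpow_of_exponent_le (by norm_num) (by linarith)
            rw [Real.rpow_neg_one] at this; linarith
          gcongr
      _ = (2 * X) ^ (s - 1) * (X / 2) := by rw [Real.mul_rpow (by norm_num) hX0.le]
      _ ≤ (2 * X) ^ (s - 1) * ∑ n ∈ Finset.Ico A B, 1 / ((n : ℝ) + 2) := by gcongr
      _ ≤ _ := by
          rw [Finset.mul_sum]
          refine Finset.sum_le_sum fun n hn => ?_
          obtain ⟨h1, h2⟩ := hmem n hn
          rw [mul_one_div]
          gcongr ?_ / _
          exact Real.rpow_le_rpow_of_nonpos (by linarith) h2 (by linarith)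

lemma hilb_rpow_lower (y R s : ℝ) (hR : 0 < R) (h1 : R ≤ y) (h2 : y ≤ 2 * R) :
    2 ^ (-|s|) * R ^ s ≤ y ^ s := by
  have hy : 0 < y := by linarith
  have : y ^ s = (y / R) ^ s * R ^ s := by
    rw [← Real.mul_rpow (by positivity) hR.le]; congr 1; field_simp
  rw [this]
  gcongr
  have a1 : 1 ≤ y / R := by rw [le_div_iff₀ hR]; linarith
  have a2 : y / R ≤ 2 := by rw [div_le_iff₀ hR]; linarith
  calc (2 : ℝ) ^ (-|s|) ≤ (y / R) ^ (-|s|) :=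
        Real.rpow_le_rpow_of_nonpos (by positivity) a2 (by simp)
    _ ≤ _ := Real.rpow_le_rpow_of_exponent_le a1 (neg_abs_le s)

lemma hilbK_lower (p q α β γ μ ν R : ℝ) (hp : 0 < p) (hq0 : 0 < q) (hq : 1 / p + 1 / q = 1)
    (hγ : 0 < γ) (hR : 0 < R) (m n : ℕ)
    (hm1 : R ≤ Real.log ((m : ℝ) + 2) ^ α) (hm2 : Real.log ((m : ℝ) + 2) ^ α ≤ 2 * R)
    (hn1 : R ≤ Real.log ((n : ℝ) + 2) ^ β) (hn2 : Real.log ((n : ℝ) + 2) ^ β ≤ 2 * R) :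
    (2 ^ (-|μ / p|) * 2 ^ (-|-(ν / p)|) / 4 ^ γ * R ^ ((μ - ν) / p - γ)) *
      ((Real.log ((m : ℝ) + 2) ^ (α - 1) / ((m : ℝ) + 2)) ^ (1 / p) *
       (Real.log ((n : ℝ) + 2) ^ (β - 1) / ((n : ℝ) + 2)) ^ (1 / q)) ≤ hilbK p q α β γ μ ν m n := by
  have h1 := hilb_logpos m
  have h2 := hilb_logpos n
  unfold hilbK
  set M := Real.log ((m : ℝ) + 2)
  set L := Real.log ((n : ℝ) + 2)
  have hM : 0 < M := by linarith
  have hL : 0 < L := by linarith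
  have b1 := hilb_rpow_lower _ _ (μ / p) hR hm1 hm2
  have b2 := hilb_rpow_lower _ _ (-(ν / p)) hR hn1 hn2
  have b3 : (M ^ α + L ^ β) ^ γ ≤ 4 ^ γ * R ^ γ := by
    rw [← Real.mul_rpow (by norm_num) hR.le]
    exact Real.rpow_le_rpow (by positivity) (by linarith) hγ.le
  have e1 : M ^ (((α - 1) + α * μ) / p) = (M ^ (α - 1)) ^ (1 / p) * (M ^ α) ^ (μ / p) := by
    rw [← Real.rpow_mul hM.le, ← Real.rpow_mul hM.le, ← Real.rpow_add hM]
    congr 1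
    ring
  have e2 : L ^ (((β - 1) - (q - 1) * β * ν) / q) = (L ^ (β - 1)) ^ (1 / q) * (L ^ β) ^ (-(ν / p)) := by
    rw [← Real.rpow_mul hL.le, ← Real.rpow_mul hL.le, ← Real.rpow_add hL]
    congr 1
    have : 1 / p = 1 - 1 / q := by linarith
    rw [div_eq_mul_one_div ν p, this]; field_simp; ring
  have e3 : R ^ ((μ - ν) / p - γ) = R ^ (μ / p) * R ^ (-(ν / p)) / R ^ γ := by
    rw [← Real.rpow_add hR, ← Real.rpow_sub hR]
    congr 1; ring
  rw [e1, e2, e3, Real.div_rpow (by positivity) (by positivity), Real.div_rpow (by positivity) (by positivity)]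
  calc _ = (M ^ (α - 1)) ^ (1 / p) / ((m : ℝ) + 2) ^ (1 / p) * ((L ^ (β - 1)) ^ (1 / q) / ((n : ℝ) + 2) ^ (1 / q)) *
        ((2 ^ (-|μ / p|) * R ^ (μ / p)) * (2 ^ (-|-(ν / p)|) * R ^ (-(ν / p))) / (4 ^ γ * R ^ γ)) := by
        field_simp
    _ ≤ (M ^ (α - 1)) ^ (1 / p) / ((m : ℝ) + 2) ^ (1 / p) * ((L ^ (β - 1)) ^ (1 / q) / ((n : ℝ) + 2) ^ (1 / q)) *
        ((M ^ α) ^ (μ / p) * (L ^ β) ^ (-(ν / p)) / (M ^ α + L ^ β) ^ γ) := by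
        gcongr
    _ = _ := by
        have : 0 < M ^ α + L ^ β := by positivity
        field_simp

lemma hilb_lower_step (p q α β γ μ ν : ℝ) (hp : 1 < p) (hq : 1 / p + 1 / q = 1)
    (hγ : 0 < γ) (hα0 : 0 < α) (hα1 : α ≤ 1) (hβ0 : 0 < β) (hβ1 : β ≤ 1) (C : ℝ) (hC : 0 < C)
    (h : ∀ a : ℕ → ℂ, lpNorm p a ≠ ⊤ →
        lpNorm p (genH p q α β γ μ ν a) ≤ ENNReal.ofReal C * lpNorm p a) (R : ℝ) (hR : 2 ≤ R) :
    (2 ^ (-|μ / p|) * 2 ^ (-|-(ν / p)|) / 4 ^ γ * R ^ ((μ - ν) / p - γ)) * (R / 4) ≤ C := by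
  have hp0 : 0 < p := by linarith
  have hpq : p.HolderConjugate q := by
    rw [Real.holderConjugate_iff]
    exact ⟨hp, by simpa using hq⟩
  have hq0 : 0 < q := hpq.symm.pos
  have hR0 : 0 < R := by linarith
  obtain ⟨S, hS, hV⟩ := hilb_block β R hβ0 hβ1 hR
  obtain ⟨S', hS', hW⟩ := hilb_block α R hα0 hα1 hR
  have hlog : ∀ n : ℕ, 0 < Real.log ((n : ℝ) + 2) := fun n => by
    have := hilb_logpos n; linarith
  have hKl := fun m hm n hn => hilbK_lower p q α β γ μ ν R hp0 hq0 hq hγ hR0 m n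
    (hS' m hm).1 (hS' m hm).2 (hS n hn).1 (hS n hn).2
  have hκ : 0 < 2 ^ (-|μ / p|) * 2 ^ (-|-(ν / p)|) / 4 ^ γ * R ^ ((μ - ν) / p - γ) := by positivity
  set κ := 2 ^ (-|μ / p|) * 2 ^ (-|-(ν / p)|) / 4 ^ γ * R ^ ((μ - ν) / p - γ)
  let v : ℕ → ℝ := fun n => Real.log ((n : ℝ) + 2) ^ (β - 1) / ((n : ℝ) + 2)
  let w : ℕ → ℝ := fun n => Real.log ((n : ℝ) + 2) ^ (α - 1) / ((n : ℝ) + 2)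
  have hv : ∀ n, 0 < v n := fun n => by have := hlog n; simp only [v]; positivity
  have hw : ∀ n, 0 < w n := fun n => by have := hlog n; simp only [w]; positivity
  change ∀ m ∈ S', ∀ n ∈ S, κ * (w m ^ (1 / p) * v n ^ (1 / q)) ≤ _ at hKl
  change R / 4 ≤ ∑ n ∈ S, v n at hV
  change R / 4 ≤ ∑ n ∈ S', w n at hW
  set V := ∑ n ∈ S, v n with hVdef
  set W := ∑ n ∈ S', w n with hWdef
  let a : ℕ → ℂ := fun n => if n - 2 ∈ S then ((v (n - 2) ^ (1 / p) : ℝ) : ℂ) else 0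
  have ha : ∀ n, a (n + 2) = if n ∈ S then ((v n ^ (1 / p) : ℝ) : ℂ) else 0 := fun n => by
    simp [a]
  have hsuma : ∑' n : ℕ, (‖a (n + 2)‖₊ : ℝ≥0∞) ^ p = ENNReal.ofReal V := by
    rw [tsum_eq_sum (s := S)]
    · rw [hVdef, ENNReal.ofReal_sum_of_nonneg (fun n _ => (hv n).le)]
      refine Finset.sum_congr rfl fun n hn => ?_
      have h0 := hv n
      rw [ha, if_pos hn]
      rw [← enorm_eq_nnnorm, ← ofReal_norm, Complex.norm_real, Real.norm_of_nonneg (by positivity),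
        ENNReal.ofReal_rpow_of_nonneg (by positivity) hp0.le, ← Real.rpow_mul h0.le, one_div,
        inv_mul_cancel₀ hp0.ne', Real.rpow_one]
    · intro n hn
      rw [ha, if_neg hn]
      simp [hp0]
  have hna : lpNorm p a = (ENNReal.ofReal V) ^ (1 / p) := by
    unfold lpNorm; rw [hsuma]
  have hnt : lpNorm p a ≠ ⊤ := by
    rw [hna]; exact ENNReal.rpow_ne_top_of_nonneg (by positivity) (by simp)
  have hb := h a hnt
  rw [hna] at hb
  have hV0 : 0 < V := by linarith
  have hW0 : 0 < W := by linarith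
  have hgen : ∀ m ∈ S', ENNReal.ofReal (κ ^ p * V ^ p * w m) ≤
      (‖genH p q α β γ μ ν a (m + 2)‖₊ : ℝ≥0∞) ^ p := by
    intro m hm
    have e : genH p q α β γ μ ν a (m + 2) = ((∑ n ∈ S, hilbK p q α β γ μ ν m n * v n ^ (1 / p) : ℝ) : ℂ) := by
      rw [hilb_genH, tsum_eq_sum (s := S)]
      · push_cast
        refine Finset.sum_congr rfl fun n hn => ?_
        rw [ha, if_pos hn]
      · intro n hn
        rw [ha, if_neg hn, mul_zero]
    have hlow : κ * w m ^ (1 / p) * V ≤ ∑ n ∈ S, hilbK p q α β γ μ ν m n * v n ^ (1 / p) := by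
      rw [hVdef, Finset.mul_sum]
      refine Finset.sum_le_sum fun n hn => ?_
      have h0 := hv n
      calc κ * w m ^ (1 / p) * v n = κ * (w m ^ (1 / p) * v n ^ (1 / q)) * v n ^ (1 / p) := by
            have : v n = v n ^ (1 / q) * v n ^ (1 / p) := by
              rw [← Real.rpow_add h0, add_comm, hq, Real.rpow_one]
            nth_rewrite 1 [this]
            ring
        _ ≤ _ := by
            gcongr
            exact hKl m hm n hn
    have h0 := hw m
    have hpos : 0 ≤ κ * w m ^ (1 / p) * V := by positivity
    rw [e, ← enorm_eq_nnnorm, ← ofReal_norm, Complex.norm_real, Real.norm_of_nonneg (hpos.trans hlow),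
      ENNReal.ofReal_rpow_of_nonneg (hpos.trans hlow) hp0.le]
    apply ENNReal.ofReal_le_ofReal
    refine le_trans (le_of_eq ?_) (Real.rpow_le_rpow hpos hlow hp0.le)
    rw [Real.mul_rpow (by positivity) hV0.le, Real.mul_rpow hκ.le (by positivity), ← Real.rpow_mul h0.le, one_div,
        inv_mul_cancel₀ hp0.ne', Real.rpow_one]
    ring
  have hsum2 : ENNReal.ofReal (κ ^ p * V ^ p * W) ≤ ∑' m : ℕ, (‖genH p q α β γ μ ν a (m + 2)‖₊ : ℝ≥0∞) ^ p := by
    refine le_trans ?_ (ENNReal.sum_le_tsum S')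
    refine le_trans (le_of_eq ?_) (Finset.sum_le_sum hgen)
    rw [← ENNReal.ofReal_sum_of_nonneg, hWdef, Finset.mul_sum]
    intro m _
    have h0 := hw m
    positivity
  have hfin : ENNReal.ofReal (κ ^ p * V ^ p * W) ≤ ENNReal.ofReal (C ^ p * V) := by
    refine hsum2.trans ?_
    have := ENNReal.rpow_le_rpow hb hp0.le
    unfold lpNorm at this
    rw [ENNReal.mul_rpow_of_nonneg _ _ hp0.le, ← ENNReal.rpow_mul, ← ENNReal.rpow_mul, one_div,
      inv_mul_cancel₀ hp0.ne', ENNReal.rpow_one, ENNReal.rpow_one,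
      ENNReal.ofReal_rpow_of_nonneg hC.le hp0.le, ← ENNReal.ofReal_mul (by positivity)] at this
    exact this
  rw [ENNReal.ofReal_le_ofReal_iff (by positivity)] at hfin
  have hVp : V ^ p = V ^ (p - 1) * V := by
    rw [Real.rpow_sub hV0, Real.rpow_one]; field_simp
  have h3 : κ ^ p * V ^ (p - 1) * W ≤ C ^ p := by
    rw [hVp] at hfin
    have : (κ ^ p * V ^ (p - 1) * W) * V ≤ C ^ p * V := by linarith
    exact le_of_mul_le_mul_right this hV0
  have h4 : (κ * (R / 4)) ^ p ≤ C ^ p := by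
    refine le_trans ?_ h3
    calc (κ * (R / 4)) ^ p = κ ^ p * (R / 4) ^ (p - 1) * (R / 4) := by
          rw [Real.mul_rpow hκ.le (by positivity), Real.rpow_sub (by positivity) p 1, Real.rpow_one]
          field_simp
      _ ≤ κ ^ p * V ^ (p - 1) * W := by
          have : (R / 4) ^ (p - 1) ≤ V ^ (p - 1) := Real.rpow_le_rpow (by positivity) hV (by linarith)
          gcongr
  exact (Real.rpow_le_rpow_iff (by positivity) hC.le hp0).1 h4

lemma hilb_lower (p q α β γ μ ν : ℝ) (hp : 1 < p) (hq : 1 / p + 1 / q = 1)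
    (hγ : 0 < γ) (hα0 : 0 < α) (hα1 : α ≤ 1) (hβ0 : 0 < β) (hβ1 : β ≤ 1) (C : ℝ) (hC : 0 < C)
    (h : ∀ a : ℕ → ℂ, lpNorm p a ≠ ⊤ →
        lpNorm p (genH p q α β γ μ ν a) ≤ ENNReal.ofReal C * lpNorm p a) :
    0 ≤ p * (γ - 1) - (μ - ν) := by
  by_contra hneg
  push Not at hneg
  have hp0 : 0 < p := by linarith
  have hδ : 0 < (μ - ν) / p - γ + 1 := by
    have : γ - 1 < (μ - ν) / p := by rw [lt_div_iff₀ hp0]; linarith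
    linarith
  have hst := hilb_lower_step p q α β γ μ ν hp hq hγ hα0 hα1 hβ0 hβ1 C hC h
  have hc : (0 : ℝ) < 2 ^ (-|μ / p|) * 2 ^ (-|-(ν / p)|) / 4 ^ γ := by positivity
  set c : ℝ := 2 ^ (-|μ / p|) * 2 ^ (-|-(ν / p)|) / 4 ^ γ
  have ht := (tendsto_rpow_atTop hδ).eventually_gt_atTop (4 * C / c)
  obtain ⟨R, hR1, hR2⟩ := (ht.and (Filter.eventually_ge_atTop 2)).exists
  have h1 := hst R hR2
  rw [Real.rpow_add (by linarith), Real.rpow_one, div_lt_iff₀ hc] at hR1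
  linarith

/-- **Theorem 1.2.** For `p > 1`, `γ > 0`, `0 < α, β ≤ 1`, `−1 < μ, ν < p − 1`, the
generalized multiplicative Hilbert operator is bounded on `l^p` if and only if
`p(γ−1) − (μ−ν) ≥ 0`. -/
theorem generalized_multiplicative_hilbert_bounded_iff
    (p q α β γ μ ν : ℝ) (hp : 1 < p) (hq : 1 / p + 1 / q = 1)
    (hγ : 0 < γ) (hα0 : 0 < α) (hα1 : α ≤ 1) (hβ0 : 0 < β) (hβ1 : β ≤ 1)
    (hμ1 : -1 < μ) (hμ2 : μ < p - 1) (hν1 : -1 < ν) (hν2 : ν < p - 1) :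
    (∃ C : ℝ, 0 < C ∧ ∀ a : ℕ → ℂ, lpNorm p a ≠ ⊤ →
        lpNorm p (genH p q α β γ μ ν a) ≤ ENNReal.ofReal C * lpNorm p a) ↔
      0 ≤ p * (γ - 1) - (μ - ν) := by

  constructor
  · rintro ⟨C, hC, h⟩
    exact hilb_lower p q α β γ μ ν hp hq hγ hα0 hα1 hβ0 hβ1 C hC h
  · intro h
    exact hilb_upper p q α β γ μ ν hp hq hα0 hα1 hβ0 hβ1 hμ1 hν2 h
end

section
/- Let p > 1, γ > 0, 0 < α ≤ 1, 0 < β ≤ 1, and −1 < μ, ν < p−1. If p(γ−1) − (μ−ν) < 0 (equivalently γ < 1 + (μ−ν)/p), then the generalized multiplicative Hilbert operator H^{μ,ν}_{p,α,β,γ} is not bounded on l^p; that is, there is no constant C > 0 such that ‖H^{μ,ν}_{p,α,β,γ} a‖_p ≤ C‖a‖_p for all a ∈ l^p. -/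
open scoped ENNReal

/-- Integers whose logarithm lies in `[U, 2U]`. -/
noncomputable def blockS (U : ℝ) : Finset ℕ :=
  Finset.Ico ⌈Real.exp U⌉₊ (⌊Real.exp (2 * U)⌋₊ + 1)

lemma blockS_mem {U : ℝ} (hU : 2 ≤ U) {n : ℕ} (hn : n ∈ blockS U) :
    2 ≤ n ∧ U ≤ Real.log n ∧ Real.log n ≤ 2 * U := by
  rw [blockS, Finset.mem_Ico] at hn
  obtain ⟨h1, h2⟩ := hn
  have h1' : Real.exp U ≤ n := Nat.ceil_le.mp h1
  have h2' : (n : ℝ) ≤ Real.exp (2 * U) :=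
    (Nat.le_floor_iff (Real.exp_pos _).le).mp (Nat.lt_succ_iff.mp h2)
  have hpos : (0 : ℝ) < n := (Real.exp_pos _).trans_le h1'
  refine ⟨?_, ?_, ?_⟩
  · have : (2 : ℝ) ≤ n := by linarith [Real.add_one_le_exp U]
    exact_mod_cast this
  · exact (Real.le_log_iff_exp_le hpos).mpr h1'
  · exact (Real.log_le_iff_le_exp hpos).mpr h2'

lemma blockS_sum {U : ℝ} (hU : 2 ≤ U) : U / 2 ≤ ∑ n ∈ blockS U, 1 / (n : ℝ) := by
  set A := ⌈Real.exp U⌉₊ with hA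
  set B := ⌊Real.exp (2 * U)⌋₊ + 1 with hB
  have hA1 : Real.exp U ≤ A := Nat.le_ceil _
  have hA2 : (A : ℝ) < Real.exp U + 1 := Nat.ceil_lt_add_one (Real.exp_pos _).le
  have hB1 : Real.exp (2 * U) < B := by
    rw [hB]; push_cast; exact Nat.lt_floor_add_one _
  have hApos : (0 : ℝ) < A := (Real.exp_pos _).trans_le hA1
  have he : 2 ≤ Real.exp U := by linarith [Real.add_one_le_exp U]
  have hAB : A ≤ B := by
    have : (A : ℝ) ≤ B := by
      have : Real.exp (2 * U) = Real.exp U * Real.exp U := by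
        rw [← Real.exp_add]; ring_nf
      nlinarith
    exact_mod_cast this
  have htel : ∑ n ∈ Finset.Ico A B, (Real.log ((n + 1 : ℕ) : ℝ) - Real.log (n : ℝ))
      = Real.log B - Real.log A :=
    Finset.sum_Ico_sub (fun n : ℕ => Real.log (n : ℝ)) hAB
  have hle : ∑ n ∈ Finset.Ico A B, (Real.log ((n + 1 : ℕ) : ℝ) - Real.log (n : ℝ))
      ≤ ∑ n ∈ blockS U, 1 / (n : ℝ) := by
    apply Finset.sum_le_sum
    intro n hn
    have hn' : A ≤ n := (Finset.mem_Ico.mp hn).1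
    have hnpos : (0 : ℝ) < n := hApos.trans_le (by exact_mod_cast hn')
    have := Real.log_le_sub_one_of_pos (x := ((n + 1 : ℕ) : ℝ) / n) (by positivity)
    rw [Real.log_div (by positivity) (by positivity)] at this
    refine this.trans (le_of_eq ?_)
    push_cast
    field_simp
    ring
  have hlB : 2 * U ≤ Real.log B := by
    rw [Real.le_log_iff_exp_le ((Real.exp_pos _).trans hB1)]
    exact hB1.le
  have hlA : Real.log A ≤ U + 1 := by
    rw [Real.log_le_iff_le_exp hApos, Real.exp_add]
    have : 2 ≤ Real.exp 1 := by linarith [Real.add_one_le_exp (1 : ℝ)]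
    nlinarith
  linarith

lemma rpow_block {U x : ℝ} (e : ℝ) (hU : 0 < U) (h1 : U ≤ x) (h2 : x ≤ 2 * U) :
    (2 : ℝ) ^ (-|e|) * U ^ e ≤ x ^ e := by
  have hr1 : 1 ≤ x / U := by rw [le_div_iff₀ hU]; linarith
  have hr2 : x / U ≤ 2 := by rw [div_le_iff₀ hU]; linarith
  have hx : x ^ e = (x / U) ^ e * U ^ e := by
    rw [← Real.mul_rpow (by linarith) hU.le, div_mul_cancel₀ _ hU.ne']
  rw [hx]
  gcongr
  calc (2 : ℝ) ^ (-|e|) ≤ (x / U) ^ (-|e|) :=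
        Real.rpow_le_rpow_of_nonpos (by linarith) hr2 (by simp)
    _ ≤ (x / U) ^ e := Real.rpow_le_rpow_of_exponent_le hr1 (neg_abs_le e)

lemma tsum_shift {M : Type*} [AddCommMonoid M] [TopologicalSpace M]
    (S : Finset ℕ) (hS : ∀ n ∈ S, 2 ≤ n) (g : ℕ → M) (hg : ∀ n, n ∉ S → g n = 0) :
    ∑' n : ℕ, g (n + 2) = ∑ n ∈ S, g n := by
  rw [tsum_eq_sum (s := S.image (fun n => n - 2))]
  · rw [Finset.sum_image]
    · apply Finset.sum_congr rfl
      intro n hn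
      have := hS n hn
      congr 1; omega
    · intro x hx y hy hxy
      have := hS x hx
      have := hS y hy
      simp only at hxy
      omega
  · intro n hn
    apply hg
    intro h
    exact hn (Finset.mem_image.mpr ⟨n + 2, h, by omega⟩)

lemma sum_le_tsum_shift (S : Finset ℕ) (hS : ∀ n ∈ S, 2 ≤ n) (g : ℕ → ℝ≥0∞) :
    ∑ n ∈ S, g n ≤ ∑' n : ℕ, g (n + 2) := by
  classical
  have h := tsum_shift S hS (fun n => if n ∈ S then g n else 0) (by intro n hn; simp [hn])
  have h2 : ∑ n ∈ S, g n = ∑ n ∈ S, (if n ∈ S then g n else 0) :=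
    Finset.sum_congr rfl (by intro n hn; simp [hn])
  rw [h2, ← h]
  apply ENNReal.tsum_le_tsum
  intro n
  split_ifs <;> simp

lemma key_bound (p q α β γ μ ν C U V X : ℝ) (hp : 1 < p) (hq : 1 / p + 1 / q = 1)
    (hγ : 0 < γ) (hα0 : 0 < α) (hα1 : α ≤ 1) (hβ0 : 0 < β) (hβ1 : β ≤ 1) (hC : 0 < C)
    (hb : ∀ a : ℕ → ℂ, lpNorm p a ≠ ⊤ →
      lpNorm p (genH p q α β γ μ ν a) ≤ ENNReal.ofReal C * lpNorm p a)
    (hU : 2 ≤ U) (hV : 2 ≤ V) (hX : 0 < X) (hUX : U ^ β = X) (hVX : V ^ α = X) :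
    ((2 : ℝ) ^ (-|((α - 1) + α * μ) / p|) * V ^ (((α - 1) + α * μ) / p) *
      ((2 : ℝ) ^ (-|((β - 1) - (q - 1) * β * ν) / q|) * U ^ (((β - 1) - (q - 1) * β * ν) / q) /
        (4 * X) ^ γ)) ^ p * (U / 2) ^ (p - 1) * (V / 2) ≤ C ^ p := by
  classical
  have hp0 : 0 < p := by linarith
  set e1 := ((α - 1) + α * μ) / p with he1
  set e2 := ((β - 1) - (q - 1) * β * ν) / q with he2
  set K1 := (2 : ℝ) ^ (-|e1|) * V ^ e1 with hK1
  set K2 := (2 : ℝ) ^ (-|e2|) * U ^ e2 / (4 * X) ^ γ with hK2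
  have hU0 : 0 < U := by linarith
  have hV0 : 0 < V := by linarith
  have hK1p : 0 < K1 := by positivity
  have hK2p : 0 < K2 := by positivity
  set σU := ∑ n ∈ blockS U, 1 / (n : ℝ) with hσU
  set σV := ∑ n ∈ blockS V, 1 / (n : ℝ) with hσV
  have hσU1 : U / 2 ≤ σU := blockS_sum hU
  have hσV1 : V / 2 ≤ σV := blockS_sum hV
  have hσU0 : 0 < σU := by linarith
  have hσV0 : 0 < σV := by linarith
  let a : ℕ → ℂ := fun n => if n ∈ blockS U then (((n : ℝ) ^ (-(1 / p)) : ℝ) : ℂ) else 0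
  have ha_mem : ∀ n ∈ blockS U, a n = (((n : ℝ) ^ (-(1 / p)) : ℝ) : ℂ) := by
    intro n hn; simp [a, hn]
  have ha_not : ∀ n, n ∉ blockS U → a n = 0 := by
    intro n hn; simp [a, hn]
  have hmU2 : ∀ n ∈ blockS U, 2 ≤ n := fun n hn => (blockS_mem hU hn).1
  have hmV2 : ∀ n ∈ blockS V, 2 ≤ n := fun n hn => (blockS_mem hV hn).1
  -- power of norm
  have hpow : ∀ (z : ℂ), (‖z‖₊ : ℝ≥0∞) ^ p = ENNReal.ofReal (‖z‖ ^ p) := by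
    intro z
    rw [← ENNReal.ofReal_rpow_of_nonneg (norm_nonneg _) hp0.le, ofReal_norm]
    rfl
  have hroot : ∀ n : ℕ, 2 ≤ n → ((n : ℝ) ^ (-(1 / p))) ^ p = 1 / (n : ℝ) := by
    intro n hn
    rw [← Real.rpow_mul (by positivity)]
    rw [show -(1 / p) * p = -1 by field_simp, Real.rpow_neg_one, one_div]
  have hsum_a : ∑' n : ℕ, (‖a (n + 2)‖₊ : ℝ≥0∞) ^ p = ENNReal.ofReal σU := by
    rw [tsum_shift (blockS U) hmU2 (fun n => (‖a n‖₊ : ℝ≥0∞) ^ p)]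
    · rw [hσU, ENNReal.ofReal_sum_of_nonneg (fun n _ => by positivity)]
      apply Finset.sum_congr rfl
      intro n hn
      rw [hpow, ha_mem n hn, Complex.norm_real, Real.norm_of_nonneg (by positivity),
        hroot n (hmU2 n hn)]
    · intro n hn
      simp [ha_not n hn, hp0]
  have hna : lpNorm p a = ENNReal.ofReal σU ^ (1 / p) := by
    rw [lpNorm, hsum_a]
  have hfin : lpNorm p a ≠ ⊤ := by
    rw [hna]
    exact ENNReal.rpow_ne_top_of_nonneg (by positivity) ENNReal.ofReal_ne_top
  have hmain := hb a hfin
  -- pointwise lower bound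
  have hpt : ∀ m ∈ blockS V, K1 * (K2 * σU) * (m : ℝ) ^ (-(1 / p)) ≤ ‖genH p q α β γ μ ν a m‖ := by
    intro m hm
    obtain ⟨hm2, hm3, hm4⟩ := blockS_mem hV hm
    have hm0 : (0 : ℝ) < m := by exact_mod_cast (by omega : 0 < m)
    have hlm : 0 < Real.log m := by linarith
    have h1 : ∑' n : ℕ, ((Real.log ((n : ℝ) + 2) ^ e2 /
          (((n : ℝ) + 2) ^ (1 / q) *
            (Real.log m ^ α + Real.log ((n : ℝ) + 2) ^ β) ^ γ) : ℝ) : ℂ) * a (n + 2)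
        = ((∑ n ∈ blockS U, (Real.log (n : ℝ) ^ e2 /
          ((n : ℝ) ^ (1 / q) *
            (Real.log m ^ α + Real.log (n : ℝ) ^ β) ^ γ)) * (n : ℝ) ^ (-(1 / p)) : ℝ) : ℂ) := by
      have := tsum_shift (blockS U) hmU2 (fun n => ((Real.log (n : ℝ) ^ e2 /
          ((n : ℝ) ^ (1 / q) *
            (Real.log m ^ α + Real.log (n : ℝ) ^ β) ^ γ) : ℝ) : ℂ) * a n)
          (by intro n hn; simp [ha_not n hn])
      rw [Complex.ofReal_sum]
      calc _ = _ := by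
            apply tsum_congr
            intro n
            rw [show ((n : ℝ) + 2) = ((n + 2 : ℕ) : ℝ) by push_cast; ring]
        _ = _ := this
        _ = _ := by
            apply Finset.sum_congr rfl
            intro n hn
            rw [ha_mem n hn, ← Complex.ofReal_mul]
    have h2 : K2 * σU ≤ ∑ n ∈ blockS U, (Real.log (n : ℝ) ^ e2 /
          ((n : ℝ) ^ (1 / q) *
            (Real.log m ^ α + Real.log (n : ℝ) ^ β) ^ γ)) * (n : ℝ) ^ (-(1 / p)) := by
      rw [hσU, Finset.mul_sum]
      apply Finset.sum_le_sum
      intro n hn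
      obtain ⟨hn2, hn3, hn4⟩ := blockS_mem hU hn
      have hn0 : (0 : ℝ) < n := by exact_mod_cast (by omega : 0 < n)
      have hln : 0 < Real.log n := by linarith
      have hpw : ∀ (t W s : ℝ), 0 < t → 0 < W → t ≤ 2 * W → 0 < s → s ≤ 1 → W ^ s = X →
          t ^ s ≤ 2 * X := by
        intro t W s ht hW htW hs hs1 hWX
        calc t ^ s ≤ (2 * W) ^ s := Real.rpow_le_rpow ht.le htW hs.le
          _ = (2 : ℝ) ^ s * X := by rw [Real.mul_rpow (by norm_num) hW.le, hWX]
          _ ≤ (2 : ℝ) ^ (1 : ℝ) * X := by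
              gcongr
              norm_num
          _ = 2 * X := by rw [Real.rpow_one]
      have hD : (Real.log m ^ α + Real.log (n : ℝ) ^ β) ^ γ ≤ (4 * X) ^ γ := by
        apply Real.rpow_le_rpow (by positivity) _ hγ.le
        have := hpw _ V α hlm hV0 hm4 hα0 hα1 hVX
        have := hpw _ U β hln hU0 hn4 hβ0 hβ1 hUX
        linarith
      have hL : (2 : ℝ) ^ (-|e2|) * U ^ e2 ≤ Real.log n ^ e2 := rpow_block e2 hU0 hn3 hn4
      have hn1 : (n : ℝ) ^ (-(1 / p)) = (n : ℝ) ^ (1 / q) / n := by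
        rw [show -(1 / p) = 1 / q - 1 by linarith, Real.rpow_sub_one hn0.ne']
      have hDpos : 0 < (Real.log m ^ α + Real.log (n : ℝ) ^ β) ^ γ := by positivity
      have hqpos : 0 < (n : ℝ) ^ (1 / q) := by positivity
      calc K2 * (1 / n) ≤ (Real.log n ^ e2 / (Real.log m ^ α + Real.log (n : ℝ) ^ β) ^ γ) * (1 / n) := by
            rw [hK2]
            gcongr
        _ = _ := by
            rw [hn1]
            field_simp
    have h3 : K1 * (m : ℝ) ^ (-(1 / p)) ≤ Real.log m ^ e1 / (m : ℝ) ^ (1 / p) := by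
      rw [Real.rpow_neg hm0.le, ← div_eq_mul_inv]
      gcongr
      exact rpow_block e1 hV0 hm3 hm4
    have h4 : genH p q α β γ μ ν a m = ((Real.log m ^ e1 / (m : ℝ) ^ (1 / p) *
        ∑ n ∈ blockS U, (Real.log (n : ℝ) ^ e2 /
          ((n : ℝ) ^ (1 / q) *
            (Real.log m ^ α + Real.log (n : ℝ) ^ β) ^ γ)) * (n : ℝ) ^ (-(1 / p)) : ℝ) : ℂ) := by
      rw [Complex.ofReal_mul, ← h1]
      rfl
    rw [h4, Complex.norm_real]
    refine le_trans ?_ (Real.le_norm_self _)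
    calc K1 * (K2 * σU) * (m : ℝ) ^ (-(1 / p)) = (K1 * (m : ℝ) ^ (-(1 / p))) * (K2 * σU) := by ring
      _ ≤ _ := by gcongr
  have hlow : ENNReal.ofReal ((K1 * (K2 * σU)) ^ p * σV) ≤
      ∑' n : ℕ, (‖genH p q α β γ μ ν a (n + 2)‖₊ : ℝ≥0∞) ^ p := by
    refine le_trans ?_ (sum_le_tsum_shift (blockS V) hmV2
      (fun n => (‖genH p q α β γ μ ν a n‖₊ : ℝ≥0∞) ^ p))
    rw [hσV, Finset.mul_sum, ENNReal.ofReal_sum_of_nonneg (fun n _ => by positivity)]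
    apply Finset.sum_le_sum
    intro m hm
    rw [hpow]
    apply ENNReal.ofReal_le_ofReal
    rw [← hroot m (hmV2 m hm), ← Real.mul_rpow (by positivity) (by positivity)]
    exact Real.rpow_le_rpow (by positivity) (hpt m hm) hp0.le
  have hpp : ∀ x : ℝ≥0∞, (x ^ (1 / p)) ^ p = x := by
    intro x
    rw [← ENNReal.rpow_mul, one_div_mul_cancel hp0.ne', ENNReal.rpow_one]
  have hE : ENNReal.ofReal ((K1 * (K2 * σU)) ^ p * σV) ≤ ENNReal.ofReal (C ^ p * σU) := by
    refine hlow.trans ?_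
    have := ENNReal.rpow_le_rpow hmain hp0.le
    rw [hna, ENNReal.mul_rpow_of_nonneg _ _ hp0.le, hpp, lpNorm, hpp,
      ENNReal.ofReal_rpow_of_nonneg hC.le hp0.le, ← ENNReal.ofReal_mul (by positivity)] at this
    exact this
  rw [ENNReal.ofReal_le_ofReal_iff (by positivity)] at hE
  have hfac : (K1 * (K2 * σU)) ^ p * σV = ((K1 * K2) ^ p * σU ^ (p - 1) * σV) * σU := by
    rw [← mul_assoc, Real.mul_rpow (by positivity) hσU0.le, Real.rpow_sub_one hσU0.ne']
    field_simp
  rw [hfac] at hE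
  have hE2 := le_of_mul_le_mul_right hE hσU0
  refine le_trans ?_ hE2
  have : (U / 2) ^ (p - 1) ≤ σU ^ (p - 1) :=
    Real.rpow_le_rpow (by positivity) hσU1 (by linarith)
  gcongr

/-- If `p(γ−1) − (μ−ν) < 0` (equivalently `γ < 1 + (μ−ν)/p`), then the generalized
multiplicative Hilbert operator `H^{μ,ν}_{p,α,β,γ}` is not bounded on `l^p`: there is
no constant `C > 0` with `‖H a‖_p ≤ C ‖a‖_p` for all `a ∈ l^p`. -/
theorem generalized_multiplicative_hilbert_unbounded_of_neg
    (p q α β γ μ ν : ℝ) (hp : 1 < p) (hq : 1 / p + 1 / q = 1)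
    (hγ : 0 < γ) (hα0 : 0 < α) (hα1 : α ≤ 1) (hβ0 : 0 < β) (hβ1 : β ≤ 1)
    (hμ1 : -1 < μ) (hμ2 : μ < p - 1) (hν1 : -1 < ν) (hν2 : ν < p - 1)
    (hcond : p * (γ - 1) - (μ - ν) < 0) :
    ¬ ∃ C : ℝ, 0 < C ∧ ∀ a : ℕ → ℂ, lpNorm p a ≠ ⊤ →
      lpNorm p (genH p q α β γ μ ν a) ≤ ENNReal.ofReal C * lpNorm p a := by
  rintro ⟨C, hC, hb⟩
  have hp0 : 0 < p := by linarith
  have hqp : q = p / (p - 1) := by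
    have hq0 : q ≠ 0 := by
      rintro rfl
      rw [div_zero, add_zero, div_eq_one_iff_eq hp0.ne'] at hq
      linarith
    have hp1 : p - 1 ≠ 0 := by linarith
    field_simp at hq ⊢
    linarith
  set e1 := ((α - 1) + α * μ) / p with he1
  set e2 := ((β - 1) - (q - 1) * β * ν) / q with he2
  set δ := p * (1 - γ) + μ - ν with hδ
  have hδ0 : 0 < δ := by rw [hδ]; linarith
  set c : ℝ := ((2 : ℝ) ^ (-|e1|) * (2 : ℝ) ^ (-|e2|) / (4 : ℝ) ^ γ) ^ p *
    (1 / 2) ^ (p - 1) * (1 / 2) with hc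
  have hc0 : 0 < c := by positivity
  have hall : ∀ l : ℝ, 1 ≤ l → c * Real.exp (δ * l) ≤ C ^ p := by
    intro l hl
    have hge : ∀ s : ℝ, 0 < s → s ≤ 1 → 2 ≤ Real.exp (l / s) := by
      intro s hs hs1
      have : 1 ≤ l / s := by rw [le_div_iff₀ hs]; linarith
      linarith [Real.add_one_le_exp (l / s)]
    have hpw : ∀ s : ℝ, 0 < s → Real.exp (l / s) ^ s = Real.exp l := by
      intro s hs
      rw [← Real.exp_mul, div_mul_cancel₀ _ hs.ne']
    have h := key_bound p q α β γ μ ν C (Real.exp (l / β)) (Real.exp (l / α)) (Real.exp l)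
      hp hq hγ hα0 hα1 hβ0 hβ1 hC hb (hge β hβ0 hβ1) (hge α hα0 hα1) (Real.exp_pos _)
      (hpw β hβ0) (hpw α hα0)
    refine le_trans (le_of_eq ?_) h
    rw [← he1, ← he2]
    have hx1 : (2 : ℝ) ^ (-|e1|) * Real.exp (l / α) ^ e1 *
        ((2 : ℝ) ^ (-|e2|) * Real.exp (l / β) ^ e2 / (4 * Real.exp l) ^ γ) =
        ((2 : ℝ) ^ (-|e1|) * (2 : ℝ) ^ (-|e2|) / (4 : ℝ) ^ γ) *
          Real.exp (l / α * e1 + l / β * e2 - l * γ) := by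
      rw [Real.mul_rpow (by norm_num) (Real.exp_pos _).le, ← Real.exp_mul, ← Real.exp_mul,
        ← Real.exp_mul, Real.exp_sub, Real.exp_add]
      field_simp
    rw [hx1, Real.mul_rpow (by positivity) (Real.exp_pos _).le, ← Real.exp_mul,
      div_eq_mul_one_div (Real.exp (l / β)), Real.mul_rpow (Real.exp_pos _).le (by norm_num),
      ← Real.exp_mul]
    have hexp : δ * l = (l / α * e1 + l / β * e2 - l * γ) * p + l / β * (p - 1) + l / α := by
      rw [he1, he2, hδ, hqp]
      have hp1 : p - 1 ≠ 0 := by linarith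
      field_simp
      ring
    rw [hexp, Real.exp_add, Real.exp_add, hc]
    ring
  have hlim : Filter.Tendsto (fun l : ℝ => c * Real.exp (δ * l)) Filter.atTop Filter.atTop :=
    (Real.tendsto_exp_atTop.comp (Filter.tendsto_id.const_mul_atTop hδ0)).const_mul_atTop hc0
  obtain ⟨l, hl1, hl2⟩ :=
    ((hlim.eventually_gt_atTop (C ^ p)).and (Filter.eventually_ge_atTop 1)).exists
  exact absurd (hall l hl2) (not_le.mpr hl1)
end

section
/- Let p > 1, 0 < α ≤ 1, 0 < β ≤ 1, and −1 < μ, ν < p−1. The operator H̃^{μ,ν}_{p,α,β} (the generalized multiplicative Hilbert operator with exponent γ = 1 + (μ−ν)/p) is bounded on l^p and its operator norm equals α^{−1/p} · β^{−1/p'} · B((1+μ)/p, (p−1−ν)/p), where B denotes the Beta function. -/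
open scoped ENNReal

/-- The Beta function `B(u, v) = ∫_0^∞ t^{u-1} / (1+t)^{u+v} dt`. -/
noncomputable def betaFn (u v : ℝ) : ℝ :=
  ∫ t in Set.Ioi (0 : ℝ), t ^ (u - 1) / (1 + t) ^ (u + v)

/-- The operator `H̃^{μ,ν}_{p,α,β}`, i.e. the generalized multiplicative Hilbert
operator with exponent `γ = 1 + (μ−ν)/p`; here `q = p'` is the conjugate exponent. -/
noncomputable def tildeH (p q α β μ ν : ℝ) (a : ℕ → ℂ) : ℕ → ℂ := fun m =>
  ((Real.log m ^ (((α - 1) + α * μ) / p) / (m : ℝ) ^ (1 / p) : ℝ) : ℂ) *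
    ∑' n : ℕ,
      ((Real.log ((n : ℝ) + 2) ^ (((β - 1) - (q - 1) * β * ν) / q) /
          (((n : ℝ) + 2) ^ (1 / q) *
            (Real.log m ^ α + Real.log ((n : ℝ) + 2) ^ β) ^ (1 + (μ - ν) / p)) : ℝ) : ℂ) *
        a (n + 2)
section Helpers

open MeasureTheory

lemma sum_le_lint (f : ℝ → ℝ≥0∞) (a : ℝ) (hf : AntitoneOn f (Set.Ioi a)) :
    ∑' n : ℕ, f (a + n + 1) ≤ ∫⁻ s in Set.Ioi a, f s := by
  have hm : Monotone (fun n : ℕ => a + (n : ℝ)) := by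
    intro i j h
    have : (i : ℝ) ≤ j := by exact_mod_cast h
    simpa using this
  have hd := hm.pairwise_disjoint_on_Ioc_succ
  have hsub : (⋃ n : ℕ, Set.Ioc (a + (n : ℝ)) (a + ((Order.succ n : ℕ) : ℝ))) ⊆ Set.Ioi a := by
    intro s hs
    simp only [Set.mem_iUnion, Set.mem_Ioc] at hs
    obtain ⟨n, h1, h2⟩ := hs
    have : (0 : ℝ) ≤ n := n.cast_nonneg
    exact lt_of_le_of_lt (by linarith) h1
  calc ∑' n : ℕ, f (a + n + 1)
      ≤ ∑' n : ℕ, ∫⁻ s in Set.Ioc (a + (n : ℝ)) (a + ((Order.succ n : ℕ) : ℝ)), f s := by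
        refine ENNReal.tsum_le_tsum fun n => ?_
        have h0 : (0 : ℝ) ≤ n := n.cast_nonneg
        calc f (a + n + 1) = ∫⁻ s in Set.Ioc (a + (n : ℝ)) (a + ((Order.succ n : ℕ) : ℝ)), f (a + n + 1) := by
              rw [setLIntegral_const]
              simp [Order.succ_eq_add_one, Real.volume_Ioc]
          _ ≤ _ := by
              refine setLIntegral_mono' measurableSet_Ioc fun s hs => ?_
              have h1 := hs.1
              have h2 := hs.2
              simp only [Order.succ_eq_add_one, Nat.cast_add, Nat.cast_one] at h2
              exact hf (Set.mem_Ioi.2 (by linarith)) (Set.mem_Ioi.2 (by linarith)) (by linarith)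
    _ = ∫⁻ s in ⋃ n : ℕ, Set.Ioc (a + (n : ℝ)) (a + ((Order.succ n : ℕ) : ℝ)), f s :=
        (lintegral_iUnion (fun _ => measurableSet_Ioc) hd _).symm
    _ ≤ _ := lintegral_mono_set hsub

lemma lint_le_sum (f : ℝ → ℝ≥0∞) (a : ℝ) (hf : AntitoneOn f (Set.Ici a)) :
    ∫⁻ s in Set.Ioi a, f s ≤ ∑' n : ℕ, f (a + n) := by
  have hsub : Set.Ioi a ⊆ ⋃ n : ℕ, Set.Ico (a + (n : ℝ)) (a + n + 1) := by
    intro s hs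
    have hs' : a < s := hs
    simp only [Set.mem_iUnion, Set.mem_Ico]
    refine ⟨⌊s - a⌋₊, ?_, ?_⟩
    · have := Nat.floor_le (a := s - a) (by linarith)
      linarith
    · have := Nat.lt_floor_add_one (s - a)
      linarith
  calc _ ≤ ∫⁻ s in ⋃ n : ℕ, Set.Ico (a + (n : ℝ)) (a + n + 1), f s := lintegral_mono_set hsub
    _ ≤ ∑' n : ℕ, ∫⁻ s in Set.Ico (a + (n : ℝ)) (a + n + 1), f s := lintegral_iUnion_le _ _
    _ ≤ _ := by
        refine ENNReal.tsum_le_tsum fun n => ?_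
        have h0 : (0 : ℝ) ≤ n := n.cast_nonneg
        calc _ ≤ ∫⁻ s in Set.Ico (a + (n : ℝ)) (a + n + 1), f (a + n) := by
              refine setLIntegral_mono' measurableSet_Ico fun s hs => ?_
              exact hf (Set.mem_Ici.2 (by linarith)) (Set.mem_Ici.2 (by linarith [hs.1])) hs.1
          _ = _ := by
              rw [setLIntegral_const]
              simp [Real.volume_Ico]

noncomputable def Gf (β σ γ X s : ℝ) : ℝ :=
  Real.log s ^ (β - 1) / s * (Real.log s ^ β) ^ (-σ) * (X + Real.log s ^ β) ^ (-γ)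

lemma Gf_nonneg {β σ γ X s : ℝ} (hX : 0 ≤ X) (hs : 1 < s) : 0 ≤ Gf β σ γ X s := by
  have := Real.log_pos hs
  unfold Gf
  positivity

lemma Gf_anti {β σ γ X : ℝ} (hβ0 : 0 < β) (hβ1 : β ≤ 1) (hσ : 0 ≤ σ) (hγ : 0 ≤ γ) (hX : 0 ≤ X) :
    AntitoneOn (fun s => ENNReal.ofReal (Gf β σ γ X s)) (Set.Ioi 1) := by
  intro s hs t ht hst
  have hs' : 1 < s := hs
  have h1 := Real.log_pos hs'
  have h2 : Real.log s ≤ Real.log t := Real.log_le_log (by linarith) hst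
  have h3 : 0 < Real.log t := by linarith
  refine ENNReal.ofReal_le_ofReal ?_
  unfold Gf
  have h4 : Real.log s ^ β ≤ Real.log t ^ β := Real.rpow_le_rpow h1.le h2 hβ0.le
  have e1 : Real.log t ^ (β - 1) ≤ Real.log s ^ (β - 1) :=
    Real.rpow_le_rpow_of_nonpos h1 h2 (by linarith)
  have e2 : (Real.log t ^ β) ^ (-σ) ≤ (Real.log s ^ β) ^ (-σ) :=
    Real.rpow_le_rpow_of_nonpos (by positivity) h4 (by linarith)
  have e3 : (X + Real.log t ^ β) ^ (-γ) ≤ (X + Real.log s ^ β) ^ (-γ) :=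
    Real.rpow_le_rpow_of_nonpos (by positivity) (by linarith) (by linarith)
  have : 0 < s := by linarith
  have : 0 < t := by linarith
  gcongr

lemma exists_exp {x : ℝ} (hx : 0 < x) : ∃ y, x = Real.exp y := ⟨Real.log x, (Real.exp_log hx).symm⟩

/-- change of variables -/
lemma cov {β σ γ X a : ℝ} (hβ0 : 0 < β) (hX : 0 < X) (ha : 1 ≤ a) :
    ∫⁻ s in Set.Ioi a, ENNReal.ofReal (Gf β σ γ X s) =
      ENNReal.ofReal (β⁻¹ * X ^ (1 - σ - γ)) *
        ∫⁻ t in Set.Ioi (Real.log a ^ β / X), ENNReal.ofReal (t ^ (-σ) * (1 + t) ^ (-γ)) := by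
  have hlog : ∀ s ∈ Set.Ioi a, 0 < Real.log s := fun s hs =>
    Real.log_pos (lt_of_le_of_lt ha hs)
  have himg : (fun s => Real.log s ^ β / X) '' Set.Ioi a = Set.Ioi (Real.log a ^ β / X) := by
    ext t
    constructor
    · rintro ⟨s, hs, rfl⟩
      have : Real.log a < Real.log s := Real.log_lt_log (by linarith) hs
      have := Real.rpow_lt_rpow (Real.log_nonneg ha) this hβ0
      exact div_lt_div_of_pos_right this hX
    · intro ht
      have ht' : Real.log a ^ β / X < t := ht
      have h0 : 0 ≤ Real.log a := Real.log_nonneg ha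
      have h1 : Real.log a ^ β < t * X := by rwa [div_lt_iff₀ hX] at ht'
      have h2 : 0 < t * X := lt_of_le_of_lt (by positivity) h1
      refine ⟨Real.exp ((t * X) ^ β⁻¹), ?_, ?_⟩
      · rw [Set.mem_Ioi, ← Real.log_lt_iff_lt_exp (by linarith)]
        have := Real.rpow_lt_rpow (by positivity) h1 (inv_pos.2 hβ0)
        rwa [Real.rpow_rpow_inv h0 hβ0.ne'] at this
      · simp only [Real.log_exp]
        rw [Real.rpow_inv_rpow h2.le hβ0.ne']
        field_simp
  have hinj : Set.InjOn (fun s => Real.log s ^ β / X) (Set.Ioi a) := by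
    have : StrictMonoOn (fun s => Real.log s ^ β / X) (Set.Ioi a) := by
      intro s hs t ht hst
      have h1 : Real.log s < Real.log t := Real.log_lt_log (by linarith [Set.mem_Ioi.1 hs]) hst
      have := Real.rpow_lt_rpow (hlog s hs).le h1 hβ0
      exact div_lt_div_of_pos_right this hX
    exact this.injOn
  rw [← himg, lintegral_image_eq_lintegral_abs_deriv_mul measurableSet_Ioi
    (f' := fun s => (s⁻¹ * β * Real.log s ^ (β - 1)) / X) ?_ hinj, ← lintegral_const_mul']
  · refine setLIntegral_congr_fun measurableSet_Ioi fun s hs => ?_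
    have hl := hlog s hs
    have hs0 : 0 < s := by linarith [Set.mem_Ioi.1 hs]
    rw [← ENNReal.ofReal_mul (by positivity), ← ENNReal.ofReal_mul (by positivity)]
    congr 1
    rw [abs_of_pos (by positivity)]
    unfold Gf
    generalize Real.log s = l at *
    have e1 : 1 + l ^ β / X = (X + l ^ β) / X := by field_simp
    have hz : 0 < X + l ^ β := by positivity
    rw [e1]
    generalize X + l ^ β = z at *
    rw [Real.div_rpow hz.le hX.le, Real.div_rpow (by positivity) hX.le]
    have e2 : X ^ (1 - σ - γ) = X * X ^ (-σ) * X ^ (-γ) := by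
      obtain ⟨x, rfl⟩ := exists_exp hX
      simp only [← Real.exp_mul, ← Real.exp_add]
      congr 1; ring
    rw [e2]
    field_simp
  · exact ENNReal.ofReal_ne_top
  · intro s hs
    have hs0 : 0 < s := by linarith [Set.mem_Ioi.1 hs]
    exact (((Real.hasDerivAt_log hs0.ne').rpow_const (Or.inl (hlog s hs).ne')).div_const X).hasDerivWithinAt

noncomputable def Bl (u v : ℝ) : ℝ≥0∞ :=
  ∫⁻ t in Set.Ioi (0 : ℝ), ENNReal.ofReal (t ^ (u - 1) * (1 + t) ^ (-(u + v)))

lemma Bl_symm (u v : ℝ) : Bl u v = Bl v u := by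
  unfold Bl
  have himg : (fun t : ℝ => t⁻¹) '' Set.Ioi 0 = Set.Ioi 0 := by
    ext t
    constructor
    · rintro ⟨s, hs, rfl⟩
      exact Set.mem_Ioi.2 (inv_pos.2 (Set.mem_Ioi.1 hs))
    · intro ht
      exact ⟨t⁻¹, Set.mem_Ioi.2 (inv_pos.2 (Set.mem_Ioi.1 ht)), inv_inv t⟩
  conv_lhs => rw [← himg]
  rw [lintegral_image_eq_lintegral_abs_deriv_mul measurableSet_Ioi
    (f' := fun s => -(s ^ 2)⁻¹) ?_ inv_injective.injOn]
  · refine setLIntegral_congr_fun measurableSet_Ioi fun t ht => ?_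
    have ht0 : 0 < t := ht
    rw [← ENNReal.ofReal_mul (by positivity)]
    congr 1
    rw [abs_neg, abs_of_pos (by positivity)]
    have e1 : 1 + t⁻¹ = (1 + t) * t⁻¹ := by
      field_simp
      ring
    have h1 : 0 < 1 + t := by positivity
    rw [e1, add_comm v u]
    generalize 1 + t = z at *
    obtain ⟨x, rfl⟩ := exists_exp ht0
    obtain ⟨y, rfl⟩ := exists_exp h1
    simp only [← Real.exp_neg, ← Real.exp_add, ← Real.exp_mul, ← Real.exp_nat_mul]
    congr 1
    push_cast
    ring
  · intro s hs
    exact (hasDerivAt_inv (ne_of_gt hs)).hasDerivWithinAt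

lemma beta_integrable {u v : ℝ} (hu : 0 < u) (hv : 0 < v) :
    IntegrableOn (fun t : ℝ => t ^ (u - 1) / (1 + t) ^ (u + v)) (Set.Ioi 0) := by
  have hmeas : Measurable (fun t : ℝ => t ^ (u - 1) / (1 + t) ^ (u + v)) := by fun_prop
  rw [← Set.Ioc_union_Ioi_eq_Ioi (zero_le_one' ℝ)]
  refine IntegrableOn.union ?_ ?_
  · have h1 : IntegrableOn (fun t : ℝ => t ^ (u - 1)) (Set.Ioc 0 1) := by
      rw [← intervalIntegrable_iff_integrableOn_Ioc_of_le zero_le_one]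
      exact intervalIntegral.intervalIntegrable_rpow' (by linarith)
    refine Integrable.mono' h1 hmeas.aestronglyMeasurable ?_
    refine (ae_restrict_iff' measurableSet_Ioc).2 (Filter.Eventually.of_forall fun t ht => ?_)
    have h0 := ht.1
    rw [Real.norm_of_nonneg (by positivity)]
    exact div_le_self (by positivity) (Real.one_le_rpow (by linarith) (by linarith))
  · have h1 : IntegrableOn (fun t : ℝ => t ^ (-v - 1)) (Set.Ioi 1) :=
      integrableOn_Ioi_rpow_of_lt (by linarith) one_pos
    refine Integrable.mono' h1 hmeas.aestronglyMeasurable ?_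
    refine (ae_restrict_iff' measurableSet_Ioi).2 (Filter.Eventually.of_forall fun t ht => ?_)
    have h0 : (1 : ℝ) < t := ht
    have h2 : 0 < t := by linarith
    rw [Real.norm_of_nonneg (by positivity)]
    rw [div_le_iff₀ (by positivity)]
    calc t ^ (u - 1) = t ^ (-v - 1) * t ^ (u + v) := by
          rw [← Real.rpow_add h2]; congr 1; ring
      _ ≤ _ := by
          gcongr
          linarith

lemma Bl_eq {u v : ℝ} (hu : 0 < u) (hv : 0 < v) : Bl u v = ENNReal.ofReal (betaFn u v) := by
  unfold betaFn Bl
  rw [ofReal_integral_eq_lintegral_ofReal (beta_integrable hu hv)]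
  · refine setLIntegral_congr_fun measurableSet_Ioi fun t ht => ?_
    have ht0 : (0 : ℝ) < t := ht
    rw [Real.rpow_neg (by positivity)]
    rfl
  · refine (ae_restrict_iff' measurableSet_Ioi).2 (Filter.Eventually.of_forall fun t ht => ?_)
    have ht0 : (0 : ℝ) < t := ht
    simp only [Pi.zero_apply]
    positivity

lemma betaFn_nonneg (u v : ℝ) : 0 ≤ betaFn u v := by
  unfold betaFn
  refine setIntegral_nonneg measurableSet_Ioi fun t ht => ?_
  have ht0 : (0 : ℝ) < t := ht
  positivity

/-- The one-sided Schur bound. -/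
lemma schur {β u v X : ℝ} (hβ0 : 0 < β) (hβ1 : β ≤ 1) (hu : 0 < u) (hv : 0 < v) (hv1 : v < 1)
    (hX : 0 < X) :
    ∑' n : ℕ, ENNReal.ofReal (Gf β (1 - v) (u + v) X ((n : ℝ) + 2)) ≤
      ENNReal.ofReal (β⁻¹ * X ^ (-u)) * Bl v u := by
  have h := sum_le_lint _ 1 (Gf_anti (σ := 1 - v) (γ := u + v) (X := X) hβ0 hβ1 (by linarith)
    (by linarith) hX.le)
  have e : ∀ n : ℕ, (1 : ℝ) + n + 1 = n + 2 := fun n => by ring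
  simp only [e] at h
  rw [cov hβ0 hX le_rfl] at h
  simp only [Real.log_one, Real.zero_rpow hβ0.ne', zero_div] at h
  unfold Bl
  rw [show 1 - (1 - v) - (u + v) = -u by ring, show -(1 - v) = v - 1 by ring] at h
  rwa [add_comm v u]

noncomputable def Kr (p q α β u v s t : ℝ) : ℝ :=
  (Real.log s ^ (α - 1) / s) ^ (1 / p) * (Real.log s ^ α) ^ (u - 1 / p) *
    (Real.log t ^ (β - 1) / t) ^ (1 / q) * (Real.log t ^ β) ^ (v - 1 / q) *
    (Real.log s ^ α + Real.log t ^ β) ^ (-(u + v))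

lemma log_two_pos' (n : ℕ) : 0 < Real.log ((n : ℝ) + 2) :=
  Real.log_pos (by have : (0 : ℝ) ≤ n := n.cast_nonneg
                   linarith)

noncomputable def Df (p α β u v s t : ℝ) : ℝ :=
  (Real.log s ^ (α - 1) / s) * (Real.log s ^ α) ^ (u * p - 1) * (Real.log t ^ β) ^ v *
    (Real.log s ^ α + Real.log t ^ β) ^ (-(u + v))

lemma Kr_split {p q α β u v s t : ℝ} (hp : 1 < p) (hq : 1 / p + 1 / q = 1) (hs : 1 < s)
    (ht : 1 < t) :
    Kr p q α β u v s t =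
      Gf β (1 - v) (u + v) (Real.log s ^ α) t ^ (1 / q) * Df p α β u v s t ^ (1 / p) := by
  have hls := Real.log_pos hs
  have hlt := Real.log_pos ht
  unfold Kr Gf Df
  have ha : 0 < Real.log s ^ (α - 1) / s := by positivity
  have hb : 0 < Real.log t ^ (β - 1) / t := by positivity
  have hX : 0 < Real.log s ^ α := by positivity
  have hY : 0 < Real.log t ^ β := by positivity
  have hZ : 0 < Real.log s ^ α + Real.log t ^ β := by positivity
  generalize Real.log s ^ α + Real.log t ^ β = Z at *
  generalize Real.log s ^ (α - 1) / s = a at *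
  generalize Real.log t ^ (β - 1) / t = b at *
  generalize Real.log s ^ α = X at *
  generalize Real.log t ^ β = Y at *
  obtain ⟨x, rfl⟩ := exists_exp hX
  obtain ⟨y, rfl⟩ := exists_exp hY
  obtain ⟨z, rfl⟩ := exists_exp hZ
  obtain ⟨a, rfl⟩ := exists_exp ha
  obtain ⟨b, rfl⟩ := exists_exp hb
  simp only [← Real.exp_add, ← Real.exp_mul]
  congr 1
  rw [show 1 / q = 1 - 1 / p by linarith]
  field_simp
  ring

lemma Df_eq {p α β u v s t : ℝ} (hs : 1 < s) (ht : 1 < t) :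
    (Real.log s ^ α) ^ (-u * (p - 1)) * Df p α β u v s t =
      (Real.log t ^ β) ^ v * Gf α (1 - u) (u + v) (Real.log t ^ β) s := by
  have hls := Real.log_pos hs
  have hlt := Real.log_pos ht
  unfold Gf Df
  rw [add_comm (Real.log t ^ β)]
  have hX : 0 < Real.log s ^ α := by positivity
  have : (Real.log s ^ α) ^ (-(1 - u)) =
      (Real.log s ^ α) ^ (-u * (p - 1)) * (Real.log s ^ α) ^ (u * p - 1) := by
    rw [← Real.rpow_add hX]; congr 1; ring
  rw [this]
  ring

lemma upper {p q α β u v : ℝ} (hp : 1 < p) (hq : 1 / p + 1 / q = 1)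
    (hα0 : 0 < α) (hα1 : α ≤ 1) (hβ0 : 0 < β) (hβ1 : β ≤ 1) (hu : 0 < u) (hu1 : u < 1)
    (hv : 0 < v) (hv1 : v < 1) (b : ℕ → ℝ≥0∞) :
    ∑' m : ℕ, (∑' n : ℕ, ENNReal.ofReal (Kr p q α β u v ((m : ℝ) + 2) ((n : ℝ) + 2)) * b n) ^ p ≤
      (ENNReal.ofReal (α ^ (-(1 / p)) * β ^ (-(1 / q))) * Bl u v) ^ p * ∑' n, b n ^ p := by
  have hp0 : 0 < p := by linarith
  have hqi : 1 / q = 1 - 1 / p := by linarith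
  have hp1 : 1 / p < 1 := by rw [div_lt_one hp0]; exact hp
  have hq0 : 0 < q := by
    have : 0 < 1 / q := by linarith
    exact one_div_pos.1 this
  have hpq : p.HolderConjugate q := by
    rw [Real.holderConjugate_iff]
    refine ⟨hp, ?_⟩
    simpa using hq
  have hn2 : ∀ n : ℕ, (1 : ℝ) < (n : ℝ) + 2 := fun n => by
    have : (0 : ℝ) ≤ n := n.cast_nonneg
    linarith
  have hDpos : ∀ m n : ℕ, 0 < Df p α β u v ((m : ℝ) + 2) ((n : ℝ) + 2) := fun m n => by
    have := log_two_pos' m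
    have := log_two_pos' n
    unfold Df
    positivity
  have hGpos : ∀ (m n : ℕ), 0 < Gf β (1 - v) (u + v) (Real.log ((m : ℝ) + 2) ^ α) ((n : ℝ) + 2) :=
    fun m n => by
      have := log_two_pos' m
      have := log_two_pos' n
      unfold Gf
      positivity
  have key : ∀ m : ℕ,
      (∑' n : ℕ, ENNReal.ofReal (Kr p q α β u v ((m : ℝ) + 2) ((n : ℝ) + 2)) * b n) ^ p ≤
      (ENNReal.ofReal β⁻¹ * Bl u v) ^ (p - 1) *
        ∑' n : ℕ, ENNReal.ofReal (Gf α (1 - u) (u + v) (Real.log ((n : ℝ) + 2) ^ β) ((m : ℝ) + 2)) *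
          (ENNReal.ofReal ((Real.log ((n : ℝ) + 2) ^ β) ^ v) * b n ^ p) := by
    intro m
    have hX : 0 < Real.log ((m : ℝ) + 2) ^ α := by
      have := log_two_pos' m
      positivity
    set A : ℕ → ℝ≥0∞ := fun n =>
      ENNReal.ofReal (Gf β (1 - v) (u + v) (Real.log ((m : ℝ) + 2) ^ α) ((n : ℝ) + 2)) with hA
    set D : ℕ → ℝ≥0∞ := fun n => ENNReal.ofReal (Df p α β u v ((m : ℝ) + 2) ((n : ℝ) + 2)) with hD
    have h1 := ENNReal.lintegral_mul_le_Lp_mul_Lq (Measure.count : Measure ℕ) hpq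
      (f := fun n => D n ^ (1 / p) * b n) (g := fun n => A n ^ (1 / q))
      (measurable_of_countable _).aemeasurable (measurable_of_countable _).aemeasurable
    simp only [lintegral_count, Pi.mul_apply] at h1
    have e1 : ∀ n, (A n ^ (1 / q)) ^ q = A n := fun n => by
      rw [← ENNReal.rpow_mul, one_div_mul_cancel hq0.ne', ENNReal.rpow_one]
    have e2 : ∀ n, (D n ^ (1 / p) * b n) ^ p = D n * b n ^ p := fun n => by
      rw [ENNReal.mul_rpow_of_nonneg _ _ hp0.le, ← ENNReal.rpow_mul, one_div_mul_cancel hp0.ne',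
        ENNReal.rpow_one]
    have e3 : ∀ n, D n ^ (1 / p) * b n * A n ^ (1 / q) =
        ENNReal.ofReal (Kr p q α β u v ((m : ℝ) + 2) ((n : ℝ) + 2)) * b n := fun n => by
      rw [Kr_split hp hq (hn2 m) (hn2 n), ENNReal.ofReal_mul (by have := hGpos m n; positivity),
        ← ENNReal.ofReal_rpow_of_pos (hGpos m n), ← ENNReal.ofReal_rpow_of_pos (hDpos m n)]
      simp only [hA, hD]
      ring
    simp only [e1, e2, e3] at h1
    have h2 := ENNReal.rpow_le_rpow h1 hp0.le
    rw [ENNReal.mul_rpow_of_nonneg _ _ hp0.le, ← ENNReal.rpow_mul, ← ENNReal.rpow_mul,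
      one_div_mul_cancel hp0.ne', ENNReal.rpow_one,
      show 1 / q * p = p - 1 by rw [hqi]; field_simp] at h2
    refine h2.trans ?_
    have h3 : (∑' n, A n) ^ (p - 1) ≤
        ENNReal.ofReal ((Real.log ((m : ℝ) + 2) ^ α) ^ (-u * (p - 1))) *
          (ENNReal.ofReal β⁻¹ * Bl u v) ^ (p - 1) := by
      refine (ENNReal.rpow_le_rpow (schur hβ0 hβ1 hu hv hv1 hX) (by linarith)).trans (le_of_eq ?_)
      rw [Real.rpow_mul hX.le, ← ENNReal.ofReal_rpow_of_pos (by positivity),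
        ← ENNReal.mul_rpow_of_nonneg _ _ (by linarith), Bl_symm v u,
        ENNReal.ofReal_mul (by positivity)]
      congr 1
      ring
    calc _ ≤ (∑' n, D n * b n ^ p) *
          (ENNReal.ofReal ((Real.log ((m : ℝ) + 2) ^ α) ^ (-u * (p - 1))) *
          (ENNReal.ofReal β⁻¹ * Bl u v) ^ (p - 1)) := by gcongr
      _ = (ENNReal.ofReal β⁻¹ * Bl u v) ^ (p - 1) *
          (ENNReal.ofReal ((Real.log ((m : ℝ) + 2) ^ α) ^ (-u * (p - 1))) *
            ∑' n, D n * b n ^ p) := by ring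
      _ = _ := by
        rw [← ENNReal.tsum_mul_left]
        congr 2
        funext n
        rw [← mul_assoc, ← mul_assoc]
        congr 1
        simp only [hD]
        have hY := log_two_pos' n
        rw [← ENNReal.ofReal_mul (by positivity), Df_eq (hn2 m) (hn2 n), mul_comm,
          ENNReal.ofReal_mul (Gf_nonneg (by positivity) (hn2 m))]
  calc _ ≤ ∑' m : ℕ, (ENNReal.ofReal β⁻¹ * Bl u v) ^ (p - 1) *
        ∑' n : ℕ, ENNReal.ofReal (Gf α (1 - u) (u + v) (Real.log ((n : ℝ) + 2) ^ β) ((m : ℝ) + 2)) *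
          (ENNReal.ofReal ((Real.log ((n : ℝ) + 2) ^ β) ^ v) * b n ^ p) := ENNReal.tsum_le_tsum key
    _ = (ENNReal.ofReal β⁻¹ * Bl u v) ^ (p - 1) * ∑' n : ℕ,
        (∑' m : ℕ, ENNReal.ofReal (Gf α (1 - u) (u + v) (Real.log ((n : ℝ) + 2) ^ β) ((m : ℝ) + 2))) *
          (ENNReal.ofReal ((Real.log ((n : ℝ) + 2) ^ β) ^ v) * b n ^ p) := by
        rw [ENNReal.tsum_mul_left, ENNReal.tsum_comm]
        simp only [ENNReal.tsum_mul_right]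
    _ ≤ (ENNReal.ofReal β⁻¹ * Bl u v) ^ (p - 1) * ∑' n : ℕ,
        (ENNReal.ofReal α⁻¹ * Bl u v) * b n ^ p := by
        refine mul_le_mul_right (ENNReal.tsum_le_tsum fun n => ?_) _
        have hY : 0 < Real.log ((n : ℝ) + 2) ^ β := by
          have := log_two_pos' n
          positivity
        have h := schur (X := Real.log ((n : ℝ) + 2) ^ β) hα0 hα1 hv hu hu1 hY
        rw [add_comm v u] at h
        rw [← mul_assoc]
        refine mul_le_mul_left ?_ _
        refine (mul_le_mul_left h _).trans (le_of_eq ?_)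
        rw [mul_right_comm, ← ENNReal.ofReal_mul (by positivity), mul_assoc α⁻¹,
          ← Real.rpow_add hY]
        simp
    _ = _ := by
        rw [ENNReal.tsum_mul_left, ← mul_assoc]
        congr 1
        rw [ENNReal.mul_rpow_of_nonneg _ _ (by linarith), ENNReal.mul_rpow_of_nonneg _ _ hp0.le,
          ENNReal.ofReal_rpow_of_pos (by positivity), ENNReal.ofReal_rpow_of_pos (by positivity)]
        have e4 : Bl u v ^ p = Bl u v ^ (p - 1) * Bl u v := by
          conv_rhs => rw [← ENNReal.rpow_one (Bl u v), ← ENNReal.rpow_mul, one_mul]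
          rw [← ENNReal.rpow_add_of_nonneg _ _ (by linarith) zero_le_one]
          congr 1; ring
        have e5 : (α ^ (-(1 / p)) * β ^ (-(1 / q))) ^ p = β⁻¹ ^ (p - 1) * α⁻¹ := by
          rw [hqi]
          obtain ⟨a, rfl⟩ := exists_exp hα0
          obtain ⟨c, rfl⟩ := exists_exp hβ0
          simp only [← Real.exp_neg, ← Real.exp_add, ← Real.exp_mul]
          congr 1
          field_simp
          ring
        rw [e4, e5, ENNReal.ofReal_mul (by positivity)]
        ring

lemma tail_int {α ε a : ℝ} (hα0 : 0 < α) (hε : 0 < ε) (ha : 1 < a) :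
    ∫⁻ s in Set.Ioi a, ENNReal.ofReal (Gf α (1 + ε) 0 1 s) =
      ENNReal.ofReal (α⁻¹ * ((Real.log a ^ α) ^ (-ε) / ε)) := by
  have hl : 0 < Real.log a ^ α := by
    have := Real.log_pos ha
    positivity
  rw [cov hα0 one_pos ha.le]
  simp only [Real.one_rpow, mul_one, neg_zero, Real.rpow_zero, div_one]
  rw [← ofReal_integral_eq_lintegral_ofReal, integral_Ioi_rpow_of_lt (by linarith) hl,
    ← ENNReal.ofReal_mul (by positivity)]
  · congr 2
    rw [show -(1 + ε) + 1 = -ε by ring, neg_div_neg_eq]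
  · exact integrableOn_Ioi_rpow_of_lt (by linarith) hl
  · refine (ae_restrict_iff' measurableSet_Ioi).2 (Filter.Eventually.of_forall fun t ht => ?_)
    have ht0 : (0 : ℝ) < t := hl.trans ht
    simp only [Pi.zero_apply]
    positivity

noncomputable def Jl (u v T : ℝ) : ℝ≥0∞ :=
  ∫⁻ t in Set.Ioo T⁻¹ T, ENNReal.ofReal (t ^ (v - 1) * (1 + t) ^ (-(u + v)))

lemma Jl_sup (u v : ℝ) : ⨆ k : ℕ, Jl u v ((k : ℝ) + 1) = Bl v u := by
  unfold Jl Bl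
  have hmono : Monotone (fun k : ℕ => Set.Ioo ((k : ℝ) + 1)⁻¹ ((k : ℝ) + 1)) := by
    intro i j h
    have h' : (i : ℝ) ≤ j := by exact_mod_cast h
    refine Set.Ioo_subset_Ioo ?_ ?_
    · gcongr
    · linarith
  rw [← setLIntegral_iUnion_of_directed _ hmono.directed_le, add_comm v u]
  congr 2
  ext t
  simp only [Set.mem_iUnion, Set.mem_Ioo, Set.mem_Ioi]
  constructor
  · rintro ⟨k, h1, h2⟩
    exact lt_trans (by positivity) h1
  · intro ht
    obtain ⟨k, hk⟩ := exists_nat_gt (max t t⁻¹)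
    have h1 := (le_max_left _ _).trans_lt hk
    have h2 := (le_max_right _ _).trans_lt hk
    refine ⟨k, ?_, by linarith⟩
    rw [inv_lt_comm₀ (by positivity) ht]
    linarith

lemma lower_n {β u v X T e : ℝ} (hβ0 : 0 < β) (hβ1 : β ≤ 1) (hu : 0 < u) (hv : 0 < v) (hv1 : v < 1)
    (hX : 0 < X) (hT : 1 ≤ T) (he : 0 ≤ e) (hXT : T * Real.log 2 ^ β ≤ X) :
    ENNReal.ofReal (β⁻¹ * X ^ (-u - e) * T ^ (-e)) * Jl u v T ≤
      ∑' n : ℕ, ENNReal.ofReal (Gf β (1 - v + e) (u + v) X ((n : ℝ) + 2)) := by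
  have hT0 : 0 < T := by linarith
  have h := lint_le_sum _ 2 ((Gf_anti (σ := 1 - v + e) (γ := u + v) (X := X) hβ0 hβ1 (by linarith)
    (by linarith) hX.le).mono (fun s hs => Set.mem_Ioi.2 (lt_of_lt_of_le one_lt_two (Set.mem_Ici.1 hs))))
  simp only [add_comm (2 : ℝ)] at h
  refine le_trans ?_ h
  rw [cov hβ0 hX (by norm_num), show 1 - (1 - v + e) - (u + v) = -u - e by ring,
    ENNReal.ofReal_mul (by positivity), mul_assoc]
  refine mul_le_mul_right ?_ _
  unfold Jl
  rw [← lintegral_const_mul' _ _ ENNReal.ofReal_ne_top]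
  have hsub : Set.Ioo T⁻¹ T ⊆ Set.Ioi (Real.log 2 ^ β / X) := by
    intro t ht
    refine lt_of_le_of_lt ?_ ht.1
    rw [div_le_iff₀ hX, inv_mul_eq_div, le_div_iff₀ hT0]
    linarith
  refine le_trans ?_ (lintegral_mono_set hsub)
  refine setLIntegral_mono' measurableSet_Ioo fun t ht => ?_
  have ht0 : 0 < t := lt_trans (by positivity) ht.1
  rw [← ENNReal.ofReal_mul (by positivity)]
  refine ENNReal.ofReal_le_ofReal ?_
  rw [← mul_assoc]
  gcongr
  calc T ^ (-e) * t ^ (v - 1) ≤ t ^ (-e) * t ^ (v - 1) := by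
        refine mul_le_mul_of_nonneg_right ?_ (by positivity)
        exact Real.rpow_le_rpow_of_nonpos ht0 ht.2.le (by linarith)
    _ = t ^ (-(1 - v + e)) := by
        rw [← Real.rpow_add ht0]
        congr 1
        ring

lemma lower_main {p q α β u v : ℝ} (hp : 1 < p) (hq : 1 / p + 1 / q = 1)
    (hα0 : 0 < α) (hα1 : α ≤ 1) (hβ0 : 0 < β) (hβ1 : β ≤ 1) (hu : 0 < u) (hu1 : u < 1)
    (hv : 0 < v) (hv1 : v < 1) {T : ℝ} (hT : 1 ≤ T) {C : ℝ≥0∞}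
    (hC : ∀ b : ℕ → ℝ, (∀ n, 0 ≤ b n) → ∑' n, ENNReal.ofReal (b n) ^ p ≠ ⊤ →
      ∑' m : ℕ, (∑' n : ℕ, ENNReal.ofReal (Kr p q α β u v ((m : ℝ) + 2) ((n : ℝ) + 2)) *
        ENNReal.ofReal (b n)) ^ p ≤ C ^ p * ∑' n, ENNReal.ofReal (b n) ^ p) :
    ENNReal.ofReal (α ^ (-(1 / p)) * β ^ (-(1 / q))) * Jl u v T ≤ C := by
  rcases eq_or_ne C ⊤ with rfl | hCt
  · exact le_top
  have hp0 : 0 < p := by linarith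
  have hT0 : 0 < T := by linarith
  have hqi : 1 / q = 1 - 1 / p := by linarith
  have hn2 : ∀ n : ℕ, (1 : ℝ) < (n : ℝ) + 2 := fun n => by
    have : (0 : ℝ) ≤ n := n.cast_nonneg
    linarith
  have hl2 : 0 < Real.log 2 := Real.log_pos one_lt_two
  obtain ⟨M, hM⟩ : ∃ M : ℕ, ∀ m : ℕ, M ≤ m → T * Real.log 2 ^ β ≤ Real.log ((m : ℝ) + 2) ^ α := by
    obtain ⟨M, hM⟩ := exists_nat_ge (Real.exp ((T * Real.log 2 ^ β) ^ α⁻¹))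
    refine ⟨M, fun m hm => ?_⟩
    have h1 : (M : ℝ) ≤ m := by exact_mod_cast hm
    have h2 : (T * Real.log 2 ^ β) ^ α⁻¹ ≤ Real.log ((m : ℝ) + 2) := by
      rw [Real.le_log_iff_exp_le (by linarith [hn2 m])]
      linarith
    have h3 := Real.rpow_le_rpow (by positivity) h2 hα0.le
    rwa [Real.rpow_inv_rpow (by positivity) hα0.ne'] at h3
  have key : ∀ ε : ℝ, 0 < ε →
      ENNReal.ofReal (α⁻¹ * (Real.log ((M : ℝ) + 2) ^ α) ^ (-ε) * (β ^ (-p) * T ^ (-ε))) *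
        Jl u v T ^ p ≤
      C ^ p * ENNReal.ofReal (ε * Gf β (1 + ε) 0 1 2 + β⁻¹ * (Real.log 2 ^ β) ^ (-ε)) := by
    intro ε hε
    set b : ℕ → ℝ := fun n => (Real.log ((n : ℝ) + 2) ^ (β - 1) / ((n : ℝ) + 2)) ^ (1 / p) *
      (Real.log ((n : ℝ) + 2) ^ β) ^ (-(1 + ε) / p) with hb
    have hbpos : ∀ n, 0 < b n := fun n => by
      have := log_two_pos' n
      simp only [hb]
      positivity
    have hbp : ∀ n, ENNReal.ofReal (b n) ^ p = ENNReal.ofReal (Gf β (1 + ε) 0 1 ((n : ℝ) + 2)) := by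
      intro n
      rw [ENNReal.ofReal_rpow_of_pos (hbpos n)]
      congr 1
      have := log_two_pos' n
      simp only [hb, Gf, neg_zero, Real.rpow_zero, mul_one]
      rw [Real.mul_rpow (by positivity) (by positivity), ← Real.rpow_mul (by positivity),
        ← Real.rpow_mul (by positivity), one_div_mul_cancel hp0.ne', div_mul_cancel₀ _ hp0.ne',
        Real.rpow_one]
    have hsum : ∑' n, ENNReal.ofReal (b n) ^ p ≤
        ENNReal.ofReal (Gf β (1 + ε) 0 1 2 + β⁻¹ * ((Real.log 2 ^ β) ^ (-ε) / ε)) := by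
      simp only [hbp]
      rw [tsum_eq_zero_add' ENNReal.summable, ENNReal.ofReal_add
        (Gf_nonneg zero_le_one one_lt_two) (by positivity)]
      simp only [Nat.cast_zero, zero_add]
      refine add_le_add le_rfl ?_
      rw [← tail_int hβ0 hε one_lt_two]
      have h := sum_le_lint _ 2 ((Gf_anti (σ := 1 + ε) (γ := 0) (X := 1) hβ0 hβ1 (by linarith)
        le_rfl zero_le_one).mono (fun s hs => Set.mem_Ioi.2 (lt_trans one_lt_two (Set.mem_Ioi.1 hs))))
      refine le_trans (le_of_eq ?_) h
      refine tsum_congr fun n => ?_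
      congr 2
      push_cast
      ring
    have hmain := hC b (fun n => (hbpos n).le) (ne_top_of_le_ne_top ENNReal.ofReal_ne_top hsum)
    have hrow : ∀ m : ℕ, M ≤ m → ENNReal.ofReal (Gf α (1 + ε) 0 1 ((m : ℝ) + 2)) *
        (ENNReal.ofReal (β ^ (-p) * T ^ (-ε)) * Jl u v T ^ p) ≤
        (∑' n : ℕ, ENNReal.ofReal (Kr p q α β u v ((m : ℝ) + 2) ((n : ℝ) + 2)) *
        ENNReal.ofReal (b n)) ^ p := by
      intro m hm
      have hlm := log_two_pos' m
      have hX : 0 < Real.log ((m : ℝ) + 2) ^ α := by positivity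
      have hph : 0 < Real.log ((m : ℝ) + 2) ^ (α - 1) / ((m : ℝ) + 2) := by positivity
      have h1 := lower_n (e := ε / p) hβ0 hβ1 hu hv hv1 hX hT (by positivity) (hM m hm)
      have h2 : ∀ n : ℕ, ENNReal.ofReal (Kr p q α β u v ((m : ℝ) + 2) ((n : ℝ) + 2)) *
          ENNReal.ofReal (b n) =
          ENNReal.ofReal ((Real.log ((m : ℝ) + 2) ^ (α - 1) / ((m : ℝ) + 2)) ^ (1 / p) *
            (Real.log ((m : ℝ) + 2) ^ α) ^ (u - 1 / p)) *
          ENNReal.ofReal (Gf β (1 - v + ε / p) (u + v) (Real.log ((m : ℝ) + 2) ^ α) ((n : ℝ) + 2)) := by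
        intro n
        have hln := log_two_pos' n
        rw [← ENNReal.ofReal_mul' (hbpos n).le, ← ENNReal.ofReal_mul (by positivity)]
        congr 1
        simp only [hb, Kr, Gf]
        have hY : 0 < Real.log ((n : ℝ) + 2) ^ β := by positivity
        have hph' : 0 < Real.log ((n : ℝ) + 2) ^ (β - 1) / ((n : ℝ) + 2) := by positivity
        have hZ : 0 < Real.log ((m : ℝ) + 2) ^ α + Real.log ((n : ℝ) + 2) ^ β := by positivity
        generalize Real.log ((m : ℝ) + 2) ^ α + Real.log ((n : ℝ) + 2) ^ β = Z at *
        generalize Real.log ((n : ℝ) + 2) ^ (β - 1) / ((n : ℝ) + 2) = y' at *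
        generalize Real.log ((n : ℝ) + 2) ^ β = Y at *
        have e1 : y' ^ (1 / q) * y' ^ (1 / p) = y' := by
          rw [← Real.rpow_add hph', add_comm, hq, Real.rpow_one]
        have e2 : Y ^ (v - 1 / q) * Y ^ (-(1 + ε) / p) = Y ^ (-(1 - v + ε / p)) := by
          rw [← Real.rpow_add hY, hqi]
          congr 1
          field_simp
          ring
        rw [← e2]
        nth_rewrite 3 [← e1]
        ring
      simp only [h2]
      rw [ENNReal.tsum_mul_left]
      refine le_trans (le_of_eq ?_) (ENNReal.rpow_le_rpow (mul_le_mul_right h1 _) hp0.le)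
      rw [← mul_assoc, ← mul_assoc, ← ENNReal.ofReal_mul (Gf_nonneg zero_le_one (hn2 m)),
        ← ENNReal.ofReal_mul (by positivity),
        ENNReal.mul_rpow_of_nonneg _ _ hp0.le, ENNReal.ofReal_rpow_of_pos (by positivity)]
      congr 2
      simp only [Gf, neg_zero, Real.rpow_zero, mul_one]
      generalize Real.log ((m : ℝ) + 2) ^ (α - 1) / ((m : ℝ) + 2) = y' at *
      generalize Real.log ((m : ℝ) + 2) ^ α = X at *
      obtain ⟨x, rfl⟩ := exists_exp hX
      obtain ⟨y, rfl⟩ := exists_exp hph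
      obtain ⟨t, rfl⟩ := exists_exp hT0
      obtain ⟨c, rfl⟩ := exists_exp hβ0
      simp only [← Real.exp_neg, ← Real.exp_add, ← Real.exp_mul]
      congr 1
      field_simp
      ring
    have hlow : ENNReal.ofReal (α⁻¹ * ((Real.log ((M : ℝ) + 2) ^ α) ^ (-ε) / ε)) *
        (ENNReal.ofReal (β ^ (-p) * T ^ (-ε)) * Jl u v T ^ p) ≤
        C ^ p * ENNReal.ofReal (Gf β (1 + ε) 0 1 2 + β⁻¹ * ((Real.log 2 ^ β) ^ (-ε) / ε)) := by
      refine le_trans ?_ (hmain.trans (mul_le_mul_right hsum _))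
      refine le_trans ?_ (ENNReal.tsum_comp_le_tsum_of_injective (add_left_injective M) _)
      refine le_trans ?_ (ENNReal.tsum_le_tsum fun k => hrow (k + M) (Nat.le_add_left _ _))
      rw [ENNReal.tsum_mul_right]
      refine mul_le_mul_left ?_ _
      rw [← tail_int hα0 hε (hn2 M)]
      have h := lint_le_sum _ ((M : ℝ) + 2) ((Gf_anti (σ := 1 + ε) (γ := 0) (X := 1) hα0 hα1
        (by linarith) le_rfl zero_le_one).mono (fun s hs => Set.mem_Ioi.2 (lt_of_lt_of_le (hn2 M) (Set.mem_Ici.1 hs))))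
      refine h.trans (le_of_eq ?_)
      refine tsum_congr fun n => ?_
      congr 2
      push_cast
      ring
    have hlM := log_two_pos' M
    have h5 := mul_le_mul_right hlow (ENNReal.ofReal ε)
    calc _ = ENNReal.ofReal ε * (ENNReal.ofReal (α⁻¹ * ((Real.log ((M : ℝ) + 2) ^ α) ^ (-ε) / ε)) *
        (ENNReal.ofReal (β ^ (-p) * T ^ (-ε)) * Jl u v T ^ p)) := by
          rw [← mul_assoc (ENNReal.ofReal ε), ← ENNReal.ofReal_mul hε.le,
            ← mul_assoc (ENNReal.ofReal (ε * _)), ← ENNReal.ofReal_mul (p := ε * _) (by positivity)]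
          congr 2
          field_simp
      _ ≤ _ := h5
      _ = _ := by
          rw [mul_left_comm, ← ENNReal.ofReal_mul hε.le]
          congr 2
          field_simp
  have hcont : ∀ {c : ℝ}, 0 < c → Filter.Tendsto (fun ε : ℝ => c ^ (-ε)) (nhdsWithin 0 (Set.Ioi 0))
      (nhds 1) := by
    intro c hc
    have : Continuous (fun ε : ℝ => c ^ (-ε)) :=
      Continuous.rpow continuous_const continuous_neg (fun _ => Or.inl hc.ne')
    have h := this.tendsto 0
    simp only [neg_zero, Real.rpow_zero] at h
    exact h.mono_left nhdsWithin_le_nhds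
  have hid : Filter.Tendsto (fun ε : ℝ => ε) (nhdsWithin 0 (Set.Ioi 0)) (nhds 0) :=
    (continuous_id.tendsto (0 : ℝ)).mono_left nhdsWithin_le_nhds
  have hlM := log_two_pos' M
  have hL : Filter.Tendsto (fun ε : ℝ => ENNReal.ofReal (α⁻¹ * (Real.log ((M : ℝ) + 2) ^ α) ^ (-ε) *
      (β ^ (-p) * T ^ (-ε))) * Jl u v T ^ p) (nhdsWithin 0 (Set.Ioi 0))
      (nhds (ENNReal.ofReal (α⁻¹ * 1 * (β ^ (-p) * 1)) * Jl u v T ^ p)) := by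
    refine ENNReal.Tendsto.mul_const (ENNReal.tendsto_ofReal ?_) (Or.inl ?_)
    · exact (tendsto_const_nhds.mul (hcont (by positivity))).mul
        (tendsto_const_nhds.mul (hcont hT0))
    · have : 0 < α⁻¹ * 1 * (β ^ (-p) * 1) := by positivity
      exact (ENNReal.ofReal_pos.2 this).ne'
  have hG : Filter.Tendsto (fun ε : ℝ => Gf β (1 + ε) 0 1 2) (nhdsWithin 0 (Set.Ioi 0))
      (nhds (Gf β (1 + 0) 0 1 2)) := by
    have : Continuous (fun ε : ℝ => Gf β (1 + ε) 0 1 2) := by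
      unfold Gf
      refine (continuous_const.mul (Continuous.rpow continuous_const (by fun_prop)
        (fun _ => Or.inl (by positivity)))).mul continuous_const
    exact (this.tendsto 0).mono_left nhdsWithin_le_nhds
  have hR : Filter.Tendsto (fun ε : ℝ =>
      C ^ p * ENNReal.ofReal (ε * Gf β (1 + ε) 0 1 2 + β⁻¹ * (Real.log 2 ^ β) ^ (-ε)))
      (nhdsWithin 0 (Set.Ioi 0))
      (nhds (C ^ p * ENNReal.ofReal (0 * Gf β (1 + 0) 0 1 2 + β⁻¹ * 1))) := by
    refine ENNReal.Tendsto.const_mul (ENNReal.tendsto_ofReal ?_)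
      (Or.inr (ENNReal.rpow_ne_top_of_nonneg hp0.le hCt))
    exact (hid.mul hG).add (tendsto_const_nhds.mul (hcont (by positivity)))
  have hlim := le_of_tendsto_of_tendsto hL hR
    (Filter.eventually_of_mem self_mem_nhdsWithin fun ε hε => key ε hε)
  simp only [zero_mul, zero_add, mul_one] at hlim
  have h6 := mul_le_mul_right hlim (ENNReal.ofReal β)
  rw [mul_left_comm (ENNReal.ofReal β) (C ^ p), ← ENNReal.ofReal_mul hβ0.le,
    mul_inv_cancel₀ hβ0.ne', ENNReal.ofReal_one,
    mul_one, ← mul_assoc, ← ENNReal.ofReal_mul hβ0.le] at h6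
  rw [← ENNReal.rpow_le_rpow_iff hp0, ENNReal.mul_rpow_of_nonneg _ _ hp0.le,
    ENNReal.ofReal_rpow_of_pos (by positivity)]
  refine le_trans (le_of_eq ?_) h6
  congr 2
  rw [hqi]
  obtain ⟨a, rfl⟩ := exists_exp hα0
  obtain ⟨c, rfl⟩ := exists_exp hβ0
  simp only [← Real.exp_neg, ← Real.exp_add, ← Real.exp_mul]
  congr 1
  field_simp
  ring

lemma kernel_eq {p q α β μ ν s t : ℝ} (hp : 1 < p) (hq : 1 / p + 1 / q = 1) (hs : 1 < s)
    (ht : 1 < t) :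
    Real.log s ^ (((α - 1) + α * μ) / p) / s ^ (1 / p) *
      (Real.log t ^ (((β - 1) - (q - 1) * β * ν) / q) /
          (t ^ (1 / q) * (Real.log s ^ α + Real.log t ^ β) ^ (1 + (μ - ν) / p))) =
      Kr p q α β ((1 + μ) / p) ((p - 1 - ν) / p) s t := by
  have hls := Real.log_pos hs
  have hlt := Real.log_pos ht
  have hs0 : 0 < s := by linarith
  have ht0 : 0 < t := by linarith
  have hZ : 0 < Real.log s ^ α + Real.log t ^ β := by positivity
  unfold Kr
  have hp0 : p ≠ 0 := by linarith
  have hq0 : q ≠ 0 := by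
    rintro rfl
    have : 1 / p < 1 := by rw [div_lt_one (by linarith)]; exact hp
    simp at hq
    linarith
  have hqp : q = p / (p - 1) := by
    have : p - 1 ≠ 0 := by linarith
    field_simp at hq ⊢
    linarith
  have hp1 : p - 1 ≠ 0 := by linarith
  generalize Real.log s ^ α + Real.log t ^ β = Z at *
  generalize Real.log s = a at *
  generalize Real.log t = b at *
  obtain ⟨a, rfl⟩ := exists_exp hls
  obtain ⟨b, rfl⟩ := exists_exp hlt
  obtain ⟨z, rfl⟩ := exists_exp hZ
  obtain ⟨s, rfl⟩ := exists_exp hs0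
  obtain ⟨t, rfl⟩ := exists_exp ht0
  simp only [← Real.exp_add, ← Real.exp_mul, ← Real.exp_sub]
  congr 1
  subst hqp
  field_simp
  ring

end Helpers

/-- **Theorem 1.3.** For `p > 1`, `0 < α, β ≤ 1`, `−1 < μ, ν < p − 1`, the operator
`H̃^{μ,ν}_{p,α,β}` is bounded on `l^p` and its operator norm equals
`α^{-1/p} β^{-1/p'} B((1+μ)/p, (p−1−ν)/p)`: this value is the least constant `C` with
`‖H̃ a‖_p ≤ C ‖a‖_p` for all `a ∈ l^p`. -/
theorem tilde_generalized_multiplicative_hilbert_norm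
    (p q α β μ ν : ℝ) (hp : 1 < p) (hq : 1 / p + 1 / q = 1)
    (hα0 : 0 < α) (hα1 : α ≤ 1) (hβ0 : 0 < β) (hβ1 : β ≤ 1)
    (hμ1 : -1 < μ) (hμ2 : μ < p - 1) (hν1 : -1 < ν) (hν2 : ν < p - 1) :
    IsLeast {C : ℝ≥0∞ | ∀ a : ℕ → ℂ, lpNorm p a ≠ ⊤ →
        lpNorm p (tildeH p q α β μ ν a) ≤ C * lpNorm p a}
      (ENNReal.ofReal
        (α ^ (-(1 / p)) * β ^ (-(1 / q)) * betaFn ((1 + μ) / p) ((p - 1 - ν) / p))) := by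
  have hp0 : 0 < p := by linarith
  set u := (1 + μ) / p with hu
  set v := (p - 1 - ν) / p with hv
  have hu0 : 0 < u := div_pos (by linarith) hp0
  have hv0 : 0 < v := div_pos (by linarith) hp0
  have hu1 : u < 1 := by rw [hu, div_lt_one hp0]; linarith
  have hv1 : v < 1 := by rw [hv, div_lt_one hp0]; linarith
  have hn2 : ∀ n : ℕ, (1 : ℝ) < (n : ℝ) + 2 := fun n => by
    have : (0 : ℝ) ≤ n := n.cast_nonneg
    linarith
  have hKpos : ∀ m n : ℕ, 0 ≤ Kr p q α β u v ((m : ℝ) + 2) ((n : ℝ) + 2) := fun m n => by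
    have := log_two_pos' m
    have := log_two_pos' n
    unfold Kr
    positivity
  have hH : ∀ (a : ℕ → ℂ) (m : ℕ), tildeH p q α β μ ν a (m + 2) =
      ∑' n : ℕ, ((Kr p q α β u v ((m : ℝ) + 2) ((n : ℝ) + 2) : ℝ) : ℂ) * a (n + 2) := by
    intro a m
    unfold tildeH
    rw [← tsum_mul_left]
    refine tsum_congr fun n => ?_
    rw [← mul_assoc, ← Complex.ofReal_mul]
    congr 2
    have := kernel_eq (α := α) (β := β) (μ := μ) (ν := ν) hp hq (hn2 m) (hn2 n)
    rw [← this]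
    push_cast
    rfl
  have hconst : ENNReal.ofReal (α ^ (-(1 / p)) * β ^ (-(1 / q)) * betaFn u v) =
      ENNReal.ofReal (α ^ (-(1 / p)) * β ^ (-(1 / q))) * Bl u v := by
    rw [ENNReal.ofReal_mul (by positivity), Bl_eq hu0 hv0]
  rw [hconst]
  have hfin : ENNReal.ofReal (α ^ (-(1 / p)) * β ^ (-(1 / q))) * Bl u v ≠ ⊤ := by
    rw [← hconst]; exact ENNReal.ofReal_ne_top
  constructor
  · intro a ha
    unfold lpNorm
    have h := upper hp hq hα0 hα1 hβ0 hβ1 hu0 hu1 hv0 hv1 (fun n => (‖a (n + 2)‖₊ : ℝ≥0∞))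
    have h1 : ∑' m : ℕ, (‖tildeH p q α β μ ν a (m + 2)‖₊ : ℝ≥0∞) ^ p ≤
        (ENNReal.ofReal (α ^ (-(1 / p)) * β ^ (-(1 / q))) * Bl u v) ^ p *
          ∑' n : ℕ, (‖a (n + 2)‖₊ : ℝ≥0∞) ^ p := by
      refine le_trans (ENNReal.tsum_le_tsum fun m => ENNReal.rpow_le_rpow ?_ hp0.le) h
      rw [hH]
      refine (enorm_tsum_le_tsum_enorm (f := fun n : ℕ =>
        ((Kr p q α β u v ((m : ℝ) + 2) ((n : ℝ) + 2) : ℝ) : ℂ) * a (n + 2))).trans (le_of_eq ?_)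
      refine tsum_congr fun n => ?_
      rw [enorm_mul]
      congr 1
      rw [← ofReal_norm, Complex.norm_real, Real.norm_of_nonneg (hKpos m n)]
    refine (ENNReal.rpow_le_rpow h1 (by positivity : (0 : ℝ) ≤ 1 / p)).trans (le_of_eq ?_)
    rw [ENNReal.mul_rpow_of_nonneg _ _ (by positivity), ← ENNReal.rpow_mul,
      mul_one_div_cancel hp0.ne', ENNReal.rpow_one]
  · intro C hC
    have hC' : ∀ b : ℕ → ℝ, (∀ n, 0 ≤ b n) → ∑' n, ENNReal.ofReal (b n) ^ p ≠ ⊤ →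
        ∑' m : ℕ, (∑' n : ℕ, ENNReal.ofReal (Kr p q α β u v ((m : ℝ) + 2) ((n : ℝ) + 2)) *
          ENNReal.ofReal (b n)) ^ p ≤ C ^ p * ∑' n, ENNReal.ofReal (b n) ^ p := by
      intro b hb hbt
      have hup := upper hp hq hα0 hα1 hβ0 hβ1 hu0 hu1 hv0 hv1 (fun n => ENNReal.ofReal (b n))
      have hupt := ne_top_of_le_ne_top (ENNReal.mul_ne_top
        (ENNReal.rpow_ne_top_of_nonneg hp0.le hfin) hbt) hup
      let a : ℕ → ℂ := fun n => ((b (n - 2) : ℝ) : ℂ)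
      have hae : ∀ n, (‖a (n + 2)‖₊ : ℝ≥0∞) = ENNReal.ofReal (b n) := by
        intro n
        change ‖a (n + 2)‖ₑ = _
        rw [← ofReal_norm]
        simp only [a, Nat.add_sub_cancel, Complex.norm_real, Real.norm_of_nonneg (hb n)]
      have hHe : ∀ m, (‖tildeH p q α β μ ν a (m + 2)‖₊ : ℝ≥0∞) =
          ∑' n : ℕ, ENNReal.ofReal (Kr p q α β u v ((m : ℝ) + 2) ((n : ℝ) + 2)) *
          ENNReal.ofReal (b n) := by
        intro m
        have hpos : ∀ n : ℕ, 0 ≤ Kr p q α β u v ((m : ℝ) + 2) ((n : ℝ) + 2) * b n :=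
          fun n => mul_nonneg (hKpos m n) (hb n)
        have hrow := ENNReal.ne_top_of_tsum_ne_top hupt m
        have hrow' : ∑' n : ℕ, ENNReal.ofReal (Kr p q α β u v ((m : ℝ) + 2) ((n : ℝ) + 2)) *
          ENNReal.ofReal (b n) ≠ ⊤ := by
          intro h
          rw [h, ENNReal.top_rpow_of_pos hp0] at hrow
          exact hrow rfl
        simp only [← ENNReal.ofReal_mul (hKpos m _)] at hrow' ⊢
        have hsumm : Summable (fun n : ℕ => Kr p q α β u v ((m : ℝ) + 2) ((n : ℝ) + 2) * b n) := by
          have := ENNReal.summable_toReal hrow'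
          refine this.congr fun n => ?_
          rw [ENNReal.toReal_ofReal (hpos n)]
        rw [← ENNReal.ofReal_tsum_of_nonneg hpos hsumm, hH]
        change ‖∑' n : ℕ, ((Kr p q α β u v ((m : ℝ) + 2) ((n : ℝ) + 2) : ℝ) : ℂ) * a (n + 2)‖ₑ = _
        rw [← ofReal_norm]
        congr 1
        simp only [a, Nat.add_sub_cancel, ← Complex.ofReal_mul, ← Complex.ofReal_tsum,
          Complex.norm_real]
        exact Real.norm_of_nonneg (tsum_nonneg hpos)
      have h := hC a (by
        unfold lpNorm
        simp only [hae]
        exact ENNReal.rpow_ne_top_of_nonneg (by positivity) hbt)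
      unfold lpNorm at h
      simp only [hae, hHe] at h
      have h2 := ENNReal.rpow_le_rpow h hp0.le
      rwa [ENNReal.mul_rpow_of_nonneg _ _ hp0.le, ← ENNReal.rpow_mul, ← ENNReal.rpow_mul,
        one_div_mul_cancel hp0.ne', ENNReal.rpow_one, ENNReal.rpow_one] at h2
    rw [Bl_symm, ← Jl_sup, ENNReal.mul_iSup]
    refine iSup_le fun k => ?_
    have hk : (0 : ℝ) ≤ k := k.cast_nonneg
    exact lower_main hp hq hα0 hα1 hβ0 hβ1 hu0 hu1 hv0 hv1 (by linarith) hC'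
end

section
/- Let p > 1, 0 < α ≤ 1, 0 < β ≤ 1, and −1 < μ, ν < p−1. For every a ∈ l^p, ‖H̃^{μ,ν}_{p,α,β} a‖_p ≤ α^{−1/p} · β^{−1/p'} · B((1+μ)/p, (p−1−ν)/p) · ‖a‖_p, where B denotes the Beta function. -/
open scoped ENNReal

open MeasureTheory Set in
lemma hil_sum_le (θ : ℝ) (h0 : 0 < θ) (h1 : θ ≤ 1) (g : ℝ → ℝ) (hg0 : ∀ t, 0 < t → 0 ≤ g t)
    (hg : AntitoneOn g (Ioi 0)) :
    ∑' n : ℕ, ENNReal.ofReal (g (Real.log ((n : ℝ) + 2) ^ θ) *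
      (Real.log ((n : ℝ) + 2) ^ (θ - 1) / ((n : ℝ) + 2)))
    ≤ ENNReal.ofReal (1 / θ) * ∫⁻ t in Ioi (0 : ℝ), ENNReal.ofReal (g t) := by
  set F : ℝ → ℝ≥0∞ := fun x => ENNReal.ofReal (g (Real.log x ^ θ) *
      (Real.log x ^ (θ - 1) / x)) with hF
  have hanti : ∀ x y, 1 < x → x ≤ y → F y ≤ F x := by
    intro x y hx hxy
    have hlx : 0 < Real.log x := Real.log_pos hx
    have hll : Real.log x ≤ Real.log y := Real.log_le_log (by linarith) hxy
    have hly : 0 < Real.log y := by linarith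
    apply ENNReal.ofReal_le_ofReal
    have a1 : g (Real.log y ^ θ) ≤ g (Real.log x ^ θ) :=
      hg (Real.rpow_pos_of_pos hlx _) (Real.rpow_pos_of_pos hly _)
        (Real.rpow_le_rpow hlx.le hll h0.le)
    have a2 : Real.log y ^ (θ - 1) ≤ Real.log x ^ (θ - 1) :=
      Real.rpow_le_rpow_of_nonpos hlx hll (by linarith)
    have a3 : 0 ≤ Real.log y ^ (θ - 1) := Real.rpow_nonneg hly.le _
    have a4 : 0 ≤ g (Real.log x ^ θ) := hg0 _ (Real.rpow_pos_of_pos hlx _)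
    have a5 : Real.log y ^ (θ - 1) / y ≤ Real.log x ^ (θ - 1) / x :=
      div_le_div₀ (a3.trans a2) a2 (by linarith) hxy
    exact mul_le_mul a1 a5 (div_nonneg a3 (by linarith)) a4
  have step1 : ∑' n : ℕ, F ((n : ℝ) + 2) ≤ ∫⁻ x in Ioi (1 : ℝ), F x := by
    calc ∑' n : ℕ, F ((n : ℝ) + 2)
        ≤ ∑' n : ℕ, ∫⁻ x in Ioc ((n : ℝ) + 1) ((n : ℝ) + 2), F x := by
          apply ENNReal.tsum_le_tsum
          intro n
          calc F ((n : ℝ) + 2) = ∫⁻ x in Ioc ((n : ℝ) + 1) ((n : ℝ) + 2), F ((n : ℝ) + 2) := by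
                rw [setLIntegral_const, Real.volume_Ioc]
                norm_num
            _ ≤ _ := by
                apply setLIntegral_mono' measurableSet_Ioc
                intro x hx
                have : (0 : ℝ) ≤ n := n.cast_nonneg
                exact hanti _ _ (by linarith [hx.1]) hx.2
      _ = ∫⁻ x in ⋃ n : ℕ, Ioc ((n : ℝ) + 1) ((n : ℝ) + 2), F x := by
          rw [lintegral_iUnion (fun _ => measurableSet_Ioc)]
          intro i j hij
          rw [Function.onFun, Set.disjoint_left]
          intro x hx hy
          apply hij
          have b1 : (i : ℝ) < j + 1 := by linarith [hx.1, hy.2]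
          have b2 : (j : ℝ) < i + 1 := by linarith [hx.2, hy.1]
          have b1' : i < j + 1 := by exact_mod_cast b1
          have b2' : j < i + 1 := by exact_mod_cast b2
          omega
      _ ≤ _ := by
          apply lintegral_mono_set
          apply iUnion_subset
          intro n x hx
          have : (0 : ℝ) ≤ n := n.cast_nonneg
          exact mem_Ioi.2 (by linarith [hx.1])
  refine step1.trans ?_
  have step2 := lintegral_image_eq_lintegral_abs_deriv_mul (s := Ioi (1 : ℝ))
    (f := fun x => Real.log x ^ θ) (f' := fun x => (1 / x) * θ * Real.log x ^ (θ - 1))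
    measurableSet_Ioi ?_ ?_ (fun t => ENNReal.ofReal (g t))
  · calc ∫⁻ x in Ioi (1 : ℝ), F x
        = ∫⁻ x in Ioi (1 : ℝ), ENNReal.ofReal (1 / θ) *
          (ENNReal.ofReal |(1 / x) * θ * Real.log x ^ (θ - 1)| *
            ENNReal.ofReal (g (Real.log x ^ θ))) := by
          apply setLIntegral_congr_fun measurableSet_Ioi
          intro x hx
          have hx' : (1 : ℝ) < x := hx
          have hlx : 0 < Real.log x := Real.log_pos hx
          have h2 : 0 < Real.log x ^ (θ - 1) := Real.rpow_pos_of_pos hlx _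
          have hx0 : 0 < x := by linarith
          simp only [hF]
          rw [abs_of_nonneg (by positivity), ← ENNReal.ofReal_mul (by positivity),
            ← ENNReal.ofReal_mul (by positivity)]
          congr 1
          field_simp
      _ = ENNReal.ofReal (1 / θ) * ∫⁻ x in (fun x => Real.log x ^ θ) '' Ioi (1 : ℝ),
            ENNReal.ofReal (g x) := by
          rw [lintegral_const_mul' _ _ ENNReal.ofReal_ne_top, step2]
      _ ≤ _ := by
          gcongr
          rintro _ ⟨x, hx, rfl⟩
          exact Real.rpow_pos_of_pos (Real.log_pos hx) _
  · intro x hx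
    have hx' : (1 : ℝ) < x := hx
    have hlx : 0 < Real.log x := Real.log_pos hx
    have := ((Real.hasDerivAt_log (by linarith : x ≠ 0)).rpow_const (p := θ)
      (Or.inl hlx.ne')).hasDerivWithinAt (s := Ioi 1)
    simpa using this
  · intro x hx y hy hxy
    have hx' : (1 : ℝ) < x := hx
    have hy' : (1 : ℝ) < y := hy
    have := (Real.rpow_left_inj (Real.log_pos hx).le (Real.log_pos hy).le h0.ne').1 hxy
    exact Real.log_injOn_pos (mem_Ioi.2 (by linarith)) (mem_Ioi.2 (by linarith)) this

open MeasureTheory Set in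
/-- the Beta integral as a lower integral -/
noncomputable def hilB (u v : ℝ) : ℝ≥0∞ :=
  ∫⁻ t in Ioi (0 : ℝ), ENNReal.ofReal (t ^ (u - 1) / (1 + t) ^ (u + v))

open MeasureTheory Set in
lemma hilB_scale (u v c : ℝ) (hc : 0 < c) :
    ∫⁻ t in Ioi (0 : ℝ), ENNReal.ofReal (c ^ v * t ^ (u - 1) / (c + t) ^ (u + v)) = hilB u v := by
  have himg : (fun t => c * t) '' Ioi (0 : ℝ) = Ioi 0 := by
    ext x
    constructor
    · rintro ⟨t, ht, rfl⟩
      exact mul_pos hc ht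
    · intro hx
      exact ⟨x / c, div_pos hx hc, by field_simp⟩
  have h := lintegral_image_eq_lintegral_abs_deriv_mul (s := Ioi (0 : ℝ))
    (f := fun t => c * t) (f' := fun _ => c) measurableSet_Ioi
    (fun x _ => by simpa using ((hasDerivAt_id x).const_mul c).hasDerivWithinAt)
    (fun x _ y _ hxy => mul_left_cancel₀ hc.ne' hxy)
    (fun t => ENNReal.ofReal (c ^ v * t ^ (u - 1) / (c + t) ^ (u + v)))
  rw [himg] at h
  rw [h, hilB]
  apply setLIntegral_congr_fun measurableSet_Ioi
  intro t ht
  have ht' : (0 : ℝ) < t := ht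
  simp only
  rw [abs_of_pos hc, ← ENNReal.ofReal_mul hc.le]
  congr 1
  have e1 : c + c * t = c * (1 + t) := by ring
  rw [e1, Real.mul_rpow hc.le ht'.le, Real.mul_rpow hc.le (by linarith), Real.rpow_add hc,
    Real.rpow_sub_one hc.ne']
  have p1 := Real.rpow_pos_of_pos hc u
  have p2 := Real.rpow_pos_of_pos hc v
  have p3 := Real.rpow_pos_of_pos (by linarith : 0 < 1 + t) (u + v)
  field_simp

open MeasureTheory Set in
lemma hilB_symm (u v : ℝ) : hilB u v = hilB v u := by
  have himg : (fun t : ℝ => t⁻¹) '' Ioi (0 : ℝ) = Ioi 0 := by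
    ext x
    constructor
    · rintro ⟨t, ht, rfl⟩
      exact inv_pos.2 (mem_Ioi.1 ht)
    · intro hx
      exact ⟨x⁻¹, inv_pos.2 (mem_Ioi.1 hx), by simp⟩
  have h := lintegral_image_eq_lintegral_abs_deriv_mul (s := Ioi (0 : ℝ))
    (f := fun t => t⁻¹) (f' := fun t => -(t ^ 2)⁻¹) measurableSet_Ioi
    (fun x hx => (hasDerivAt_inv (ne_of_gt hx)).hasDerivWithinAt)
    (fun x _ y _ hxy => inv_injective hxy)
    (fun t => ENNReal.ofReal (t ^ (u - 1) / (1 + t) ^ (u + v)))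
  rw [himg] at h
  rw [hilB, h, hilB]
  apply setLIntegral_congr_fun measurableSet_Ioi
  intro t ht
  have ht' : (0 : ℝ) < t := ht
  simp only
  rw [abs_neg, abs_of_pos (by positivity), ← ENNReal.ofReal_mul (by positivity)]
  congr 1
  have e1 : 1 + t⁻¹ = (1 + t) / t := by field_simp; ring
  rw [e1, Real.inv_rpow ht'.le, Real.div_rpow (by linarith) ht'.le, Real.rpow_sub_one ht'.ne',
    Real.rpow_sub_one ht'.ne', Real.rpow_add ht', add_comm v u]
  have p1 := Real.rpow_pos_of_pos ht' u
  have p2 := Real.rpow_pos_of_pos ht' v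
  have p3 := Real.rpow_pos_of_pos (by linarith : 0 < 1 + t) (u + v)
  field_simp

open MeasureTheory Set in
lemma hilB_eq (u v : ℝ) (hu : 0 < u) (hv : 0 < v) : hilB u v = ENNReal.ofReal (betaFn u v) := by
  have hm : Measurable (fun t : ℝ => t ^ (u - 1) / (1 + t) ^ (u + v)) := by fun_prop
  have hi : IntegrableOn (fun t : ℝ => t ^ (u - 1) / (1 + t) ^ (u + v)) (Ioi 0) := by
    rw [← Ioc_union_Ioi_eq_Ioi zero_le_one]
    apply IntegrableOn.union
    · have : IntegrableOn (fun t : ℝ => t ^ (u - 1)) (Ioc 0 1) := by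
        rw [integrableOn_Ioc_iff_integrableOn_Ioo]
        exact (intervalIntegral.integrableOn_Ioo_rpow_iff one_pos).2 (by linarith)
      refine Integrable.mono' this hm.aestronglyMeasurable ?_
      filter_upwards [ae_restrict_mem measurableSet_Ioc] with t ht
      have h1 : 1 ≤ (1 + t) ^ (u + v) := Real.one_le_rpow (by linarith [ht.1]) (by linarith)
      have h2 : 0 ≤ t ^ (u - 1) := Real.rpow_nonneg ht.1.le _
      rw [Real.norm_of_nonneg (by positivity)]
      exact div_le_self h2 h1
    · have : IntegrableOn (fun t : ℝ => t ^ (-v - 1)) (Ioi 1) :=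
        integrableOn_Ioi_rpow_of_lt (by linarith) one_pos
      refine Integrable.mono' this hm.aestronglyMeasurable ?_
      filter_upwards [ae_restrict_mem measurableSet_Ioi] with t ht
      have ht' : (1 : ℝ) < t := ht
      have ht0 : (0 : ℝ) < t := by linarith
      have h1 : t ^ (u + v) ≤ (1 + t) ^ (u + v) :=
        Real.rpow_le_rpow ht0.le (by linarith) (by linarith)
      have h0 : 0 < t ^ (u + v) := Real.rpow_pos_of_pos ht0 _
      have h2 : 0 ≤ t ^ (u - 1) := Real.rpow_nonneg ht0.le _
      rw [Real.norm_of_nonneg (by positivity)]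
      calc _ ≤ t ^ (u - 1) / t ^ (u + v) := div_le_div_of_nonneg_left h2 h0 h1
        _ = t ^ (-v - 1) := by
          rw [← Real.rpow_sub ht0]
          congr 1
          ring
  rw [betaFn, ofReal_integral_eq_lintegral_ofReal hi, hilB]
  filter_upwards [ae_restrict_mem measurableSet_Ioi] with t ht
  have ht' : (0 : ℝ) < t := ht
  positivity

open MeasureTheory Set in
lemma hil_row (θ u v c : ℝ) (h0 : 0 < θ) (h1 : θ ≤ 1) (hc : 0 < c) (hu1 : u ≤ 1)
    (huv : 0 ≤ u + v) :
    ∑' n : ℕ, ENNReal.ofReal (c ^ v * (Real.log ((n : ℝ) + 2) ^ θ) ^ (u - 1) /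
        (c + Real.log ((n : ℝ) + 2) ^ θ) ^ (u + v) *
      (Real.log ((n : ℝ) + 2) ^ (θ - 1) / ((n : ℝ) + 2)))
    ≤ ENNReal.ofReal (1 / θ) * hilB u v := by
  rw [← hilB_scale u v c hc]
  apply hil_sum_le θ h0 h1 (fun t => c ^ v * t ^ (u - 1) / (c + t) ^ (u + v))
  · intro t ht
    positivity
  · intro x hx y hy hxy
    have hx' : (0 : ℝ) < x := hx
    have hy' : (0 : ℝ) < y := hy
    have a1 : y ^ (u - 1) ≤ x ^ (u - 1) := Real.rpow_le_rpow_of_nonpos hx' hxy (by linarith)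
    have a2 : (c + x) ^ (u + v) ≤ (c + y) ^ (u + v) :=
      Real.rpow_le_rpow (by linarith) (by linarith) huv
    have a3 : 0 < (c + x) ^ (u + v) := by positivity
    show c ^ v * y ^ (u - 1) / (c + y) ^ (u + v) ≤ c ^ v * x ^ (u - 1) / (c + x) ^ (u + v)
    gcongr

open MeasureTheory in
lemma hil_schur (p q : ℝ) (hpq : p.HolderConjugate q) (K F G : ℕ → ℕ → ℝ≥0∞) (A B : ℝ≥0∞)
    (hK : ∀ m n, K m n ≤ F m n ^ (1 / q) * G m n ^ (1 / p))
    (hA : ∀ m, ∑' n, F m n ≤ A) (hB : ∀ n, ∑' m, G m n ≤ B) (x : ℕ → ℝ≥0∞) :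
    (∑' m, (∑' n, K m n * x n) ^ p) ^ (1 / p)
      ≤ A ^ (1 / q) * B ^ (1 / p) * (∑' n, x n ^ p) ^ (1 / p) := by
  have hp0 : 0 < p := hpq.pos
  have hq0 : 0 < q := hpq.symm.pos
  have key : ∀ m, (∑' n, K m n * x n) ^ p ≤ (A ^ (1 / q)) ^ p * ∑' n, G m n * x n ^ p := by
    intro m
    have h := ENNReal.lintegral_mul_le_Lp_mul_Lq (Measure.count : Measure ℕ) hpq.symm
      (f := fun n => F m n ^ (1 / q)) (g := fun n => G m n ^ (1 / p) * x n)
      (measurable_from_nat).aemeasurable (measurable_from_nat).aemeasurable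
    simp only [lintegral_count, Pi.mul_apply] at h
    have e1 : ∀ n, (F m n ^ (1 / q)) ^ q = F m n := fun n => by
      rw [← ENNReal.rpow_mul, one_div_mul_cancel hq0.ne', ENNReal.rpow_one]
    have e2 : ∀ n, (G m n ^ (1 / p) * x n) ^ p = G m n * x n ^ p := fun n => by
      rw [ENNReal.mul_rpow_of_nonneg _ _ hp0.le, ← ENNReal.rpow_mul,
        one_div_mul_cancel hp0.ne', ENNReal.rpow_one]
    simp only [e1, e2] at h
    have h2 : ∑' n, K m n * x n ≤ A ^ (1 / q) * (∑' n, G m n * x n ^ p) ^ (1 / p) := by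
      calc ∑' n, K m n * x n ≤ ∑' n, F m n ^ (1 / q) * (G m n ^ (1 / p) * x n) := by
            apply ENNReal.tsum_le_tsum
            intro n
            rw [← mul_assoc]
            gcongr
            exact hK m n
        _ ≤ _ := h
        _ ≤ _ := by
            gcongr
            exact hA m
    calc _ ≤ (A ^ (1 / q) * (∑' n, G m n * x n ^ p) ^ (1 / p)) ^ p := by gcongr
      _ = _ := by
        rw [ENNReal.mul_rpow_of_nonneg _ _ hp0.le, ← ENNReal.rpow_mul _ (1 / p) p,
          one_div_mul_cancel hp0.ne', ENNReal.rpow_one]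
  have h3 : ∑' m, (∑' n, K m n * x n) ^ p ≤ (A ^ (1 / q)) ^ p * (B * ∑' n, x n ^ p) := by
    calc _ ≤ ∑' m, (A ^ (1 / q)) ^ p * ∑' n, G m n * x n ^ p := ENNReal.tsum_le_tsum key
      _ = (A ^ (1 / q)) ^ p * ∑' n, (∑' m, G m n) * x n ^ p := by
        rw [ENNReal.tsum_mul_left, ENNReal.tsum_comm]
        simp only [ENNReal.tsum_mul_right]
      _ ≤ (A ^ (1 / q)) ^ p * ∑' n, B * x n ^ p := by
        gcongr with n
        exact hB n
      _ = _ := by rw [ENNReal.tsum_mul_left]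
  calc _ ≤ ((A ^ (1 / q)) ^ p * (B * ∑' n, x n ^ p)) ^ (1 / p) := by gcongr
    _ = _ := by
      rw [ENNReal.mul_rpow_of_nonneg _ _ (by positivity), ENNReal.mul_rpow_of_nonneg _ _
        (by positivity), ← ENNReal.rpow_mul _ p (1 / p), mul_one_div_cancel hp0.ne',
        ENNReal.rpow_one, mul_assoc]

/-- The algebraic factorisation of the kernel. -/
lemma hil_kernel (p q α β μ ν l k M N : ℝ) (hp : 1 < p) (hq0 : 0 < q) (hq : 1 / p + 1 / q = 1)
    (hl : 0 < l) (hk : 0 < k) (hM : 0 < M) (hN : 0 < N) :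
    (l ^ (((α - 1) + α * μ) / p) / M ^ (1 / p)) *
      (k ^ (((β - 1) - (q - 1) * β * ν) / q) /
        (N ^ (1 / q) * (l ^ α + k ^ β) ^ (1 + (μ - ν) / p))) =
    ((l ^ α) ^ ((1 + μ) / p) * (k ^ β) ^ ((p - 1 - ν) / p - 1) /
        (l ^ α + k ^ β) ^ ((p - 1 - ν) / p + (1 + μ) / p) * (k ^ (β - 1) / N)) ^ (1 / q) *
    ((k ^ β) ^ ((p - 1 - ν) / p) * (l ^ α) ^ ((1 + μ) / p - 1) /
        (k ^ β + l ^ α) ^ ((1 + μ) / p + (p - 1 - ν) / p) * (l ^ (α - 1) / M)) ^ (1 / p) := by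
  have hp0 : 0 < p := by linarith
  have hS : 0 < l ^ α + k ^ β := by positivity
  rw [add_comm (k ^ β) (l ^ α)]
  apply Real.log_injOn_pos
  · exact Set.mem_Ioi.2 (by positivity)
  · exact Set.mem_Ioi.2 (by positivity)
  have hqe : q = p / (p - 1) := by
    have : p - 1 ≠ 0 := by linarith
    field_simp at hq ⊢
    linarith
  have hSlog := Real.log_rpow hS
  have hlog1 := Real.log_rpow hl
  have hlog2 := Real.log_rpow hk
  have hlog3 := Real.log_rpow hM
  have hlog4 := Real.log_rpow hN
  have n1 : ∀ y : ℝ, l ^ y ≠ 0 := fun y => (Real.rpow_pos_of_pos hl y).ne'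
  have n2 : ∀ y : ℝ, k ^ y ≠ 0 := fun y => (Real.rpow_pos_of_pos hk y).ne'
  have n5 : ∀ y : ℝ, (l ^ α + k ^ β) ^ y ≠ 0 := fun y => (Real.rpow_pos_of_pos hS y).ne'
  have n3 : ∀ y : ℝ, M ^ y ≠ 0 := fun y => (Real.rpow_pos_of_pos hM y).ne'
  have n4 : ∀ y : ℝ, N ^ y ≠ 0 := fun y => (Real.rpow_pos_of_pos hN y).ne'
  have n6 : ∀ y : ℝ, (l ^ α) ^ y ≠ 0 := fun y => (by positivity)
  have n7 : ∀ y : ℝ, (k ^ β) ^ y ≠ 0 := fun y => (by positivity)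
  have r1 := Real.log_rpow (Real.rpow_pos_of_pos hl α)
  have r2 := Real.log_rpow (Real.rpow_pos_of_pos hk β)
  rw [Real.log_mul (by positivity) (by positivity), Real.log_mul (by positivity) (by positivity),
    Real.log_rpow (by positivity), Real.log_rpow (by positivity),
    Real.log_mul (by positivity) (by positivity), Real.log_mul (by positivity) (by positivity)]
  rw [Real.log_div (n1 _) (n3 _), Real.log_div (n2 _) (by positivity),
    Real.log_mul (n4 _) (n5 _), Real.log_div (by positivity) (n5 _),
    Real.log_div (by positivity) (n5 _), Real.log_div (n2 _) hN.ne', Real.log_div (n1 _) hM.ne',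
    Real.log_mul (n6 _) (n7 _), Real.log_mul (n7 _) (n6 _)]
  simp only [hSlog, hlog1, hlog2, hlog3, hlog4, r1, r2]
  have : p - 1 ≠ 0 := by linarith
  rw [hqe]
  field_simp
  ring

theorem tilde_generalized_multiplicative_hilbert_norm_le
    (p q α β μ ν : ℝ) (hp : 1 < p) (hq : 1 / p + 1 / q = 1)
    (hα0 : 0 < α) (hα1 : α ≤ 1) (hβ0 : 0 < β) (hβ1 : β ≤ 1)
    (hμ1 : -1 < μ) (hμ2 : μ < p - 1) (hν1 : -1 < ν) (hν2 : ν < p - 1) :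
    ∀ a : ℕ → ℂ, lpNorm p a ≠ ⊤ →
      lpNorm p (tildeH p q α β μ ν a) ≤
        ENNReal.ofReal
          (α ^ (-(1 / p)) * β ^ (-(1 / q)) * betaFn ((1 + μ) / p) ((p - 1 - ν) / p)) *
          lpNorm p a := by
  intro a _
  have hpq : p.HolderConjugate q := Real.holderConjugate_iff.2 ⟨hp, by simpa using hq⟩
  have hp0 : 0 < p := hpq.pos
  have hq0 : 0 < q := hpq.symm.pos
  have hu : 0 < (p - 1 - ν) / p := div_pos (by linarith) hp0
  have hv : 0 < (1 + μ) / p := div_pos (by linarith) hp0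
  have hu1 : (p - 1 - ν) / p ≤ 1 := (div_le_one hp0).2 (by linarith)
  have hv1 : (1 + μ) / p ≤ 1 := (div_le_one hp0).2 (by linarith)
  have hlog : ∀ n : ℕ, 0 < Real.log ((n : ℝ) + 2) := fun n =>
    Real.log_pos (by have : (0 : ℝ) ≤ n := n.cast_nonneg
                     linarith)
  have hpos : ∀ n : ℕ, (0 : ℝ) < (n : ℝ) + 2 := fun n => by positivity
  set u := (p - 1 - ν) / p with hudef
  set v := (1 + μ) / p with hvdef
  let X : ℕ → ℝ := fun m => Real.log ((m : ℝ) + 2) ^ α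
  let Y : ℕ → ℝ := fun n => Real.log ((n : ℝ) + 2) ^ β
  have hX : ∀ m, 0 < X m := fun m => Real.rpow_pos_of_pos (hlog m) _
  have hY : ∀ m, 0 < Y m := fun m => Real.rpow_pos_of_pos (hlog m) _
  let c : ℕ → ℝ := fun m => Real.log ((m : ℝ) + 2) ^ (((α - 1) + α * μ) / p) /
    ((m : ℝ) + 2) ^ (1 / p)
  let d : ℕ → ℕ → ℝ := fun m n => Real.log ((n : ℝ) + 2) ^ (((β - 1) - (q - 1) * β * ν) / q) /
    (((n : ℝ) + 2) ^ (1 / q) * (X m + Y n) ^ (1 + (μ - ν) / p))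
  let f : ℕ → ℕ → ℝ := fun m n => X m ^ v * Y n ^ (u - 1) / (X m + Y n) ^ (u + v) *
    (Real.log ((n : ℝ) + 2) ^ (β - 1) / ((n : ℝ) + 2))
  let g : ℕ → ℕ → ℝ := fun m n => Y n ^ u * X m ^ (v - 1) / (Y n + X m) ^ (v + u) *
    (Real.log ((m : ℝ) + 2) ^ (α - 1) / ((m : ℝ) + 2))
  have hc : ∀ m, 0 ≤ c m := fun m =>
    div_nonneg (Real.rpow_nonneg (hlog m).le _) (Real.rpow_nonneg (hpos m).le _)
  have hd : ∀ m n, 0 ≤ d m n := fun m n => by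
    have := hX m; have := hY n; have := hlog n
    positivity
  have hf : ∀ m n, 0 ≤ f m n := fun m n => by
    have := hX m; have := hY n; have := hlog n
    positivity
  have hg : ∀ m n, 0 ≤ g m n := fun m n => by
    have := hX m; have := hY n; have := hlog m
    positivity
  have hcd : ∀ m n, c m * d m n = f m n ^ (1 / q) * g m n ^ (1 / p) := fun m n =>
    hil_kernel p q α β μ ν _ _ _ _ hp hq0 hq (hlog m) (hlog n) (hpos m) (hpos n)
  have hS := hil_schur p q hpq (fun m n => ENNReal.ofReal (c m * d m n))
    (fun m n => ENNReal.ofReal (f m n)) (fun m n => ENNReal.ofReal (g m n))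
    (ENNReal.ofReal (1 / β) * hilB u v) (ENNReal.ofReal (1 / α) * hilB v u)
    (fun m n => by
      rw [hcd, ENNReal.ofReal_mul (Real.rpow_nonneg (hf m n) _),
        ENNReal.ofReal_rpow_of_nonneg (hf m n) (by positivity),
        ENNReal.ofReal_rpow_of_nonneg (hg m n) (by positivity)])
    (fun m => hil_row β u v (X m) hβ0 hβ1 (hX m) hu1 (by linarith))
    (fun n => hil_row α v u (Y n) hα0 hα1 (hY n) hv1 (by linarith))
    (fun n => (‖a (n + 2)‖₊ : ℝ≥0∞))
  have hconst : (ENNReal.ofReal (1 / β) * hilB u v) ^ (1 / q) *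
      (ENNReal.ofReal (1 / α) * hilB v u) ^ (1 / p) =
      ENNReal.ofReal (α ^ (-(1 / p)) * β ^ (-(1 / q)) * betaFn v u) := by
    have hb : 0 ≤ betaFn v u := by
      apply MeasureTheory.setIntegral_nonneg measurableSet_Ioi
      intro t ht
      have ht' : (0 : ℝ) < t := ht
      positivity
    rw [hilB_symm u v, hilB_eq v u hv hu, ← ENNReal.ofReal_mul (by positivity),
      ← ENNReal.ofReal_mul (by positivity),
      ENNReal.ofReal_rpow_of_nonneg (by positivity) (by positivity),
      ENNReal.ofReal_rpow_of_nonneg (by positivity) (by positivity),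
      ← ENNReal.ofReal_mul (by positivity)]
    congr 1
    rw [Real.mul_rpow (by positivity) hb, Real.mul_rpow (by positivity) hb,
      Real.div_rpow zero_le_one hβ0.le, Real.div_rpow zero_le_one hα0.le, Real.rpow_neg hα0.le,
      Real.rpow_neg hβ0.le, Real.one_rpow, Real.one_rpow]
    have hbb : betaFn v u ^ (1 / q) * betaFn v u ^ (1 / p) = betaFn v u := by
      rw [← Real.rpow_add_of_nonneg hb (by positivity) (by positivity), add_comm, hq,
        Real.rpow_one]
    calc _ = (β ^ (1 / q))⁻¹ * (α ^ (1 / p))⁻¹ *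
          (betaFn v u ^ (1 / q) * betaFn v u ^ (1 / p)) := by ring
      _ = _ := by rw [hbb]; ring
  rw [hconst] at hS
  refine le_trans ?_ hS
  unfold lpNorm
  gcongr with m
  have hT : tildeH p q α β μ ν a (m + 2) = (c m : ℂ) * ∑' n : ℕ, (d m n : ℂ) * a (n + 2) := by
    simp only [tildeH, c, d, X, Y]
    push_cast
    rfl
  rw [hT, ← tsum_mul_left]
  change ‖∑' n : ℕ, (c m : ℂ) * ((d m n : ℂ) * a (n + 2))‖ₑ ≤ _
  refine enorm_tsum_le_tsum_enorm.trans (ENNReal.tsum_le_tsum fun n => le_of_eq ?_)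
  rw [← mul_assoc, ← Complex.ofReal_mul, enorm_mul]
  congr 1
  rw [← ofReal_norm_eq_enorm, Complex.norm_real, Real.norm_of_nonneg (mul_nonneg (hc m) (hd m n))]
end
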